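/- arXiv:1906.07173 — 4 statements merged into one kernel-verified Lean document; each statement's English description precedes it below -/
import Mathlib

section
/- Let ε∈(0,1], τ>0 and δ = min{δ₀, εα/(8(d+β+2)), ε/(dη₁²)}. There exists c such that for all a,b∈ℝ, t∈(0,τ], x,y∈ℝ and i,j,k∈{1,…,d}: (1) ∫_ℝ |g_{i,t}^{(δ)}(x+aw)+g_{i,t}^{(δ)}(x−aw)−2g_{i,t}^{(δ)}(x)| μ_j^{(δ)}(w)dw ≤ c(|a|^α+|a|²)·t^{−β/α}·max_{|u|≤2δ} tilde-g_{i,t}^{(ε)}(x+au); (2) the same integral with μ_i^{(δ)} in place of μ_j^{(δ)} is ≤ c(|a|^α+|a|²)·t^{−1}·max_{|u|≤2δ} tilde-g_{i,t}^{(ε)}(x+au); (3) ∫_ℝ |g_{i,t}^{(δ)}(x+aw)−g_{i,t}^{(δ)}(x)|·|g_{k,t}^{(δ)}(y+bw)−g_{k,t}^{(δ)}(y)| μ_j^{(δ)}(w)dw ≤ c((|a||b|)^{α/2}+|a||b|)·t^{−β/α}·(max_{|u|≤2δ} tilde-g_{i,t}^{(ε)}(x+au))·(max_{|u|≤2δ}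 tilde-g_{k,t}^{(ε)}(y+bu)); (4) when i=j=k, the integral in (3) is ≤ c((|a||b|)^{α/2}+|a||b|)·t^{−1}·(max_{|u|≤2δ} tilde-g_{i,t}^{(ε)}(x+au))·(max_{|u|≤2δ} tilde-g_{i,t}^{(ε)}(y+bu)). -/
open Filter MeasureTheory

/-- The majorant `tilde-g_t^{(ε)}(x)`: equal to `(1/h^{-1}(1/t)) ∧ (t h(|x|)/|x|)` for
`|x| < ε` (with `h(0)/0 = ∞`) and to `c_ε t^p e^{-|x|}` for `|x| ≥ ε`, where
`p = (d+β-1)/α` and `c_ε = ((1/h^{-1}(1/τ)) ∧ (τ h(ε)/ε)) e^ε τ^{-p}`. -/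
noncomputable def tg (h hinv : ℝ → ℝ) (τ ε p t x : ℝ) : ℝ :=
  if x = 0 then 1 / hinv (1 / t)
  else if |x| < ε then min (1 / hinv (1 / t)) (t * h |x| / |x|)
  else min (1 / hinv (1 / τ)) (τ * h ε / ε) * Real.exp ε / τ ^ p *
    (t ^ p * Real.exp (-|x|))

namespace LV
open Complex Topology

structure Good (m : ℝ → ℝ) (R : ℝ) : Prop where
  Rpos : 0 < R
  meas : Measurable m
  nn : ∀ w, 0 ≤ m w
  even : ∀ w, m (-w) = m w
  int : Integrable (fun w => w ^ 2 * m w)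
  supp : ∀ w, R < |w| → m w = 0

noncomputable def psiC (m : ℝ → ℝ) (z : ℂ) : ℂ := ∫ w : ℝ, (1 - Complex.cos (z * w)) * (m w : ℂ)
noncomputable def psiR (m : ℝ → ℝ) (ξ : ℝ) : ℝ := ∫ w : ℝ, (1 - Real.cos (ξ * w)) * m w
noncomputable def AA (m : ℝ → ℝ) (κ : ℝ) : ℝ := ∫ w : ℝ, (Real.cosh (κ * w) - 1) * m w

lemma contour (f : ℂ → ℂ) (hf : Differentiable ℂ f) (b : ℝ → ℝ) (κ : ℝ) (hb : Integrable b)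
    (hb1 : Tendsto b atTop (𝓝 0)) (hb2 : Tendsto (fun T => b (-T)) atTop (𝓝 0))
    (hfb : ∀ ξ s : ℝ, |s| ≤ |κ| → ‖f (ξ + s * I)‖ ≤ b ξ) :
    ∫ ξ : ℝ, f ξ = ∫ ξ : ℝ, f (ξ + κ * I) := by
  have hc := hf.continuous
  have int1 : Integrable (fun ξ : ℝ => f ξ) := by
    refine hb.mono' (by fun_prop) (Eventually.of_forall fun ξ => ?_)
    simpa using hfb ξ 0 (by simp)
  have int2 : Integrable (fun ξ : ℝ => f (ξ + κ * I)) := by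
    refine hb.mono' (by fun_prop) (Eventually.of_forall fun ξ => ?_)
    exact hfb ξ κ le_rfl
  have t1 := intervalIntegral_tendsto_integral int1 tendsto_neg_atTop_atBot tendsto_id
  have t2 := intervalIntegral_tendsto_integral int2 tendsto_neg_atTop_atBot tendsto_id
  have C : ∀ T : ℝ, (∫ x : ℝ in -T..T, f x) - (∫ x : ℝ in -T..T, f (x + κ * I))
      = I * (∫ y : ℝ in (0:ℝ)..κ, f (-T + y * I)) - I * (∫ y : ℝ in (0:ℝ)..κ, f (T + y * I)) := by
    intro T
    have := integral_boundary_rect_eq_zero_of_differentiableOn f (-T) (T + κ * I)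
        hf.differentiableOn
    have h2 : (∫ x : ℝ in -T..T, f x) - (∫ x : ℝ in -T..T, f (x + κ * I))
      + I * (∫ y : ℝ in (0:ℝ)..κ, f (T + y * I)) - I * (∫ y : ℝ in (0:ℝ)..κ, f (-T + y * I)) = 0 := by
      simpa only [neg_im, ofReal_im, neg_zero, ofReal_zero, zero_mul, add_zero, neg_re,
        ofReal_re, add_re, mul_re, I_re, mul_zero, I_im, tsub_zero, add_im, mul_im,
        mul_one, zero_add, smul_eq_mul, ofReal_neg] using this
    linear_combination h2
  have hs : ∀ {y : ℝ}, y ∈ Set.uIoc 0 κ → |y| ≤ |κ| := by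
    intro y hy
    simpa using Set.abs_sub_left_of_mem_uIcc (Set.uIoc_subset_uIcc hy)
  have v1 : Tendsto (fun T : ℝ => ∫ y : ℝ in (0:ℝ)..κ, f (-T + y * I)) atTop (𝓝 0) := by
    refine squeeze_zero_norm (a := fun T => b (-T) * |κ - 0|) (fun T => ?_)
      (by simpa using hb2.mul_const |κ - 0|)
    refine intervalIntegral.norm_integral_le_of_norm_le_const fun y hy => ?_
    simpa using hfb (-T) y (hs hy)
  have v2 : Tendsto (fun T : ℝ => ∫ y : ℝ in (0:ℝ)..κ, f (T + y * I)) atTop (𝓝 0) := by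
    refine squeeze_zero_norm (a := fun T => b (T) * |κ - 0|) (fun T => ?_)
      (by simpa using hb1.mul_const |κ - 0|)
    refine intervalIntegral.norm_integral_le_of_norm_le_const fun y hy => ?_
    simpa using hfb (T) y (hs hy)
  have t3 := t1.sub t2
  have t4 : Tendsto (fun T : ℝ => (∫ x : ℝ in -T..T, f x) - (∫ x : ℝ in -T..T, f (x + κ * I)))
      atTop (𝓝 0) := by
    simp_rw [C]
    simpa using (v1.const_mul I).sub (v2.const_mul I)
  exact sub_eq_zero.1 (tendsto_nhds_unique t3 t4)

lemma norm_one_sub_cos_le (z : ℂ) : ‖1 - Complex.cos z‖ ≤ ‖z‖ ^ 2 * Real.exp ‖z‖ := by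
  have h1 := Complex.norm_exp_sub_sum_le_norm_mul_exp (z * I) 2
  have h2 := Complex.norm_exp_sub_sum_le_norm_mul_exp (-z * I) 2
  simp [Finset.sum_range_succ] at h1 h2
  have : 1 - Complex.cos z = -((cexp (z * I) - (1 + z * I)) + (cexp (-(z * I)) - (1 + -(z * I)))) / 2 := by
    rw [Complex.cos]; ring_nf
  rw [this, norm_div, norm_neg]
  have h3 := norm_add_le (cexp (z * I) - (1 + z * I)) (cexp (-(z * I)) - (1 + -(z * I)))
  have : ‖(2:ℂ)‖ = 2 := by simp
  rw [this]
  linarith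

lemma norm_sin_le' (z : ℂ) : ‖Complex.sin z‖ ≤ ‖z‖ * Real.exp ‖z‖ := by
  have h1 := Complex.norm_exp_sub_sum_le_norm_mul_exp (z * I) 1
  have h2 := Complex.norm_exp_sub_sum_le_norm_mul_exp (-z * I) 1
  simp at h1 h2
  have : Complex.sin z = ((cexp (-(z * I)) - 1) - (cexp (z * I) - 1)) * I / 2 := by
    rw [Complex.sin]; ring_nf
  rw [this, norm_div, norm_mul]
  have h3 := norm_sub_le (cexp (-(z * I)) - 1) (cexp (z * I) - 1)
  have : ‖(2:ℂ)‖ = 2 := by simp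
  rw [this, norm_I]
  linarith

variable {m : ℝ → ℝ} {R : ℝ}

lemma Good.pt (hm : Good m R) {B : ℝ} {z : ℂ} (hz : ‖z‖ ≤ B) (w : ℝ) :
    ‖(1 - Complex.cos (z * w)) * (m w : ℂ)‖ ≤ B ^ 2 * Real.exp (B * R) * (w ^ 2 * m w) := by
  have hB : 0 ≤ B := (norm_nonneg _).trans hz
  rcases lt_or_ge R |w| with h | h
  · simp [hm.supp w h]
  · rw [norm_mul, Complex.norm_real, Real.norm_of_nonneg (hm.nn w)]
    have h1 := norm_one_sub_cos_le (z * w)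
    have h2 : ‖z * w‖ ≤ B * |w| := by
      rw [norm_mul, Complex.norm_real, Real.norm_eq_abs]; gcongr
    have h3 : ‖1 - Complex.cos (z * w)‖ ≤ (B * |w|) ^ 2 * Real.exp (B * R) := by
      refine h1.trans ?_
      gcongr
      exact h2.trans (by gcongr)
    calc _ ≤ (B * |w|) ^ 2 * Real.exp (B * R) * m w := by
            gcongr; exact hm.nn w
      _ = _ := by rw [mul_pow, sq_abs]; ring

lemma Good.intC (hm : Good m R) (z : ℂ) :
    Integrable (fun w : ℝ => (1 - Complex.cos (z * w)) * (m w : ℂ)) := by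
  have := hm.meas
  refine (hm.int.const_mul (‖z‖ ^ 2 * Real.exp (‖z‖ * R))).mono' (by fun_prop)
    (Eventually.of_forall fun w => hm.pt le_rfl w)

lemma Good.intR (hm : Good m R) (ξ : ℝ) :
    Integrable (fun w : ℝ => (1 - Real.cos (ξ * w)) * m w) := by
  have := (hm.intC ξ).re
  refine this.congr (Eventually.of_forall fun w => ?_)
  have e : (1 - Complex.cos (ξ * w)) * (m w : ℂ) = (((1 - Real.cos (ξ * w)) * m w : ℝ) : ℂ) := by
    push_cast; rfl
  simp only [e]
  exact ofReal_re _

lemma Good.intA (hm : Good m R) (κ : ℝ) :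
    Integrable (fun w : ℝ => (Real.cosh (κ * w) - 1) * m w) := by
  have := (hm.intC (κ * I)).re.neg
  refine this.congr (Eventually.of_forall fun w => ?_)
  have : (κ:ℂ) * I * w = ((κ * w : ℝ) : ℂ) * I := by push_cast; ring
  have e : (1 - Complex.cos (κ * I * w)) * (m w : ℂ) =
      (((1 - Real.cosh (κ * w)) * m w : ℝ) : ℂ) := by
    rw [this, Complex.cos_mul_I]; push_cast; rfl
  simp only [Pi.neg_apply, e]
  have e2 : RCLike.re (((1 - Real.cosh (κ * w)) * m w : ℝ) : ℂ) = (1 - Real.cosh (κ * w)) * m w :=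
    ofReal_re _
  rw [e2]
  ring

lemma psiC_real (m : ℝ → ℝ) (ξ : ℝ) : psiC m ξ = psiR m ξ := by
  rw [psiC, psiR, ← integral_complex_ofReal]
  congr 1; ext w; push_cast; rfl

lemma Good.diff (hm : Good m R) : Differentiable ℂ (psiC m) := by
  intro z0
  have hmm := hm.meas
  have := hasDerivAt_integral_of_dominated_loc_of_deriv_le (μ := (volume : Measure ℝ))
    (F := fun (z : ℂ) (w : ℝ) => (1 - Complex.cos (z * w)) * (m w : ℂ))
    (F' := fun (z : ℂ) (w : ℝ) => (Complex.sin (z * w) * w) * (m w : ℂ)) (x₀ := z0)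
    (s := Metric.ball z0 1)
    (bound := fun w => (‖z0‖ + 1) * Real.exp ((‖z0‖ + 1) * R) * (w ^ 2 * m w))
    (Metric.ball_mem_nhds _ one_pos)
    (Eventually.of_forall fun z => by fun_prop) (hm.intC z0) (by fun_prop)
    (Eventually.of_forall fun w z hz => ?_) (hm.int.const_mul _)
    (Eventually.of_forall fun w z hz => ?_)
  · exact this.2.differentiableAt
  · rcases lt_or_ge R |w| with h | h
    · simp [hm.supp w h]
    · have hz' : ‖z‖ ≤ ‖z0‖ + 1 := by
        have : ‖z - z0‖ < 1 := by simpa [dist_eq_norm] using hz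
        have := norm_add_le (z - z0) z0
        simp at this; linarith
      rw [norm_mul, norm_mul, Complex.norm_real, Complex.norm_real, Real.norm_of_nonneg (hm.nn w),
        Real.norm_eq_abs]
      have h1 := norm_sin_le' (z * w)
      have h2 : ‖z * w‖ ≤ (‖z0‖ + 1) * |w| := by
        rw [norm_mul, Complex.norm_real, Real.norm_eq_abs]; gcongr
      have h3 : ‖Complex.sin (z * w)‖ ≤ ((‖z0‖ + 1) * |w|) * Real.exp ((‖z0‖ + 1) * R) := by
        refine h1.trans ?_
        gcongr
        exact h2.trans (by gcongr)
      calc _ ≤ ((‖z0‖ + 1) * |w|) * Real.exp ((‖z0‖ + 1) * R) * |w| * m w := by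
              gcongr; exact hm.nn w
        _ = _ := by rw [← sq_abs w]; ring
  · have h1 : HasDerivAt (fun z : ℂ => z * (w:ℂ)) w z := by simpa using (hasDerivAt_id z).mul_const (w:ℂ)
    have h2 := ((Complex.hasDerivAt_cos (z * w)).comp z h1)
    have := (h2.const_sub 1).mul_const (m w : ℂ)
    refine this.congr_deriv ?_
    ring

lemma Good.re_ge (hm : Good m R) (ξ κ : ℝ) :
    psiR m ξ - AA m κ ≤ (psiC m (ξ + κ * I)).re := by
  rw [psiR, AA, psiC, ← integral_sub (hm.intR ξ) (hm.intA κ)]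
  have : (∫ w : ℝ, (1 - Complex.cos ((ξ + κ * I) * w)) * (m w : ℂ)).re =
      ∫ w : ℝ, ((1 - Complex.cos ((ξ + κ * I) * w)) * (m w : ℂ)).re :=
    (integral_re (𝕜 := ℂ) (hm.intC (ξ + κ * I))).symm
  rw [this]
  refine integral_mono ((hm.intR ξ).sub (hm.intA κ)) (hm.intC (ξ + κ * I)).re fun w => ?_
  have e : ((1 - Complex.cos ((ξ + κ * I) * w)) * (m w : ℂ)).re =
      (1 - Real.cos (ξ * w) * Real.cosh (κ * w)) * m w := by
    have : ((ξ:ℂ) + κ * I) * w = ((ξ * w : ℝ) : ℂ) + ((κ * w : ℝ) : ℂ) * I := by push_cast; ring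
    rw [this, Complex.cos_add_mul_I, ← ofReal_cos, ← ofReal_cosh, ← ofReal_sin, ← ofReal_sinh]
    simp only [mul_re, sub_re, one_re, ofReal_re, ofReal_im, mul_im, sub_im, I_re, I_im]
    ring
  refine le_of_le_of_eq ?_ e.symm
  have h1 := Real.cos_le_one (ξ * w)
  have h2 := Real.one_le_cosh (κ * w)
  have h3 := hm.nn w
  have : 0 ≤ (1 - Real.cos (ξ * w)) * (Real.cosh (κ * w) - 1) * m w :=
    mul_nonneg (mul_nonneg (by linarith) (by linarith)) h3
  nlinarith

end LV

namespace LV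
open Complex Topology

noncomputable def GG (c α u : ℝ) : ℝ := (1 + |u|) ^ 2 * Real.exp (-c * |u| ^ α)
noncomputable def MM (c α : ℝ) : ℝ := ∫ u, GG c α u
noncomputable def Fo (φ : ℝ → ℂ) (x : ℝ) : ℂ := ∫ ξ : ℝ, cexp (x * ξ * I) * φ ξ
noncomputable def ph (m : ℝ → ℝ) (t : ℝ) (k : ℕ) (ξ : ℝ) : ℂ := (ξ * I) ^ k * cexp (-t * psiC m ξ)

lemma GG_even (c α u : ℝ) : GG c α (-u) = GG c α u := by simp [GG]

lemma GG_nonneg (c α u : ℝ) : 0 ≤ GG c α u := by unfold GG; positivity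

lemma GG_tendsto {c α : ℝ} (hc : 0 < c) (hα : 0 < α) : Tendsto (GG c α) atTop (𝓝 0) := by
  have h1 := (tendsto_rpow_mul_exp_neg_mul_atTop_nhds_zero (2 / α) c hc).comp (tendsto_rpow_atTop hα)
  have h2 := h1.const_mul 4
  rw [mul_zero] at h2
  refine squeeze_zero' (Eventually.of_forall fun u => GG_nonneg c α u) ?_ h2
  filter_upwards [eventually_ge_atTop 1] with u hu
  have hu0 : 0 ≤ u := by linarith
  have e : (u ^ α) ^ (2 / α) = u ^ 2 := by
    rw [← Real.rpow_mul hu0, mul_div_cancel₀ _ hα.ne']; simp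
  simp only [Function.comp, e, GG, abs_of_nonneg hu0]
  rw [← mul_assoc]
  gcongr
  nlinarith

lemma GG_int {c α : ℝ} (hc : 0 < c) (hα : 0 < α) : Integrable (GG c α) := by
  have h0 := integrableOn_rpow_mul_exp_neg_mul_rpow (p := α) (s := 0) (b := c) (by norm_num) hα hc
  have h2 := integrableOn_rpow_mul_exp_neg_mul_rpow (p := α) (s := 2) (b := c) (by norm_num) hα hc
  have h3 : IntegrableOn (fun u => GG c α u) (Set.Ioi 0) := by
    refine Integrable.mono' ((h0.const_mul 2).add (h2.const_mul 2)) ?_ ?_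
    · unfold GG
      exact Measurable.aestronglyMeasurable (by fun_prop)
    · refine (ae_restrict_iff' measurableSet_Ioi).2 (Eventually.of_forall fun u hu => ?_)
      have hu0 : 0 < u := hu
      rw [Real.norm_of_nonneg (GG_nonneg _ _ _)]
      simp only [GG, abs_of_pos hu0, Pi.add_apply, Real.rpow_zero, one_mul, Real.rpow_two]
      have := Real.exp_pos (-c * u ^ α)
      nlinarith [sq_nonneg (1 - u), mul_nonneg (sq_nonneg (1 - u)) this.le]
  have h4 : IntegrableOn (fun u => GG c α u) (Set.Iio 0) := by
    have := h3.comp_neg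
    simpa [GG_even] using this
  have h5 : IntegrableOn (fun u => GG c α u) (Set.univ) := by
    have : (Set.univ : Set ℝ) = Set.Iio 0 ∪ ({0} ∪ Set.Ioi 0) := by
      ext u; simp
    rw [this]
    exact h4.union ((integrableOn_singleton (by simp) (by rw [Real.volume_singleton]; simp)).union h3)
  simpa using h5

lemma MM_nonneg (c α : ℝ) : 0 ≤ MM c α := integral_nonneg fun u => GG_nonneg c α u

variable {m : ℝ → ℝ} {R : ℝ}

lemma wt {ρ κ y : ℝ} (hρ : 0 < ρ) (hκ : 0 ≤ κ) (hy : 0 ≤ y) {k : ℕ} (hk : k ≤ 2) :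
    (y + κ) ^ k ≤ (1 + κ * ρ) ^ k / ρ ^ k * (1 + ρ * y) ^ 2 := by
  have h1 : (y + κ) ≤ (1 + κ * ρ) / ρ * (1 + ρ * y) := by
    rw [div_mul_eq_mul_div, le_div_iff₀ hρ]
    nlinarith [mul_nonneg (mul_nonneg hκ hρ.le) (mul_nonneg hρ.le hy)]
  have h2 : (1 + ρ * y) ^ k ≤ (1 + ρ * y) ^ 2 :=
    pow_le_pow_right₀ (by nlinarith [mul_nonneg hρ.le hy]) hk
  calc (y + κ) ^ k ≤ ((1 + κ * ρ) / ρ * (1 + ρ * y)) ^ k := by gcongr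
    _ = (1 + κ * ρ) ^ k / ρ ^ k * (1 + ρ * y) ^ k := by rw [mul_pow, div_pow]
    _ ≤ _ := by gcongr

lemma GG_scale_int {c α ρ : ℝ} (hc : 0 < c) (hα : 0 < α) (hρ : 0 < ρ) :
    Integrable (fun ξ => GG c α (ρ * ξ)) := (GG_int hc hα).comp_mul_left' hρ.ne'

lemma Good.cs (hm : Good m R) {c B α ρ t κ : ℝ} (hc : 0 < c) (hα : 0 < α) (hρ : 0 < ρ) (ht : 0 < t)
    (hκ : 0 ≤ κ) (hD : ∀ ξ, c * (ρ * |ξ|) ^ α - B ≤ t * psiR m ξ) {k : ℕ} (hk : k ≤ 2) (x : ℝ) :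
    ‖Fo (ph m t k) x‖ ≤ Real.exp (-κ * |x|) * Real.exp (t * AA m κ) * Real.exp B *
      (1 + κ * ρ) ^ k * MM c α / ρ ^ (k + 1) := by
  -- WLOG sign
  obtain ⟨κ', hκ', hκx⟩ : ∃ κ' : ℝ, |κ'| = κ ∧ κ' * x = κ * |x| := by
    rcases le_total 0 x with h | h
    · exact ⟨κ, abs_of_nonneg hκ, by rw [abs_of_nonneg h]⟩
    · exact ⟨-κ, by rw [abs_neg, abs_of_nonneg hκ], by rw [abs_of_nonpos h]; ring⟩
  set f : ℂ → ℂ := fun z => cexp (x * z * I) * ((z * I) ^ k * cexp (-t * psiC m z)) with hf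
  have hfd : Differentiable ℂ f := by
    have := hm.diff
    fun_prop
  have key : ∀ ξ s : ℝ, |s| ≤ κ → ‖f (ξ + s * I)‖ ≤ Real.exp (-(s * x)) * Real.exp (t * AA m s) *
      Real.exp B * ((1 + κ * ρ) ^ k / ρ ^ k) * GG c α (ρ * ξ) := by
    intro ξ s hs
    have n1 : ‖cexp (x * (ξ + s * I) * I)‖ = Real.exp (-(s * x)) := by
      rw [Complex.norm_exp]; congr 1; simp; ring
    have n2 : ‖(((ξ:ℂ) + s * I) * I) ^ k‖ ≤ (|ξ| + κ) ^ k := by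
      rw [norm_pow, norm_mul, norm_I, mul_one]
      gcongr
      refine (norm_add_le _ _).trans ?_
      simp
      linarith
    have n3 : ‖cexp (-t * psiC m (ξ + s * I))‖ ≤ Real.exp (t * AA m s) * Real.exp B *
        Real.exp (-c * (ρ * |ξ|) ^ α) := by
      rw [Complex.norm_exp, ← Real.exp_add, ← Real.exp_add]
      apply Real.exp_le_exp.2
      have h1 := hm.re_ge ξ s
      have h2 := hD ξ
      have : (-(t:ℂ) * psiC m (ξ + s * I)).re = -t * (psiC m (ξ + s * I)).re := by
        rw [← ofReal_neg, re_ofReal_mul]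
      rw [this]
      nlinarith
    have e1 : |ρ * ξ| = ρ * |ξ| := by rw [abs_mul, abs_of_pos hρ]
    have h4 := wt hρ hκ (abs_nonneg ξ) hk
    calc ‖f (ξ + s * I)‖ = ‖cexp (x * (ξ + s * I) * I)‖ * (‖(((ξ:ℂ) + s * I) * I) ^ k‖ *
          ‖cexp (-t * psiC m (ξ + s * I))‖) := by rw [hf]; simp only [norm_mul]
      _ ≤ Real.exp (-(s * x)) * ((|ξ| + κ) ^ k * (Real.exp (t * AA m s) * Real.exp B *
        Real.exp (-c * (ρ * |ξ|) ^ α))) := by rw [n1]; gcongr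
      _ ≤ Real.exp (-(s * x)) * (((1 + κ * ρ) ^ k / ρ ^ k * (1 + ρ * |ξ|) ^ 2) *
        (Real.exp (t * AA m s) * Real.exp B * Real.exp (-c * (ρ * |ξ|) ^ α))) := by gcongr
      _ = _ := by rw [GG, e1]; ring
  have AAm : ∀ s : ℝ, |s| ≤ |κ'| → AA m s ≤ AA m κ' := by
    intro s hs
    unfold AA
    refine integral_mono (hm.intA s) (hm.intA κ') fun w => ?_
    have : Real.cosh (s * w) ≤ Real.cosh (κ' * w) := by
      rw [Real.cosh_le_cosh, abs_mul, abs_mul]; gcongr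
    have := hm.nn w
    simp only; gcongr
  have AAe : AA m κ' = AA m κ := by
    unfold AA
    congr 1; ext w
    rw [← Real.cosh_abs, abs_mul, hκ', ← Real.cosh_abs (κ * w), abs_mul, abs_of_nonneg hκ]
  have hcont := contour f hfd (fun ξ => Real.exp (κ * |x|) * Real.exp (t * AA m κ') *
      Real.exp B * ((1 + κ * ρ) ^ k / ρ ^ k) * GG c α (ρ * ξ)) κ'
    ((GG_scale_int hc hα hρ).const_mul _)
    (by
      have := ((GG_tendsto hc hα).comp (tendsto_id.const_mul_atTop hρ)).const_mul
        (Real.exp (κ * |x|) * Real.exp (t * AA m κ') * Real.exp B * ((1 + κ * ρ) ^ k / ρ ^ k))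
      simpa using this)
    (by
      have := ((GG_tendsto hc hα).comp (tendsto_id.const_mul_atTop hρ)).const_mul
        (Real.exp (κ * |x|) * Real.exp (t * AA m κ') * Real.exp B * ((1 + κ * ρ) ^ k / ρ ^ k))
      simpa [GG_even] using this)
    (fun ξ s hs => by
      refine (key ξ s (by rwa [← hκ'])).trans ?_
      have := AAm s hs
      have h2 : -(s * x) ≤ κ * |x| := by
        have := neg_abs_le (s * x)
        rw [abs_mul] at this
        have : |s| * |x| ≤ κ * |x| := by gcongr; rwa [← hκ']
        linarith
      have := GG_nonneg c α (ρ * ξ)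
      gcongr)
  have e0 : Fo (ph m t k) x = ∫ ξ : ℝ, f ξ := rfl
  rw [e0, hcont]
  refine (norm_integral_le_of_norm_le ((GG_scale_int hc hα hρ).const_mul _)
    (Eventually.of_forall fun ξ => key ξ κ' hκ'.le)).trans ?_
  rw [integral_const_mul, Measure.integral_comp_mul_left, AAe, hκx, abs_of_pos (inv_pos.2 hρ)]
  apply le_of_eq
  rw [smul_eq_mul, MM, neg_mul, pow_succ]
  field_simp

lemma Good.ph_norm (hm : Good m R) {c B α ρ t : ℝ} (hρ : 0 < ρ)
    (hD : ∀ ξ, c * (ρ * |ξ|) ^ α - B ≤ t * psiR m ξ) {k : ℕ} (hk : k ≤ 2) (ξ : ℝ) :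
    ‖ph m t k ξ‖ ≤ Real.exp B / ρ ^ k * GG c α (ρ * ξ) := by
  have n3 : ‖cexp (-t * psiC m ξ)‖ ≤ Real.exp B * Real.exp (-c * (ρ * |ξ|) ^ α) := by
    rw [Complex.norm_exp, ← Real.exp_add]
    apply Real.exp_le_exp.2
    have h2 := hD ξ
    rw [psiC_real, ← ofReal_neg, ← ofReal_mul, ofReal_re]
    linarith
  have e1 : |ρ * ξ| = ρ * |ξ| := by rw [abs_mul, abs_of_pos hρ]
  have h4 := wt hρ le_rfl (abs_nonneg ξ) hk
  simp at h4
  rw [ph, norm_mul, norm_pow, norm_mul, norm_I, mul_one, Complex.norm_real, Real.norm_eq_abs, GG, e1]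
  calc _ ≤ ((ρ ^ k)⁻¹ * (1 + ρ * |ξ|) ^ 2) * (Real.exp B * Real.exp (-c * (ρ * |ξ|) ^ α)) := by
        gcongr
    _ = _ := by ring

lemma Good.ph_int (hm : Good m R) {c B α ρ t : ℝ} (hc : 0 < c) (hα : 0 < α) (hρ : 0 < ρ)
    (hD : ∀ ξ, c * (ρ * |ξ|) ^ α - B ≤ t * psiR m ξ) {k : ℕ} (hk : k ≤ 2) :
    Integrable (ph m t k) := by
  have hd := hm.diff.continuous
  refine ((GG_scale_int hc hα hρ).const_mul (Real.exp B / ρ ^ k)).mono' ?_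
    (Eventually.of_forall fun ξ => hm.ph_norm hρ hD hk ξ)
  unfold ph
  exact Continuous.aestronglyMeasurable (by fun_prop)

end LV

namespace LV
open Complex Topology

noncomputable def mh (m : ℝ → ℝ) (ξ : ℝ) : ℂ := ∫ y : ℝ, cexp (-(y * ξ * I)) * (m y : ℂ)

lemma norm_e1 (x ξ : ℝ) : ‖cexp (x * ξ * I)‖ = 1 := by
  rw [← ofReal_mul]; exact norm_exp_ofReal_mul_I _
lemma norm_e2 (x ξ : ℝ) : ‖cexp (-(x * ξ * I))‖ = 1 := by
  rw [← ofReal_mul, ← neg_mul, ← ofReal_neg]; exact norm_exp_ofReal_mul_I _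

lemma Fo_cont {φ : ℝ → ℂ} (hφ : Integrable φ) : Continuous (Fo φ) := by
  unfold Fo
  refine continuous_of_dominated (bound := fun ξ => ‖φ ξ‖) (fun x => ?_) (fun x => ?_) hφ.norm ?_
  · exact AEStronglyMeasurable.mul (by fun_prop) hφ.1
  · exact Eventually.of_forall fun ξ => by rw [norm_mul, norm_e1, one_mul]
  · exact Eventually.of_forall fun ξ => by fun_prop

variable {m : ℝ → ℝ}

lemma mh_cont (hm : Integrable m) : Continuous (mh m) := by
  unfold mh
  refine continuous_of_dominated (bound := fun ξ => ‖m ξ‖) (fun x => ?_) (fun x => ?_) hm.norm ?_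
  · exact AEStronglyMeasurable.mul (by fun_prop) hm.ofReal.1
  · exact Eventually.of_forall fun ξ => by rw [norm_mul, norm_e2, one_mul, Complex.norm_real]
  · exact Eventually.of_forall fun ξ => by fun_prop

lemma mh_norm (hn : ∀ w, 0 ≤ m w) (ξ : ℝ) : ‖mh m ξ‖ ≤ ∫ y, m y := by
  unfold mh
  refine (norm_integral_le_integral_norm _).trans (le_of_eq ?_)
  congr 1; ext y
  rw [norm_mul, norm_e2, one_mul, Complex.norm_real, Real.norm_of_nonneg (hn y)]

lemma phn_int {φ : ℝ → ℂ} (hφ : Integrable φ) (hm : Integrable m) (hn : ∀ w, 0 ≤ m w) (n : ℕ) :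
    Integrable (fun ξ => φ ξ * mh m ξ ^ n) := by
  refine hφ.mul_bdd (c := (∫ y, m y) ^ n) ?_ (Eventually.of_forall fun ξ => ?_)
  · exact ((mh_cont hm).pow n).aestronglyMeasurable
  · rw [norm_pow]; gcongr; exact mh_norm hn ξ

lemma Fo_conv {φ : ℝ → ℂ} (hφ : Integrable φ) (hm : Integrable m) (x : ℝ) :
    Fo (fun ξ => φ ξ * mh m ξ) x = ∫ y : ℝ, Fo φ (x - y) * (m y : ℂ) := by
  have hI : Integrable (Function.uncurry fun (ξ y : ℝ) =>
      (cexp (x * ξ * I) * cexp (-(y * ξ * I))) * (φ ξ * (m y : ℂ))) (volume.prod volume) := by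
    have := hφ.mul_prod (ν := volume) (hm.ofReal (𝕜 := ℂ))
    refine this.bdd_mul (c := 1) ?_ (Eventually.of_forall fun p => ?_)
    · exact Continuous.aestronglyMeasurable (by fun_prop)
    · rw [norm_mul, norm_e1, norm_e2, one_mul]
  have := integral_integral_swap hI
  unfold Fo mh
  calc _ = ∫ ξ : ℝ, ∫ y : ℝ, (cexp (x * ξ * I) * cexp (-(y * ξ * I))) * (φ ξ * (m y : ℂ)) := by
        congr 1; ext ξ
        simp only
        rw [← integral_const_mul, ← integral_const_mul]
        congr 1; ext y; ring
    _ = _ := this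
    _ = _ := by
        congr 1; ext y
        rw [← integral_mul_const]
        congr 1; ext ξ
        rw [← Complex.exp_add]
        push_cast
        ring_nf

lemma Fo_step {φ : ℝ → ℂ} (hφ : Integrable φ) (hm : Integrable m) (x : ℝ) :
    ‖Fo (fun ξ => φ ξ * mh m ξ) x‖ₑ ≤ ∫⁻ y : ℝ, ‖Fo φ (x - y)‖ₑ * ‖m y‖ₑ := by
  rw [Fo_conv hφ hm]
  refine (enorm_integral_le_lintegral_enorm _).trans (le_of_eq ?_)
  congr 1; ext y
  rw [enorm_mul]; congr 1
  simp [enorm_eq_nnnorm]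

lemma Fo_step1 {φ : ℝ → ℂ} (hφ : Integrable φ) (hm : Integrable m) (hmm : Measurable m) :
    ∫⁻ x, ‖Fo (fun ξ => φ ξ * mh m ξ) x‖ₑ ≤ (∫⁻ y, ‖m y‖ₑ) * ∫⁻ x, ‖Fo φ x‖ₑ := by
  have hc := Fo_cont hφ
  calc _ ≤ ∫⁻ x, ∫⁻ y : ℝ, ‖Fo φ (x - y)‖ₑ * ‖m y‖ₑ := lintegral_mono fun x => Fo_step hφ hm x
    _ = ∫⁻ y, ∫⁻ x : ℝ, ‖Fo φ (x - y)‖ₑ * ‖m y‖ₑ := by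
        refine lintegral_lintegral_swap (Measurable.aemeasurable ?_)
        unfold Function.uncurry
        have := hc.measurable
        fun_prop
    _ = ∫⁻ y, (∫⁻ x : ℝ, ‖Fo φ x‖ₑ) * ‖m y‖ₑ := by
        congr 1; ext y
        rw [lintegral_mul_const' _ _ (by simp), lintegral_sub_right_eq_self (fun x => ‖Fo φ x‖ₑ)]
    _ = _ := by rw [lintegral_const_mul _ (by fun_prop), mul_comm]

lemma Fo_sup {φ : ℝ → ℂ} (hφ : Integrable φ) (hm : Integrable m) (hn : ∀ w, 0 ≤ m w) {S : ℝ}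
    (hS : ∀ w, m w ≤ S) (x : ℝ) :
    ‖Fo (fun ξ => φ ξ * mh m ξ) x‖ₑ ≤ ENNReal.ofReal S * ∫⁻ x, ‖Fo φ x‖ₑ := by
  refine (Fo_step hφ hm x).trans ?_
  calc _ ≤ ∫⁻ y, ‖Fo φ (x - y)‖ₑ * ENNReal.ofReal S := by
        refine lintegral_mono fun y => ?_
        simp only
        gcongr
        rw [Real.enorm_of_nonneg (hn y)]
        exact ENNReal.ofReal_le_ofReal (hS y)
    _ = _ := by
        rw [lintegral_mul_const' _ _ (by simp), lintegral_sub_left_eq_self (fun x => ‖Fo φ x‖ₑ),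
          mul_comm]

lemma Fo_n {φ : ℝ → ℂ} (hφ : Integrable φ) (hm : Integrable m) (hmm : Measurable m)
    (hn : ∀ w, 0 ≤ m w) {J : ℝ} (hJ0 : 0 ≤ J) (hJ : ∫⁻ x, ‖Fo φ x‖ₑ ≤ ENNReal.ofReal J) (n : ℕ) :
    ∫⁻ x, ‖Fo (fun ξ => φ ξ * mh m ξ ^ n) x‖ₑ ≤ ENNReal.ofReal ((∫ y, m y) ^ n * J) := by
  induction n with
  | zero => simpa using hJ
  | succ n ih =>
    have h1 := Fo_step1 (phn_int hφ hm hn n) hm hmm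
    have e : (fun ξ => φ ξ * mh m ξ ^ (n + 1)) = fun ξ => φ ξ * mh m ξ ^ n * mh m ξ := by
      ext ξ; ring
    rw [e]
    refine h1.trans ?_
    have h2 : ∫⁻ y, ‖m y‖ₑ = ENNReal.ofReal (∫ y, m y) := by
      rw [ofReal_integral_eq_lintegral_ofReal hm (Eventually.of_forall hn)]
      congr 1; ext y; exact Real.enorm_of_nonneg (hn y)
    rw [h2, pow_succ']
    have h3 : 0 ≤ ∫ y, m y := integral_nonneg hn
    rw [mul_assoc, ENNReal.ofReal_mul h3]
    gcongr

lemma Fo_n_sup {φ : ℝ → ℂ} (hφ : Integrable φ) (hm : Integrable m) (hmm : Measurable m)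
    (hn : ∀ w, 0 ≤ m w) {J S : ℝ} (hJ0 : 0 ≤ J) (hJ : ∫⁻ x, ‖Fo φ x‖ₑ ≤ ENNReal.ofReal J)
    (hS0 : 0 ≤ S) (hS : ∀ w, m w ≤ S) (n : ℕ) (x : ℝ) :
    ‖Fo (fun ξ => φ ξ * mh m ξ ^ (n + 1)) x‖ ≤ S * ((∫ y, m y) ^ n * J) := by
  have h1 := Fo_sup (phn_int hφ hm hn n) hm hn hS x
  have e : (fun ξ => φ ξ * mh m ξ ^ (n + 1)) = fun ξ => φ ξ * mh m ξ ^ n * mh m ξ := by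
    ext ξ; ring
  rw [e]
  have h3 : 0 ≤ ∫ y, m y := integral_nonneg hn
  have h2 := h1.trans (mul_le_mul_right (Fo_n hφ hm hmm hn hJ0 hJ n) (ENNReal.ofReal S))
  rw [← ENNReal.ofReal_mul hS0, ← ofReal_norm] at h2
  exact (ENNReal.ofReal_le_ofReal_iff (by positivity)).1 h2

lemma Fo_series {φ : ℝ → ℂ} (hφ : Integrable φ) (hm : Integrable m)
    (hn : ∀ w, 0 ≤ m w) {t : ℝ} (ht : 0 < t) (x : ℝ) :
    HasSum (fun n : ℕ => ((Real.exp (-t * ∫ y, m y) * t ^ n / n.factorial : ℝ) : ℂ) *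
      Fo (fun ξ => φ ξ * mh m ξ ^ n) x)
      (Fo (fun ξ => φ ξ * cexp (t * (mh m ξ - (∫ y, m y : ℝ)))) x) := by
  set l := ∫ y, m y with hl
  have h3 : 0 ≤ l := integral_nonneg hn
  set G : ℕ → ℝ → ℂ := fun n ξ => ((Real.exp (-t * l) * t ^ n / n.factorial : ℝ) : ℂ) *
    (cexp (x * ξ * I) * (φ ξ * mh m ξ ^ n)) with hG
  have hGn : ∀ n ξ, ‖G n ξ‖ ≤ (Real.exp (-t * l) * t ^ n / n.factorial) * (l ^ n * ‖φ ξ‖) := by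
    intro n ξ
    simp only [hG]
    rw [norm_mul, Complex.norm_real, Real.norm_of_nonneg (by positivity), norm_mul, norm_e1, one_mul,
      norm_mul, norm_pow, mul_comm ‖φ ξ‖]
    have := mh_norm hn ξ
    gcongr
  have hGi : ∀ n, Integrable (G n) := by
    intro n
    refine Integrable.const_mul ?_ _
    refine (phn_int hφ hm hn n).bdd_mul (c := 1) (by fun_prop) (Eventually.of_forall fun p => ?_)
    rw [norm_e1]
  have hs : Summable fun n => ∫ ξ, ‖G n ξ‖ := by
    have h5 : Summable fun n : ℕ => (Real.exp (-t * l) * ∫ ξ, ‖φ ξ‖) * ((t * l) ^ n / n.factorial) :=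
      (Real.summable_pow_div_factorial (t * l)).mul_left _
    refine Summable.of_nonneg_of_le (fun n => integral_nonneg fun ξ => norm_nonneg _) (fun n => ?_) h5
    calc _ ≤ ∫ ξ, (Real.exp (-t * l) * t ^ n / n.factorial) * (l ^ n * ‖φ ξ‖) :=
          integral_mono (hGi n).norm ((hφ.norm.const_mul _).const_mul _) fun ξ => hGn n ξ
      _ = _ := by rw [integral_const_mul, integral_const_mul, mul_pow]; ring
  have := hasSum_integral_of_summable_integral_norm hGi hs
  have e1 : ∀ n, ∫ ξ, G n ξ = ((Real.exp (-t * l) * t ^ n / n.factorial : ℝ) : ℂ) *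
      Fo (fun ξ => φ ξ * mh m ξ ^ n) x := by
    intro n; simp only [hG]; rw [integral_const_mul]; rfl
  have e2 : ∫ ξ, ∑' n, G n ξ = Fo (fun ξ => φ ξ * cexp (t * (mh m ξ - (l : ℝ)))) x := by
    unfold Fo
    congr 1; ext ξ
    have h7 : HasSum (fun n : ℕ => (t * mh m ξ) ^ n / n.factorial) (cexp (t * mh m ξ)) := by
      rw [Complex.exp_eq_exp_ℂ]; exact NormedSpace.expSeries_div_hasSum_exp _
    have h8 := h7.mul_left ((Real.exp (-t * l) : ℂ) * cexp (x * ξ * I) * φ ξ)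
    have h9 : (fun n => G n ξ) = fun n : ℕ => ((Real.exp (-t * l) : ℂ) * cexp (x * ξ * I) * φ ξ) *
        ((t * mh m ξ) ^ n / n.factorial) := by
      ext n; simp only [hG]; push_cast; rw [mul_pow]; ring
    rw [h9, h8.tsum_eq]
    have : cexp (t * (mh m ξ - l)) = (Real.exp (-t * l) : ℂ) * cexp (t * mh m ξ) := by
      push_cast; rw [← Complex.exp_add]; ring_nf
    simp only [this]; ring
  rw [← e2]
  simpa only [e1] using this

lemma exp_tsum_bound {t l : ℝ} : HasSum (fun n : ℕ => Real.exp (-t * l) * ((t * l) ^ n / n.factorial)) 1 := by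
  have h7 : HasSum (fun n : ℕ => (t * l) ^ n / n.factorial) (Real.exp (t * l)) := by
    rw [Real.exp_eq_exp_ℝ]; exact NormedSpace.expSeries_div_hasSum_exp _
  have := h7.mul_left (Real.exp (-t * l))
  rw [← Real.exp_add, neg_mul, neg_add_cancel, Real.exp_zero] at this
  simpa only [neg_mul] using this

/-- main convolution lemma, L1 part -/
lemma Fo_L1 {φ : ℝ → ℂ} (hφ : Integrable φ) (hm : Integrable m) (hmm : Measurable m)
    (hn : ∀ w, 0 ≤ m w) {t : ℝ} (ht : 0 < t)
    {J : ℝ} (hJ0 : 0 ≤ J) (hJ : ∫⁻ x, ‖Fo φ x‖ₑ ≤ ENNReal.ofReal J) :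
    ∫⁻ x, ‖Fo (fun ξ => φ ξ * cexp (t * (mh m ξ - (∫ y, m y : ℝ)))) x‖ₑ ≤ ENNReal.ofReal J := by
  set l := ∫ y, m y with hl
  have h3 : 0 ≤ l := integral_nonneg hn
  calc _ ≤ ∫⁻ x, ∑' n : ℕ, ENNReal.ofReal (Real.exp (-t * l) * t ^ n / n.factorial) *
        ‖Fo (fun ξ => φ ξ * mh m ξ ^ n) x‖ₑ := by
        refine lintegral_mono fun x => ?_
        rw [← (Fo_series hφ hm hn ht x).tsum_eq]
        refine enorm_tsum_le_tsum_enorm.trans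
          (le_of_eq ?_)
        congr 1; ext n
        rw [enorm_mul]; congr 1
        rw [← ofReal_norm, Complex.norm_real, Real.norm_of_nonneg (by positivity)]
    _ = ∑' n : ℕ, ∫⁻ x, ENNReal.ofReal (Real.exp (-t * l) * t ^ n / n.factorial) *
        ‖Fo (fun ξ => φ ξ * mh m ξ ^ n) x‖ₑ := by
        refine lintegral_tsum fun n => ?_
        have := (Fo_cont (phn_int hφ hm hn n)).measurable
        exact (this.enorm.const_mul _).aemeasurable
    _ ≤ ∑' n : ℕ, ENNReal.ofReal ((Real.exp (-t * l) * ((t * l) ^ n / n.factorial)) * J) := by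
        refine ENNReal.tsum_le_tsum fun n => ?_
        have := (Fo_cont (phn_int hφ hm hn n)).measurable
        rw [lintegral_const_mul _ this.enorm]
        refine (mul_le_mul_right (Fo_n hφ hm hmm hn hJ0 hJ n) _).trans (le_of_eq ?_)
        rw [← ENNReal.ofReal_mul (by positivity), mul_pow]
        congr 1; ring
    _ = _ := by
        have h := (exp_tsum_bound (t := t) (l := l)).mul_right J
        rw [one_mul] at h
        rw [← ENNReal.ofReal_tsum_of_nonneg (fun n => by positivity) h.summable, h.tsum_eq]

/-- main convolution lemma, pointwise part -/
lemma Fo_pt {φ : ℝ → ℂ} (hφ : Integrable φ) (hm : Integrable m) (hmm : Measurable m)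
    (hn : ∀ w, 0 ≤ m w) {t : ℝ} (ht : 0 < t)
    {J S : ℝ} (hJ0 : 0 ≤ J) (hJ : ∫⁻ x, ‖Fo φ x‖ₑ ≤ ENNReal.ofReal J)
    (hS0 : 0 ≤ S) (hS : ∀ w, m w ≤ S) (x : ℝ) :
    ‖Fo (fun ξ => φ ξ * cexp (t * (mh m ξ - (∫ y, m y : ℝ)))) x‖ ≤ ‖Fo φ x‖ + t * S * J := by
  set l := ∫ y, m y with hl
  have h3 : 0 ≤ l := integral_nonneg hn
  have hs := Fo_series hφ hm hn ht x
  rw [← hl] at hs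
  have hs1 := (hasSum_nat_add_iff' 1).2 hs
  have hb : ∀ n : ℕ, ‖((Real.exp (-t * l) * t ^ (n + 1) / (n + 1).factorial : ℝ) : ℂ) *
      Fo (fun ξ => φ ξ * mh m ξ ^ (n + 1)) x‖ ≤
      (Real.exp (-t * l) * ((t * l) ^ n / n.factorial)) * (t * S * J) := by
    intro n
    rw [norm_mul, Complex.norm_real, Real.norm_of_nonneg (by positivity)]
    have h1 := Fo_n_sup hφ hm hmm hn hJ0 hJ hS0 hS n x
    have h2 : (n.factorial : ℝ) ≤ (n + 1).factorial := by
      exact_mod_cast Nat.factorial_le (Nat.le_succ n)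
    have h4 : (0:ℝ) < n.factorial := by positivity
    calc _ ≤ Real.exp (-t * l) * t ^ (n + 1) / n.factorial * (S * (l ^ n * J)) := by
          gcongr
      _ = _ := by rw [mul_pow]; ring
  have := tsum_of_norm_bounded ((exp_tsum_bound (t := t) (l := l)).mul_right (t * S * J)) hb
  rw [hs1.tsum_eq] at this
  simp only [Finset.range_one, Finset.sum_singleton, pow_zero, Nat.factorial_zero, mul_one, one_mul,
    Nat.cast_one, div_one] at this
  have h5 : ‖((Real.exp (-t * l) : ℝ) : ℂ) * Fo φ x‖ ≤ ‖Fo φ x‖ := by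
    rw [norm_mul, Complex.norm_real, Real.norm_of_nonneg (by positivity)]
    have : Real.exp (-t * l) ≤ 1 := Real.exp_le_one_iff.2 (by nlinarith)
    exact mul_le_of_le_one_left (norm_nonneg _) this
  have h6 := norm_sub_norm_le (Fo (fun ξ => φ ξ * cexp (t * (mh m ξ - (l : ℝ)))) x)
    (((Real.exp (-t * l) : ℝ) : ℂ) * Fo φ x)
  linarith

end LV

namespace LV
open Complex Topology

structure Lev (ν μ h hinv : ℝ → ℝ) (α C₁ δ : ℝ) : Prop where
  νmeas : Measurable ν
  νnn : ∀ x, 0 ≤ ν x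
  νint : Integrable (fun x : ℝ => min (x ^ 2) 1 * ν x)
  hdef : ∀ r : ℝ, 0 < r → h r = ∫ x : ℝ, min 1 (x ^ 2 / r ^ 2) * ν x
  hanti : StrictAntiOn h (Set.Ioi 0)
  hinvpos : ∀ s : ℝ, 0 < s → 0 < hinv s
  hinvr : ∀ s : ℝ, 0 < s → h (hinv s) = s
  hlsc : ∀ θ : ℝ, 0 < θ → ∀ l : ℝ, 1 ≤ l → C₁ * l ^ α * h (l * θ) ≤ h θ
  μmeas : Measurable μ
  μeq : ∀ x : ℝ, x ≠ 0 → |x| ≤ δ → μ x = ν x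
  μb : ∀ x : ℝ, x ≠ 0 → 0 ≤ μ x ∧ μ x ≤ ν x
  μzero : ∀ x : ℝ, 2 * δ ≤ |x| → μ x = 0
  μsymm : ∀ x : ℝ, μ (-x) = μ x
  μanti : ∀ x y : ℝ, 0 < x → x ≤ y → μ y ≤ μ x
  δpos : 0 < δ
  αpos : 0 < α
  C₁pos : 0 < C₁

noncomputable def cut (f : ℝ → ℝ) (a b w : ℝ) : ℝ := if a < |w| ∧ |w| ≤ b then f w else 0

variable {ν μ h hinv : ℝ → ℝ} {α C₁ δ : ℝ}

lemma cut_meas {f : ℝ → ℝ} (hf : Measurable f) (a b : ℝ) : Measurable (cut f a b) := by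
  unfold cut
  refine Measurable.ite ?_ hf measurable_const
  exact (measurableSet_lt measurable_const measurable_norm).inter
    (measurableSet_le measurable_norm measurable_const)

namespace Lev

lemma hint (L : Lev ν μ h hinv α C₁ δ) {r : ℝ} (hr : 0 < r) :
    Integrable (fun x : ℝ => min 1 (x ^ 2 / r ^ 2) * ν x) := by
  have := L.νmeas
  refine (L.νint.const_mul (max 1 (1 / r ^ 2))).mono' (by fun_prop) (Eventually.of_forall fun x => ?_)
  have h0 := L.νnn x
  have hr2 : 0 < r ^ 2 := by positivity
  rw [Real.norm_of_nonneg (by positivity), ← mul_assoc]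
  gcongr
  rcases le_total (x ^ 2) 1 with h1 | h1
  · rw [min_eq_left h1]
    refine (min_le_right _ _).trans ?_
    rw [div_eq_mul_one_div, mul_comm]
    gcongr
    exact le_max_right _ _
  · rw [min_eq_right h1, mul_one]
    exact (min_le_left _ _).trans (le_max_left _ _)

lemma hpos (L : Lev ν μ h hinv α C₁ δ) {r : ℝ} (hr : 0 < r) : 0 < h r := by
  have h1 : h (2 * r) < h r := L.hanti hr (show (0:ℝ) < 2 * r by linarith) (by linarith)
  have h2 : 0 ≤ h (2 * r) := by
    rw [L.hdef _ (by linarith)]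
    refine integral_nonneg fun x => ?_
    have h0 := L.νnn x
    positivity
  linarith

lemma anti (L : Lev ν μ h hinv α C₁ δ) {r s : ℝ} (hr : 0 < r) (hrs : r ≤ s) : h s ≤ h r :=
  L.hanti.antitoneOn hr (show (0:ℝ) < s by linarith) hrs

lemma quad (L : Lev ν μ h hinv α C₁ δ) {r l : ℝ} (hr : 0 < r) (hl : 1 ≤ l) :
    h r ≤ l ^ 2 * h (l * r) := by
  have hlr : 0 < l * r := by positivity
  rw [L.hdef r hr, L.hdef _ hlr, ← integral_const_mul]
  refine integral_mono (L.hint hr) ((L.hint hlr).const_mul _) fun x => ?_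
  simp only
  rw [← mul_assoc]
  have h0 := L.νnn x
  gcongr
  rw [mul_min_of_nonneg _ _ (by positivity)]
  refine le_min ?_ ?_
  · refine (min_le_left _ _).trans ?_
    nlinarith
  · refine (min_le_right _ _).trans (le_of_eq ?_)
    field_simp

lemma cutb (L : Lev ν μ h hinv α C₁ δ) {a b : ℝ} (ha : 0 ≤ a) (w : ℝ) :
    0 ≤ cut μ a b w ∧ cut μ a b w ≤ cut ν a b w := by
  unfold cut
  split_ifs with hc
  · have : w ≠ 0 := by
      intro h0; simp [h0] at hc; linarith
    exact L.μb w this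
  · simp

lemma cuteven (L : Lev ν μ h hinv α C₁ δ) {a b : ℝ} (w : ℝ) : cut μ a b (-w) = cut μ a b w := by
  simp [cut, L.μsymm]

lemma cutν (L : Lev ν μ h hinv α C₁ δ) {a b : ℝ} (w : ℝ) : 0 ≤ cut ν a b w ∧ cut ν a b w ≤ ν w := by
  unfold cut
  have := L.νnn w
  split_ifs <;> simp [this]

lemma intν (L : Lev ν μ h hinv α C₁ δ) {b : ℝ} (hb : 0 < b) :
    Integrable (fun w => w ^ 2 * cut ν 0 b w) := by
  refine ((L.hint hb).const_mul (b ^ 2)).mono' ?_ (Eventually.of_forall fun w => ?_)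
  · have := cut_meas L.νmeas 0 b
    fun_prop
  · have h1 := L.cutν (a := 0) (b := b) w
    rw [Real.norm_of_nonneg (mul_nonneg (sq_nonneg _) h1.1)]
    unfold cut
    split_ifs with hc
    · have h2 : w ^ 2 ≤ b ^ 2 := by rw [← sq_abs]; gcongr; exact hc.2
      have h3 : min 1 (w ^ 2 / b ^ 2) = w ^ 2 / b ^ 2 :=
        min_eq_right ((div_le_one (by positivity)).2 h2)
      rw [h3]
      apply le_of_eq; field_simp
    · have h0 := L.νnn w
      rw [mul_zero]; positivity

lemma good (L : Lev ν μ h hinv α C₁ δ) {b : ℝ} (hb : 0 < b) : Good (cut μ 0 b) b where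
  Rpos := hb
  meas := cut_meas L.μmeas _ _
  nn w := (L.cutb le_rfl w).1
  even := L.cuteven
  int := by
    refine (L.intν hb).mono' ?_ (Eventually.of_forall fun w => ?_)
    · have := cut_meas L.μmeas 0 b
      fun_prop
    · have h1 := L.cutb (a := 0) (b := b) le_rfl w
      rw [Real.norm_of_nonneg (mul_nonneg (sq_nonneg _) h1.1)]
      gcongr
      exact h1.2
  supp w hw := by
    unfold cut
    rw [if_neg]
    push Not
    intro _; exact hw

lemma cut_int (L : Lev ν μ h hinv α C₁ δ) {a b : ℝ} (ha : 0 < a) : Integrable (cut μ a b) := by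
  refine (L.hint ha).mono' (cut_meas L.μmeas _ _).aestronglyMeasurable
    (Eventually.of_forall fun w => ?_)
  have h1 := L.cutb (b := b) ha.le w
  rw [Real.norm_of_nonneg h1.1]
  refine h1.2.trans ?_
  unfold cut
  have h0 := L.νnn w
  split_ifs with hc
  · have h2 : a ^ 2 ≤ w ^ 2 := by rw [← sq_abs w]; gcongr; exact hc.1.le
    have h3 : min 1 (w ^ 2 / a ^ 2) = 1 := min_eq_left ((one_le_div (by positivity)).2 h2)
    rw [h3, one_mul]
  · positivity

lemma cut_sup (L : Lev ν μ h hinv α C₁ δ) {a b : ℝ} (ha : 0 < a) (w : ℝ) :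
    cut μ a b w ≤ 8 * h a / a := by
  have hp := L.hpos ha
  unfold cut
  split_ifs with hc
  · have e : μ w = μ |w| := by
      rcases abs_choice w with h | h <;> rw [h]
      rw [L.μsymm]
    rw [e]
    refine (L.μanti a |w| ha hc.1.le).trans ?_
    have h1 : ∫ x in Set.Ioc (a / 2) a, μ a = a / 2 * μ a := by
      rw [setIntegral_const]; simp; left; rw [max_eq_left (by linarith)]; ring
    have h4 : ∀ x ∈ Set.Ioc (a / 2) a, ν x ≤ 4 * (min 1 (x ^ 2 / a ^ 2) * ν x) := by
      intro x hx
      have h0 := L.νnn x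
      have : 1 / 4 ≤ min 1 (x ^ 2 / a ^ 2) := by
        refine le_min (by norm_num) ?_
        rw [div_le_div_iff₀ (by norm_num) (by positivity)]
        nlinarith [hx.1]
      nlinarith
    have h2 : ∫ x in Set.Ioc (a / 2) a, μ a ≤ ∫ x in Set.Ioc (a / 2) a, 4 * (min 1 (x ^ 2 / a ^ 2) * ν x) := by
      refine setIntegral_mono_on (by simp) ((L.hint ha).const_mul 4).integrableOn measurableSet_Ioc ?_
      intro x hx
      have hx0 : 0 < x := by linarith [hx.1]
      refine (L.μanti x a hx0 hx.2).trans ?_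
      exact (L.μb x hx0.ne').2.trans (h4 x hx)
    have h3 : ∫ x in Set.Ioc (a / 2) a, 4 * (min 1 (x ^ 2 / a ^ 2) * ν x) ≤ 4 * h a := by
      rw [L.hdef a ha, ← integral_const_mul]
      refine setIntegral_le_integral ((L.hint ha).const_mul 4) (Eventually.of_forall fun x => ?_)
      have h0 := L.νnn x
      simp only [Pi.zero_apply]; positivity
    rw [le_div_iff₀ ha]
    linarith
  · positivity

lemma K_ge (L : Lev ν μ h hinv α C₁ δ) : ∃ cK : ℝ, 0 < cK ∧ ∀ r : ℝ, 0 < r →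
    cK * h r * r ^ 2 ≤ ∫ w, w ^ 2 * cut ν 0 r w := by
  obtain ⟨l, hl1, hl⟩ : ∃ l : ℝ, 1 ≤ l ∧ 2 ≤ C₁ * l ^ α := by
    have h1 := (tendsto_rpow_atTop L.αpos).const_mul_atTop L.C₁pos
    obtain ⟨l, h2⟩ := ((eventually_ge_atTop (1:ℝ)).and (h1.eventually_ge_atTop 2)).exists
    exact ⟨l, h2⟩
  have hl0 : 0 < l := by linarith
  refine ⟨1 / (2 * l ^ 2), by positivity, fun r hr => ?_⟩
  set s := r / l with hs
  have hs0 : 0 < s := by positivity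
  have hls : l * s = r := by rw [hs]; field_simp
  have h1 := L.hlsc s hs0 l hl1
  rw [hls] at h1
  have hp := L.hpos hr
  have h2 : 2 * h r ≤ h s := by nlinarith
  have h3 : h s - h r ≤ (1 / s ^ 2) * ∫ w, w ^ 2 * cut ν 0 r w := by
    rw [L.hdef s hs0, L.hdef r hr, ← integral_sub (L.hint hs0) (L.hint hr), ← integral_const_mul]
    refine integral_mono ((L.hint hs0).sub (L.hint hr)) ((L.intν hr).const_mul _) fun w => ?_
    simp only
    have h0 := L.νnn w
    unfold cut
    split_ifs with hc
    · have : min 1 (w ^ 2 / s ^ 2) ≤ w ^ 2 / s ^ 2 := min_le_right _ _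
      have h5 : 0 ≤ min 1 (w ^ 2 / r ^ 2) * ν w := by positivity
      have : min 1 (w ^ 2 / s ^ 2) * ν w ≤ w ^ 2 / s ^ 2 * ν w := by gcongr
      calc _ ≤ w ^ 2 / s ^ 2 * ν w := by linarith
        _ = _ := by ring
    · rw [mul_zero, mul_zero]
      by_cases hw : w = 0
      · simp [hw]
      · have hw' : r < |w| := by
          by_contra hcon
          exact hc ⟨abs_pos.2 hw, not_lt.1 hcon⟩
        have h6 : r ^ 2 ≤ w ^ 2 := by rw [← sq_abs w]; gcongr
        have h7 : min 1 (w ^ 2 / r ^ 2) = 1 := min_eq_left ((one_le_div (by positivity)).2 h6)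
        rw [h7]
        have : min 1 (w ^ 2 / s ^ 2) ≤ 1 := min_le_left _ _
        nlinarith
  have h4 : h r ≤ (1 / s ^ 2) * ∫ w, w ^ 2 * cut ν 0 r w := by linarith
  have h5 : h r * s ^ 2 ≤ ∫ w, w ^ 2 * cut ν 0 r w := by
    rw [one_div_mul_eq_div, le_div_iff₀ (by positivity)] at h4
    exact h4
  have h6 : 0 ≤ h r * s ^ 2 := by positivity
  have h7 : 1 / (2 * l ^ 2) * h r * r ^ 2 = 1 / 2 * (h r * s ^ 2) := by
    rw [← hls]; field_simp
  rw [h7]; linarith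

lemma rho_mono (L : Lev ν μ h hinv α C₁ δ) {t τ : ℝ} (ht : 0 < t) (htτ : t ≤ τ) :
    hinv (1 / t) ≤ hinv (1 / τ) := by
  have hτ : 0 < τ := by linarith
  by_contra hcon
  push Not at hcon
  have := L.hanti (L.hinvpos (1 / τ) (by positivity)) (L.hinvpos (1 / t) (by positivity)) hcon
  rw [L.hinvr _ (by positivity), L.hinvr _ (by positivity)] at this
  have : 1 / τ ≤ 1 / t := by gcongr
  linarith

lemma psi_ge (L : Lev ν μ h hinv α C₁ δ) {a r : ℝ} (hr : 0 < r) (hra : r ≤ a) (hrδ : r ≤ δ) :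
    2 / Real.pi ^ 2 / r ^ 2 * ∫ w, w ^ 2 * cut ν 0 r w ≤ psiR (cut μ 0 a) (1 / r) := by
  have ha : 0 < a := by linarith
  unfold psiR
  rw [← integral_const_mul]
  refine integral_mono ((L.intν hr).const_mul _) ((L.good ha).intR _) fun w => ?_
  simp only
  have hg := (L.good ha).nn w
  have hcos := Real.cos_le_one (1 / r * w)
  by_cases hc : 0 < |w| ∧ |w| ≤ r
  · have e1 : cut ν 0 r w = ν w := if_pos hc
    have e2 : cut μ 0 a w = ν w := by
      rw [cut, if_pos ⟨hc.1, hc.2.trans hra⟩]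
      exact L.μeq w (abs_pos.1 hc.1) (hc.2.trans hrδ)
    rw [e1, e2, ← mul_assoc]
    have h0 := L.νnn w
    gcongr
    have h1 : |1 / r * w| ≤ 1 := by
      rw [abs_mul, abs_of_pos (by positivity), one_div_mul_eq_div]
      exact (div_le_one hr).2 hc.2
    have h2 := Real.cos_le_one_sub_mul_cos_sq (x := 1 / r * w) (by linarith [Real.pi_gt_three])
    calc _ = 2 / Real.pi ^ 2 * (1 / r * w) ^ 2 := by field_simp
      _ ≤ _ := by linarith
  · have e1 : cut ν 0 r w = 0 := if_neg hc
    rw [e1]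
    simp only [mul_zero]
    exact mul_nonneg (by linarith) hg

lemma psi_nonneg (L : Lev ν μ h hinv α C₁ δ) {a : ℝ} (ha : 0 < a) (ξ : ℝ) :
    0 ≤ psiR (cut μ 0 a) ξ := by
  refine integral_nonneg fun w => mul_nonneg ?_ ((L.good ha).nn w)
  linarith [Real.cos_le_one (ξ * w)]

lemma psi_abs (m : ℝ → ℝ) (ξ : ℝ) : psiR m |ξ| = psiR m ξ := by
  unfold psiR
  congr 1; ext w
  rw [← Real.cos_abs (ξ * w), ← Real.cos_abs (|ξ| * w), abs_mul, abs_mul, abs_abs]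

lemma decay (L : Lev ν μ h hinv α C₁ δ) {τ : ℝ} (hτ : 0 < τ) : ∃ c B : ℝ, 0 < c ∧
    ∀ t, 0 < t → t ≤ τ → ∀ a, min (hinv (1 / t)) δ ≤ a → ∀ ξ,
      c * (hinv (1 / t) * |ξ|) ^ α - B ≤ t * psiR (cut μ 0 a) ξ := by
  obtain ⟨cK, hcK, hK⟩ := L.K_ge
  have hα := L.αpos
  have hC := L.C₁pos
  have hδ := L.δpos
  set c := 2 / Real.pi ^ 2 * cK * C₁ with hc
  have hc0 : 0 < c := by have := Real.pi_pos; positivity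
  have hρτ := L.hinvpos (1 / τ) (by positivity)
  refine ⟨c, c * (max 1 (hinv (1 / τ) / δ)) ^ α, hc0, fun t ht htτ a ha ξ => ?_⟩
  set ρ := hinv (1 / t) with hρ
  have hρ0 : 0 < ρ := L.hinvpos _ (by positivity)
  have hmin : 0 < min ρ δ := lt_min hρ0 hδ
  have ha0 : 0 < a := by linarith
  rcases lt_or_ge |ξ| (1 / min ρ δ) with hξ | hξ
  · have h1 : ρ * |ξ| ≤ max 1 (hinv (1 / τ) / δ) := by
      have : ρ * |ξ| ≤ ρ * (1 / min ρ δ) := by gcongr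
      refine this.trans ?_
      rcases le_total ρ δ with h | h
      · rw [min_eq_left h]
        refine le_trans (le_of_eq ?_) (le_max_left _ _)
        field_simp
      · rw [min_eq_right h]
        refine le_trans (le_of_eq ?_) ((div_le_div_of_nonneg_right (L.rho_mono ht htτ) hδ.le).trans
          (le_max_right _ _))
        rw [← hρ]; ring
    have h2 : (ρ * |ξ|) ^ α ≤ (max 1 (hinv (1 / τ) / δ)) ^ α := by gcongr
    have h3 := mul_nonneg ht.le (L.psi_nonneg ha0 ξ)
    nlinarith
  · have hξ0 : 0 < |ξ| := lt_of_lt_of_le (by positivity) hξ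
    set r := 1 / |ξ| with hr
    have hr0 : 0 < r := by positivity
    have hrm : r ≤ min ρ δ := by
      rw [hr]; rw [div_le_iff₀ hmin] at hξ
      rw [div_le_iff₀ hξ0]; linarith
    have h1 := L.psi_ge hr0 (hrm.trans ha) (hrm.trans (min_le_right _ _))
    have h2 := hK r hr0
    have e : 1 / r = |ξ| := by rw [hr]; simp
    rw [e, psi_abs] at h1
    have hrρ : r ≤ ρ := hrm.trans (min_le_left _ _)
    have h3 := L.hlsc r hr0 (ρ / r) ((one_le_div hr0).2 hrρ)
    rw [div_mul_cancel₀ _ hr0.ne', hρ, L.hinvr _ (by positivity), ← hρ] at h3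
    have e2 : ρ / r = ρ * |ξ| := by rw [hr]; simp
    rw [e2] at h3
    have h4 : C₁ * (ρ * |ξ|) ^ α ≤ t * h r := by
      calc _ = t * (C₁ * (ρ * |ξ|) ^ α * (1 / t)) := by field_simp
        _ ≤ _ := by gcongr
    have h5 : 2 / Real.pi ^ 2 * cK * h r ≤ psiR (cut μ 0 a) ξ := by
      refine le_trans ?_ h1
      calc _ = 2 / Real.pi ^ 2 / r ^ 2 * (cK * h r * r ^ 2) := by field_simp
        _ ≤ _ := by gcongr
    have h6 : c * (ρ * |ξ|) ^ α ≤ t * psiR (cut μ 0 a) ξ := by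
      calc c * (ρ * |ξ|) ^ α = 2 / Real.pi ^ 2 * cK * (C₁ * (ρ * |ξ|) ^ α) := by rw [hc]; ring
        _ ≤ 2 / Real.pi ^ 2 * cK * (t * h r) := by gcongr
        _ = t * (2 / Real.pi ^ 2 * cK * h r) := by ring
        _ ≤ _ := by gcongr
    have h7 : 0 ≤ c * (max 1 (hinv (1 / τ) / δ)) ^ α := by positivity
    linarith

end Lev

lemma cosh_scale {θ y : ℝ} (h0 : 0 ≤ θ) (h1 : θ ≤ 1) :
    Real.cosh (θ * y) - 1 ≤ θ ^ 2 * Real.cosh y := by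
  have a1 := (hasSum_nat_add_iff' 1).2 (Real.hasSum_cosh (θ * y))
  have a2 := ((hasSum_nat_add_iff' 1).2 (Real.hasSum_cosh y)).mul_left (θ ^ 2)
  have := hasSum_le (fun n => ?_) a1 a2
  · simp at this
    nlinarith [sq_nonneg θ]
  · have e : (θ * y) ^ (2 * (n + 1)) / ((2 * (n + 1)).factorial : ℝ) =
      θ ^ (2 * (n + 1)) * (y ^ (2 * (n + 1)) / ((2 * (n + 1)).factorial : ℝ)) := by
      rw [mul_pow]; ring
    rw [e]
    have : 0 ≤ y ^ (2 * (n + 1)) := by rw [pow_mul]; positivity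
    gcongr ?_ * _
    exact pow_le_pow_of_le_one h0 h1 (by omega)

namespace Lev

lemma AA_le (L : Lev ν μ h hinv α C₁ δ) {R : ℝ} (hR : 0 < R) (κ : ℝ) :
    AA (cut μ 0 R) κ ≤ Real.cosh (κ * R) * h R := by
  unfold AA
  rw [L.hdef R hR, ← integral_const_mul]
  refine integral_mono ((L.good hR).intA κ) ((L.hint hR).const_mul _) fun w => ?_
  simp only
  have h0 := L.νnn w
  have hb := L.cutb (a := 0) (b := R) le_rfl w
  by_cases hc : 0 < |w| ∧ |w| ≤ R
  · have h2 : w ^ 2 ≤ R ^ 2 := by rw [← sq_abs w]; gcongr; exact hc.2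
    have h3 : min 1 (w ^ 2 / R ^ 2) = w ^ 2 / R ^ 2 :=
        min_eq_right ((div_le_one (by positivity)).2 h2)
    have h4 := cosh_scale (θ := |w| / R) (y := κ * R) (by positivity) ((div_le_one hR).2 hc.2)
    have e : Real.cosh (|w| / R * (κ * R)) = Real.cosh (κ * w) := by
      rw [← Real.cosh_abs (κ * w), ← Real.cosh_abs (|w| / R * (κ * R))]
      congr 1
      rw [abs_mul, abs_mul, abs_div, abs_abs, abs_of_pos hR, abs_mul]
      field_simp
    rw [e, div_pow, sq_abs] at h4
    have h5 := Real.one_le_cosh (κ * w)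
    calc _ ≤ (Real.cosh (κ * w) - 1) * ν w := by
          gcongr
          exact hb.2.trans (L.cutν w).2
      _ ≤ (w ^ 2 / R ^ 2 * Real.cosh (κ * R)) * ν w := by gcongr
      _ = _ := by rw [h3]; ring
  · have e1 : cut μ 0 R w = 0 := if_neg hc
    rw [e1, mul_zero]
    have := Real.cosh_pos (κ * R)
    positivity

lemma psi_eq (L : Lev ν μ h hinv α C₁ δ) {D : ℝ} (hD : 2 * δ ≤ D) (ξ : ℝ) :
    psiR (cut μ 0 D) ξ = ∫ w, (1 - Real.cos (ξ * w)) * μ w := by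
  unfold psiR
  congr 1; ext w
  by_cases hw : w = 0
  · simp [hw]
  · rcases le_total |w| D with h | h
    · rw [cut, if_pos ⟨abs_pos.2 hw, h⟩]
    · have h1 := L.μzero w (hD.trans h)
      rw [h1, cut]
      split_ifs
      · rw [h1]
      · rfl

lemma mh_eq {m : ℝ → ℝ} (hm : Integrable m) (he : ∀ w, m (-w) = m w) (ξ : ℝ) :
    (∫ y, m y : ℝ) - mh m ξ = psiC m ξ := by
  have i1 : Integrable (fun y : ℝ => cexp (-(y * ξ * I)) * (m y : ℂ)) := by
    refine (hm.ofReal (𝕜 := ℂ)).bdd_mul (c := 1) (by fun_prop) (Eventually.of_forall fun p => ?_)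
    rw [norm_e2]
  have i2 : Integrable (fun y : ℝ => cexp (y * ξ * I) * (m y : ℂ)) := by
    refine (hm.ofReal (𝕜 := ℂ)).bdd_mul (c := 1) (by fun_prop) (Eventually.of_forall fun p => ?_)
    rw [norm_e1]
  have h1 : mh m ξ = ∫ y : ℝ, cexp (y * ξ * I) * (m y : ℂ) := by
    rw [mh, ← integral_neg_eq_self]
    congr 1; ext y
    rw [he]; push_cast; ring_nf
  have h2 : mh m ξ = ∫ y : ℝ, Complex.cos (ξ * y) * (m y : ℂ) := by
    have h3 : mh m ξ = (1 / 2) * (mh m ξ + mh m ξ) := by ring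
    rw [h3]
    nth_rewrite 1 [h1]
    rw [mh, ← integral_add i2 i1, ← integral_const_mul]
    congr 1; ext y
    rw [Complex.cos]
    ring_nf
  have i3 : Integrable (fun y : ℝ => Complex.cos (ξ * y) * (m y : ℂ)) := by
    refine ((i1.add i2).const_mul (1 / 2)).congr (Eventually.of_forall fun y => ?_)
    simp only [Pi.add_apply]
    rw [Complex.cos]
    ring_nf
  have i4 : Integrable (fun y : ℝ => (m y : ℂ)) := hm.ofReal (𝕜 := ℂ)
  rw [h2, psiC, ← integral_complex_ofReal, ← integral_sub i4 i3]
  congr 1; ext y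
  ring

lemma psi_split (L : Lev ν μ h hinv α C₁ δ) {a b : ℝ} (ha : 0 < a) (hab : a ≤ b) (ξ : ℝ) :
    psiC (cut μ 0 b) ξ = psiC (cut μ 0 a) ξ + ((∫ y, cut μ a b y : ℝ) - mh (cut μ a b) ξ) := by
  rw [mh_eq (L.cut_int ha) L.cuteven]
  unfold psiC
  have e : ∀ w, cut μ 0 b w = cut μ 0 a w + cut μ a b w := by
    intro w
    unfold cut
    by_cases h1 : |w| ≤ a
    · have h2 : |w| ≤ b := h1.trans hab
      have h3 : ¬ a < |w| := not_lt.2 h1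
      simp [h1, h2, h3]
    · have h3 : a < |w| := not_le.1 h1
      have h4 : 0 < |w| := by linarith
      have h5 : w ≠ 0 := abs_pos.1 h4
      simp [h1, h3, h5]
  have i1 := (L.good ha).intC ξ
  have i2 : Integrable (fun w : ℝ => (1 - Complex.cos (ξ * w)) * (cut μ a b w : ℂ)) := by
    have := ((L.good (lt_of_lt_of_le ha hab)).intC ξ).sub i1
    refine this.congr (Eventually.of_forall fun w => ?_)
    simp only [Pi.sub_apply, e w]
    push_cast; ring
  rw [← integral_add i1 i2]
  congr 1; ext w
  rw [e w]; push_cast; ring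

lemma ph_split (L : Lev ν μ h hinv α C₁ δ) {a b : ℝ} (ha : 0 < a) (hab : a ≤ b) (t : ℝ) (k : ℕ) :
    ph (cut μ 0 b) t k = fun ξ => ph (cut μ 0 a) t k ξ *
      cexp (t * (mh (cut μ a b) ξ - (∫ y, cut μ a b y : ℝ))) := by
  ext ξ
  unfold ph
  rw [L.psi_split ha hab, mul_assoc, ← Complex.exp_add]
  ring_nf

end Lev
end LV

namespace LV
open Complex Topology
variable {ν μ h hinv : ℝ → ℝ} {α C₁ δ : ℝ}
namespace Lev

lemma phD (L : Lev ν μ h hinv α C₁ δ) {D : ℝ} (hD : 2 * δ ≤ D) (t : ℝ) (k : ℕ) :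
    ph (cut μ 0 D) t k = ph (cut μ 0 (2 * δ)) t k := by
  ext ξ
  unfold ph
  rw [psiC_real, psiC_real, L.psi_eq hD, L.psi_eq le_rfl]

lemma AA_zero (m : ℝ → ℝ) : AA m 0 = 0 := by simp [AA]

lemma regA (L : Lev ν μ h hinv α C₁ δ) {τ : ℝ} (hτ : 0 < τ) : ∃ C : ℝ, 0 < C ∧
    ∀ t, 0 < t → t ≤ τ → ∀ k ≤ 2, ∀ x,
      ‖Fo (ph (cut μ 0 (2 * δ)) t k) x‖ ≤ C / hinv (1 / t) ^ (k + 1) := by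
  obtain ⟨c, B, hc, hD⟩ := L.decay hτ
  have hδ := L.δpos
  have hM := MM_nonneg c α
  refine ⟨Real.exp B * MM c α + 1, by positivity, fun t ht htτ k hk x => ?_⟩
  have hρ := L.hinvpos (1 / t) (by positivity)
  have := (L.good (b := 2 * δ) (by linarith)).cs hc L.αpos hρ ht le_rfl
    (hD t ht htτ (2 * δ) ((min_le_right _ _).trans (by linarith))) hk x
  rw [AA_zero] at this
  simp only [neg_zero, zero_mul, mul_zero, Real.exp_zero, one_mul, add_zero, one_pow, mul_one] at this
  refine this.trans ?_
  gcongr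
  linarith

lemma exp_abs_int {s : ℝ} (hs : 0 < s) : Integrable (fun x : ℝ => Real.exp (-|s * x|)) := by
  have h1 : Integrable (fun x : ℝ => Real.exp (-|x|)) := by
    have := GG_int (c := 1) (α := 1) one_pos one_pos
    refine this.mono' (by fun_prop) (Eventually.of_forall fun x => ?_)
    rw [Real.norm_of_nonneg (Real.exp_nonneg _), GG]
    simp only [Real.rpow_one, neg_mul, one_mul]
    have : 1 ≤ (1 + |x|) ^ 2 := by nlinarith [abs_nonneg x]
    nlinarith [Real.exp_pos (-|x|)]
  exact h1.comp_mul_left' hs.ne'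

lemma regL1 (L : Lev ν μ h hinv α C₁ δ) {τ : ℝ} (hτ : 0 < τ) : ∃ J : ℝ, 0 < J ∧
    ∀ t, 0 < t → t ≤ τ → ∀ k ≤ 2,
      ∫⁻ x, ‖Fo (ph (cut μ 0 (hinv (1 / t))) t k) x‖ₑ ≤ ENNReal.ofReal (J / hinv (1 / t) ^ k) := by
  obtain ⟨c, B, hc, hD⟩ := L.decay hτ
  have hM := MM_nonneg c α
  have hE : 0 ≤ ∫ x : ℝ, Real.exp (-|x|) := integral_nonneg fun x => (Real.exp_pos _).le
  set E := ∫ x : ℝ, Real.exp (-|x|) with hEdef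
  refine ⟨Real.exp (Real.cosh 1) * Real.exp B * 4 * MM c α * E + 1, by positivity, fun t ht htτ k hk => ?_⟩
  have hρ := L.hinvpos (1 / t) (by positivity)
  have hhρ := L.hinvr (1 / t) (by positivity)
  set ρ := hinv (1 / t)
  have hA : t * AA (cut μ 0 ρ) (1 / ρ) ≤ Real.cosh 1 := by
    have := L.AA_le hρ (1 / ρ)
    rw [hhρ, one_div_mul_cancel hρ.ne'] at this
    calc _ ≤ t * (Real.cosh 1 * (1 / t)) := by gcongr
      _ = _ := by field_simp
  have key : ∀ x, ‖Fo (ph (cut μ 0 ρ) t k) x‖ ≤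
      (Real.exp (Real.cosh 1) * Real.exp B * 4 * MM c α / ρ ^ (k + 1)) * Real.exp (-|ρ⁻¹ * x|) := by
    intro x
    have := (L.good hρ).cs hc L.αpos hρ ht (κ := 1 / ρ) (by positivity)
      (hD t ht htτ ρ (min_le_left _ _)) hk x
    refine this.trans ?_
    rw [one_div_mul_cancel hρ.ne', abs_mul, abs_of_pos (inv_pos.2 hρ)]
    have h4 : (1 + 1 : ℝ) ^ k ≤ 4 := by
      calc (1 + 1 : ℝ) ^ k ≤ (1 + 1) ^ 2 := pow_le_pow_right₀ (by norm_num) hk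
        _ = 4 := by norm_num
    calc _ ≤ Real.exp (-(1 / ρ) * |x|) * Real.exp (Real.cosh 1) * Real.exp B * 4 * MM c α / ρ ^ (k + 1) := by
          gcongr
      _ = _ := by
          rw [show -(1 / ρ) * |x| = -(ρ⁻¹ * |x|) by ring]
          ring
  have hI := exp_abs_int (inv_pos.2 hρ)
  calc _ ≤ ∫⁻ x, ENNReal.ofReal ((Real.exp (Real.cosh 1) * Real.exp B * 4 * MM c α / ρ ^ (k + 1)) * Real.exp (-|ρ⁻¹ * x|)) := by
        refine lintegral_mono fun x => ?_
        rw [← ofReal_norm]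
        exact ENNReal.ofReal_le_ofReal (key x)
    _ = ENNReal.ofReal (∫ x, (Real.exp (Real.cosh 1) * Real.exp B * 4 * MM c α / ρ ^ (k + 1)) * Real.exp (-|ρ⁻¹ * x|)) := by
        rw [ofReal_integral_eq_lintegral_ofReal (hI.const_mul _)]
        exact Eventually.of_forall fun x => by positivity
    _ ≤ _ := by
        apply ENNReal.ofReal_le_ofReal
        rw [integral_const_mul, Measure.integral_comp_mul_left (fun x => Real.exp (-|x|)), inv_inv, abs_of_pos hρ,
          smul_eq_mul, ← hEdef]
        rw [div_mul_eq_mul_div, div_le_div_iff₀ (by positivity) (by positivity), pow_succ]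
        have : 0 ≤ ρ ^ k * ρ := by positivity
        nlinarith

lemma rB (L : Lev ν μ h hinv α C₁ δ) {τ : ℝ} (hτ : 0 < τ) : ∃ C : ℝ, 0 < C ∧
    ∀ t, 0 < t → t ≤ τ → ∀ k ≤ 2, ∀ x, (1 + 1 / α) * hinv (1 / t) < |x| →
      ‖Fo (ph (cut μ 0 (|x| / (1 + 1 / α))) t k) x‖ ≤ C / hinv (1 / t) ^ k * (t * h |x| / |x|) := by
  obtain ⟨c, B, hc, hD⟩ := L.decay hτ
  have hMM := MM_nonneg c α
  have hα := L.αpos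
  have hC1 := L.C₁pos
  obtain ⟨M, hMdef⟩ : ∃ M : ℝ, M = 1 + 1 / α := ⟨_, rfl⟩
  have hM1 : 1 ≤ M := by rw [hMdef]; have : 0 < 1 / α := by positivity
                         linarith
  have hM0 : 0 < M := by linarith
  rw [← hMdef]
  refine ⟨Real.exp (M ^ 2) * Real.exp B * (1 + 2 * M) ^ 2 * (MM c α + 1) * C₁ ^ (-(1 / α)), by positivity,
    fun t ht htτ k hk x hx => ?_⟩
  have hρ := L.hinvpos (1 / t) (by positivity)
  have hhρ := L.hinvr (1 / t) (by positivity)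
  set ρ := hinv (1 / t)
  set y := |x| with hy
  have hMρ : ρ ≤ M * ρ := le_mul_of_one_le_left hρ.le hM1
  have hρy : ρ < y := by linarith
  have hy0 : 0 < y := by linarith
  set r := y / M with hr
  have hr0 : 0 < r := by positivity
  have hρr : ρ < r := by rw [hr, lt_div_iff₀ hM0]; linarith
  have hMr : M * r = y := by rw [hr]; field_simp
  have hhy := L.hpos hy0
  set l := 1 / (t * h y) with hl
  have hq : h ρ ≤ (y / ρ) ^ 2 * h y := by
    have := L.quad hρ (l := y / ρ) ((one_le_div hρ).2 hρy.le)
    rwa [div_mul_cancel₀ _ hρ.ne'] at this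
  have hls : C₁ * (y / ρ) ^ α * h y ≤ h ρ := by
    have := L.hlsc ρ hρ (y / ρ) ((one_le_div hρ).2 hρy.le)
    rwa [div_mul_cancel₀ _ hρ.ne'] at this
  have hhyρ : h y ≤ h ρ := L.anti hρ hρy.le
  rw [hhρ] at hq hls hhyρ
  have hl1 : 1 ≤ l := by
    rw [hl, one_le_div (by positivity)]
    calc t * h y ≤ t * (1 / t) := by gcongr
      _ = 1 := by field_simp
  have hl0 : 0 < l := by linarith
  have hlq : l ≤ (y / ρ) ^ 2 := by
    rw [hl, div_le_iff₀ (by positivity)]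
    rw [div_le_iff₀ ht] at hq
    linarith
  have hll : C₁ * (y / ρ) ^ α ≤ l := by
    rw [hl, le_div_iff₀ (by positivity)]
    rw [le_div_iff₀ ht] at hls
    linarith
  have hlog : 0 ≤ Real.log l := Real.log_nonneg hl1
  have hκρ : Real.log l / r * ρ ≤ 2 * M := by
    have h1 : Real.log l ≤ 2 * Real.log (y / ρ) := by
      have := Real.log_le_log hl0 hlq
      rwa [Real.log_pow] at this
    have h2 : Real.log (y / ρ) ≤ y / ρ := by
      have := Real.log_le_sub_one_of_pos (show 0 < y / ρ by positivity)
      linarith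
    have : Real.log l ≤ 2 * (y / ρ) := by linarith
    calc Real.log l / r * ρ ≤ (2 * (y / ρ)) / r * ρ := by gcongr
      _ = 2 * M := by rw [← hMr]; field_simp
  have hAA : t * AA (cut μ 0 r) (Real.log l / r) ≤ M ^ 2 := by
    have h1 := L.AA_le hr0 (Real.log l / r)
    rw [div_mul_cancel₀ _ hr0.ne'] at h1
    have h2 : Real.cosh (Real.log l) ≤ l := by
      rw [Real.cosh_log hl0]
      have : l⁻¹ ≤ 1 := inv_le_one_of_one_le₀ hl1
      linarith
    have h3 := L.quad hr0 hM1
    rw [hMr] at h3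
    have hhr := L.hpos hr0
    calc _ ≤ t * (l * (M ^ 2 * h y)) := by
          gcongr
          refine h1.trans ?_
          gcongr
      _ = M ^ 2 := by rw [hl]; field_simp
  have hexp : Real.exp (-(Real.log l / r) * y) = l ^ (-M) := by
    rw [Real.rpow_def_of_pos hl0]
    congr 1
    rw [← hMr]; field_simp
  have hyl : y / ρ ≤ C₁ ^ (-(1 / α)) * l ^ (1 / α) := by
    have h1 : (y / ρ) ^ α ≤ C₁⁻¹ * l := by
      rw [inv_mul_eq_div, le_div_iff₀ hC1]; linarith
    have h2 := Real.rpow_le_rpow (by positivity) h1 (show 0 ≤ 1 / α by positivity)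
    rw [← Real.rpow_mul (by positivity), mul_one_div_cancel hα.ne', Real.rpow_one,
      Real.mul_rpow (by positivity) hl0.le, Real.inv_rpow hC1.le, ← Real.rpow_neg hC1.le] at h2
    exact h2
  have hfin : l ^ (-M) / ρ ≤ C₁ ^ (-(1 / α)) * (t * h y / y) := by
    have e1 : l ^ (-M) = l⁻¹ * (l ^ (1 / α))⁻¹ := by
      rw [← Real.rpow_neg hl0.le, ← Real.rpow_neg_one l, ← Real.rpow_add hl0, hMdef]
      congr 1; ring
    have e2 : t * h y = l⁻¹ := by rw [hl]; simp
    rw [e1, e2]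
    have hlp : 0 < l ^ (1 / α) := by positivity
    have : (l ^ (1 / α))⁻¹ / ρ ≤ C₁ ^ (-(1 / α)) / y := by
      rw [inv_eq_one_div, div_div, div_le_div_iff₀ (by positivity) hy0]
      rw [div_le_iff₀ hρ] at hyl
      linarith
    calc _ = l⁻¹ * ((l ^ (1 / α))⁻¹ / ρ) := by ring
      _ ≤ l⁻¹ * (C₁ ^ (-(1 / α)) / y) := by gcongr
      _ = _ := by ring
  have := (L.good hr0).cs hc hα hρ ht (κ := Real.log l / r) (by positivity)
      (hD t ht htτ r ((min_le_left _ _).trans hρr.le)) hk x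
  refine this.trans ?_
  rw [← hy, hexp]
  have h5 : (1 + Real.log l / r * ρ) ^ k ≤ (1 + 2 * M) ^ 2 := by
    calc _ ≤ (1 + 2 * M) ^ k := by gcongr
      _ ≤ _ := pow_le_pow_right₀ (by linarith) hk
  calc _ ≤ l ^ (-M) * Real.exp (M ^ 2) * Real.exp B * (1 + 2 * M) ^ 2 * (MM c α + 1) / ρ ^ (k + 1) := by
        gcongr
        linarith
    _ = Real.exp (M ^ 2) * Real.exp B * (1 + 2 * M) ^ 2 * (MM c α + 1) / ρ ^ k * (l ^ (-M) / ρ) := by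
        rw [div_mul_div_comm, pow_succ]; congr 1; ring
    _ ≤ Real.exp (M ^ 2) * Real.exp B * (1 + 2 * M) ^ 2 * (MM c α + 1) / ρ ^ k *
          (C₁ ^ (-(1 / α)) * (t * h y / y)) := by gcongr
    _ = _ := by ring

lemma regB (L : Lev ν μ h hinv α C₁ δ) {τ : ℝ} (hτ : 0 < τ) : ∃ C : ℝ, 0 < C ∧
    ∀ t, 0 < t → t ≤ τ → ∀ k ≤ 2, ∀ x, (1 + 1 / α) * hinv (1 / t) < |x| →
      ‖Fo (ph (cut μ 0 (2 * δ)) t k) x‖ ≤ C / hinv (1 / t) ^ k * (t * h |x| / |x|) := by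
  obtain ⟨C, hC, hB⟩ := L.rB hτ
  obtain ⟨J, hJ, hJ1⟩ := L.regL1 hτ
  obtain ⟨c, B, hc, hD⟩ := L.decay hτ
  have hα := L.αpos
  have hδ := L.δpos
  obtain ⟨M, hMdef⟩ : ∃ M : ℝ, M = 1 + 1 / α := ⟨_, rfl⟩
  have hM1 : 1 ≤ M := by rw [hMdef]; have : 0 < 1 / α := by positivity
                         linarith
  have hM0 : 0 < M := by linarith
  rw [← hMdef] at hB ⊢
  refine ⟨C + 8 * M ^ 3 * J, by positivity, fun t ht htτ k hk x hx => ?_⟩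
  have hB := hB t ht htτ k hk x hx
  have hJ1 := hJ1 t ht htτ k hk
  have hD := hD t ht htτ
  have hρ := L.hinvpos (1 / t) (by positivity)
  set ρ := hinv (1 / t)
  set y := |x| with hy
  have hMρ : ρ ≤ M * ρ := le_mul_of_one_le_left hρ.le hM1
  have hρy : ρ < y := by linarith
  have hy0 : 0 < y := by linarith
  have hhy := L.hpos hy0
  set r := y / M with hr
  have hr0 : 0 < r := by positivity
  have hρr : ρ < r := by rw [hr, lt_div_iff₀ hM0]; linarith
  have hMr : M * r = y := by rw [hr]; field_simp
  have h3 := L.quad hr0 hM1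
  rw [hMr] at h3
  have hhr := L.hpos hr0
  have i0 : Integrable (ph (cut μ 0 ρ) t k) :=
    (L.good hρ).ph_int hc hα hρ (hD ρ (min_le_left _ _)) hk
  have i1 : Integrable (ph (cut μ 0 r) t k) :=
    (L.good hr0).ph_int hc hα hρ (hD r ((min_le_left _ _).trans hρr.le)) hk
  have J2 := Fo_L1 i0 (L.cut_int (b := r) hρ) (cut_meas L.μmeas _ _) (fun w => (L.cutb hρ.le w).1) ht
    (show 0 ≤ J / ρ ^ k by positivity) hJ1
  rw [← L.ph_split hρ hρr.le] at J2
  have P := Fo_pt i1 (L.cut_int (b := r + 2 * δ) hr0) (cut_meas L.μmeas _ _) (fun w => (L.cutb hr0.le w).1) ht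
    (show 0 ≤ J / ρ ^ k by positivity) J2 (show 0 ≤ 8 * h r / r by positivity) (L.cut_sup hr0) x
  rw [← L.ph_split hr0 (by linarith), L.phD (by linarith)] at P
  refine P.trans ?_
  calc _ ≤ C / ρ ^ k * (t * h y / y) + t * (8 * (M ^ 2 * h y) / r) * (J / ρ ^ k) := by gcongr
    _ = _ := by rw [← hMr]; field_simp

end Lev
end LV

namespace LV
open Complex Topology
variable {ν μ h hinv : ℝ → ℝ} {α C₁ δ : ℝ}
namespace Lev

lemma rho_ge (L : Lev ν μ h hinv α C₁ δ) {τ : ℝ} (hτ : 0 < τ) : ∃ c : ℝ, 0 < c ∧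
    ∀ t, 0 < t → t ≤ τ → c * t ^ (1 / α) ≤ hinv (1 / t) := by
  have hα := L.αpos
  have hC1 := L.C₁pos
  have h1 := L.hpos one_pos
  refine ⟨min ((C₁ * h 1) ^ (1 / α)) (τ ^ (-(1 / α))), by positivity, fun t ht htτ => ?_⟩
  have hρ := L.hinvpos (1 / t) (by positivity)
  have hhρ := L.hinvr (1 / t) (by positivity)
  set ρ := hinv (1 / t)
  rcases le_total ρ 1 with hr | hr
  · have h2 := L.hlsc ρ hρ (1 / ρ) ((one_le_div hρ).2 hr)
    rw [one_div_mul_cancel hρ.ne', hhρ, one_div ρ, Real.inv_rpow hρ.le] at h2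
    have h3 : C₁ * h 1 * t ≤ ρ ^ α := by
      have hp : 0 < ρ ^ α := by positivity
      rw [le_div_iff₀ ht] at h2
      calc C₁ * h 1 * t = (C₁ * (ρ ^ α)⁻¹ * h 1 * t) * ρ ^ α := by field_simp
        _ ≤ 1 * ρ ^ α := by gcongr
        _ = _ := one_mul _
    have h4 := Real.rpow_le_rpow (by positivity) h3 (show 0 ≤ 1 / α by positivity)
    rw [← Real.rpow_mul hρ.le, mul_one_div_cancel hα.ne', Real.rpow_one,
      Real.mul_rpow (by positivity) ht.le] at h4
    refine le_trans ?_ h4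
    gcongr
    exact min_le_left _ _
  · refine le_trans ?_ hr
    calc _ ≤ τ ^ (-(1 / α)) * τ ^ (1 / α) := by
          gcongr
          exact min_le_right _ _
      _ = 1 := by rw [← Real.rpow_add hτ]; simp

lemma regC (L : Lev ν μ h hinv α C₁ δ) {τ ε p : ℝ} (hτ : 0 < τ) (hδ4 : 4 * δ ≤ 1)
    (hp : 0 ≤ p) (hq : p + 1 / α + 2 ≤ ε / (4 * δ)) : ∃ C : ℝ, 0 < C ∧
    ∀ t, 0 < t → t ≤ τ → ∀ k ≤ 2, ∀ x, ε ≤ |x| →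
      ‖Fo (ph (cut μ 0 (2 * δ)) t k) x‖ ≤ C / hinv (1 / t) ^ k * (t ^ p * Real.exp (-|x|)) := by
  obtain ⟨c, B, hc, hD⟩ := L.decay hτ
  obtain ⟨c', hc', hρge⟩ := L.rho_ge hτ
  have hMM := MM_nonneg c α
  have hα := L.αpos
  have hδ := L.δpos
  have hδ2 : 0 < 2 * δ := by linarith
  have hρτ := L.hinvpos (1 / τ) (by positivity)
  have hh := L.hpos hδ2
  obtain ⟨T, hT⟩ : ∃ T : ℝ, T = Real.exp 1 * τ := ⟨_, rfl⟩
  have hT0 : 0 < T := by rw [hT]; positivity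
  obtain ⟨K, hK⟩ : ∃ K : ℝ, K = 1 + hinv (1 / τ) / (2 * δ) := ⟨_, rfl⟩
  have hK0 : 0 < K := by rw [hK]; positivity
  refine ⟨Real.exp (T * h (2 * δ)) * Real.exp B * K ^ 2 * (MM c α + 1) * c'⁻¹ * T ^ (-(p + 1 / α)), by positivity,
    fun t ht htτ k hk x hx => ?_⟩
  have hρ := L.hinvpos (1 / t) (by positivity)
  have hρm := L.rho_mono ht htτ
  have hρge := hρge t ht htτ
  have hD := hD t ht htτ
  set ρ := hinv (1 / t)
  set s := T / t with hs
  have hse : Real.exp 1 ≤ s := by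
    rw [hs, le_div_iff₀ ht, hT]
    gcongr
  have hs0 : 0 < s := by positivity
  have hs1 : 1 ≤ s := le_trans (by linarith [Real.add_one_le_exp (1:ℝ)]) hse
  have hlog1 : 1 ≤ Real.log s := by rwa [Real.le_log_iff_exp_le hs0]
  have hlogs : Real.log s ≤ s := by linarith [Real.log_le_sub_one_of_pos hs0]
  have cs := (L.good hδ2).cs hc hα hρ ht (κ := Real.log s / (2 * δ)) (by positivity)
      (hD (2 * δ) ((min_le_right _ _).trans (by linarith))) hk x
  have hAA : t * AA (cut μ 0 (2 * δ)) (Real.log s / (2 * δ)) ≤ T * h (2 * δ) := by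
    have h1 := L.AA_le hδ2 (Real.log s / (2 * δ))
    rw [div_mul_cancel₀ _ hδ2.ne'] at h1
    have h2 : Real.cosh (Real.log s) ≤ s := by
      rw [Real.cosh_log hs0]
      have : s⁻¹ ≤ 1 := inv_le_one_of_one_le₀ hs1
      linarith
    calc _ ≤ t * (s * h (2 * δ)) := by
          gcongr
          refine h1.trans ?_
          gcongr
      _ = _ := by rw [hs]; field_simp
  have hexp : Real.exp (-(Real.log s / (2 * δ)) * |x|) ≤ s ^ (-(p + 1 / α + 2)) * Real.exp (-|x|) := by
    rw [Real.rpow_def_of_pos hs0, ← Real.exp_add]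
    apply Real.exp_le_exp.2
    have h1 : p + 1 / α + 2 ≤ |x| / (4 * δ) := hq.trans (by gcongr)
    have h2 : |x| ≤ |x| / (4 * δ) := by
      rw [le_div_iff₀ (by positivity)]
      nlinarith [abs_nonneg x]
    have h3 : Real.log s / (2 * δ) * |x| = Real.log s * (|x| / (4 * δ)) + Real.log s * (|x| / (4 * δ)) := by
      field_simp; ring
    have h4 : Real.log s * (p + 1 / α + 2) ≤ Real.log s * (|x| / (4 * δ)) := by gcongr
    have h5 : 1 * |x| ≤ Real.log s * (|x| / (4 * δ)) := by gcongr
    linarith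
  have hk2 : (1 + Real.log s / (2 * δ) * ρ) ^ k ≤ K ^ 2 * s ^ (2:ℝ) := by
    have h1 : 1 ≤ 1 + Real.log s / (2 * δ) * ρ := by
      have : 0 ≤ Real.log s / (2 * δ) * ρ := by positivity
      linarith
    calc _ ≤ (1 + Real.log s / (2 * δ) * ρ) ^ 2 := pow_le_pow_right₀ h1 hk
      _ ≤ (K * s) ^ 2 := by
          gcongr
          calc _ ≤ s + s / (2 * δ) * hinv (1 / τ) := by gcongr
            _ = K * s := by rw [hK]; ring
      _ = _ := by rw [mul_pow, Real.rpow_two]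
  have hρi : 1 / ρ ≤ c'⁻¹ * t ^ (-(1 / α)) := by
    rw [Real.rpow_neg ht.le, ← mul_inv, one_div]
    gcongr
  have hsp : s ^ (-(p + 1 / α + 2)) * s ^ (2:ℝ) = T ^ (-(p + 1 / α)) * t ^ (p + 1 / α) := by
    rw [← Real.rpow_add hs0, hs, Real.div_rpow hT0.le ht.le, div_eq_mul_inv, ← Real.rpow_neg ht.le]
    congr 2 <;> ring
  have htp : t ^ (p + 1 / α) * t ^ (-(1 / α)) = t ^ p := by
    rw [← Real.rpow_add ht]; congr 1; ring
  refine cs.trans ?_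
  calc _ ≤ (s ^ (-(p + 1 / α + 2)) * Real.exp (-|x|)) * Real.exp (T * h (2 * δ)) * Real.exp B * (K ^ 2 * s ^ (2:ℝ)) *
        (MM c α + 1) / ρ ^ (k + 1) := by
        gcongr
        linarith
    _ = (s ^ (-(p + 1 / α + 2)) * s ^ (2:ℝ)) * Real.exp (-|x|) * Real.exp (T * h (2 * δ)) * Real.exp B * K ^ 2 *
        (MM c α + 1) / ρ ^ k * (1 / ρ) := by
        rw [div_mul_div_comm, pow_succ]; congr 1; ring
    _ ≤ (s ^ (-(p + 1 / α + 2)) * s ^ (2:ℝ)) * Real.exp (-|x|) * Real.exp (T * h (2 * δ)) * Real.exp B * K ^ 2 *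
        (MM c α + 1) / ρ ^ k * (c'⁻¹ * t ^ (-(1 / α))) := by gcongr
    _ = _ := by rw [hsp, ← htp]; ring

lemma tg_nonneg (L : Lev ν μ h hinv α C₁ δ) {τ ε p t : ℝ} (hτ : 0 < τ) (hε : 0 < ε) (ht : 0 < t) (x : ℝ) :
    0 ≤ tg h hinv τ ε p t x := by
  have h1 := L.hinvpos (1 / t) (by positivity)
  have h2 := L.hinvpos (1 / τ) (by positivity)
  have h3 := L.hpos hε
  unfold tg
  split_ifs with hx hxe
  · positivity
  · have := L.hpos (abs_pos.2 hx)
    positivity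
  · positivity

lemma tg_bdd (L : Lev ν μ h hinv α C₁ δ) {τ ε p t : ℝ} (hτ : 0 < τ) (hε : 0 < ε) (ht : 0 < t) :
    ∃ K, ∀ x, tg h hinv τ ε p t x ≤ K := by
  have h1 := L.hinvpos (1 / t) (by positivity)
  have h2 := L.hinvpos (1 / τ) (by positivity)
  have h3 := L.hpos hε
  refine ⟨1 / hinv (1 / t) + min (1 / hinv (1 / τ)) (τ * h ε / ε) * Real.exp ε / τ ^ p * (t ^ p * 1), fun x => ?_⟩
  have hA : 0 ≤ 1 / hinv (1 / t) := by positivity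
  have hB : 0 ≤ min (1 / hinv (1 / τ)) (τ * h ε / ε) * Real.exp ε / τ ^ p * (t ^ p * 1) := by positivity
  unfold tg
  split_ifs with hx hxe
  · linarith
  · exact (min_le_left _ _).trans (by linarith)
  · refine le_trans ?_ (le_add_of_nonneg_left hA)
    gcongr
    exact Real.exp_le_one_iff.2 (by linarith [abs_nonneg x])

lemma main (L : Lev ν μ h hinv α C₁ δ) {τ ε p : ℝ} (hτ : 0 < τ) (hε : 0 < ε) (hδ4 : 4 * δ ≤ 1)
    (hp : 0 ≤ p) (hq : p + 1 / α + 2 ≤ ε / (4 * δ)) : ∃ C : ℝ, 0 < C ∧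
    ∀ t, 0 < t → t ≤ τ → ∀ k ≤ 2, ∀ x,
      ‖Fo (ph (cut μ 0 (2 * δ)) t k) x‖ ≤ C / hinv (1 / t) ^ k * tg h hinv τ ε p t x := by
  obtain ⟨A, hA0, hA⟩ := L.regA hτ
  obtain ⟨B, hB0, hB⟩ := L.regB hτ
  obtain ⟨C, hC0, hC⟩ := L.regC hτ hδ4 hp hq
  have hα := L.αpos
  obtain ⟨M, hMdef⟩ : ∃ M : ℝ, M = 1 + 1 / α := ⟨_, rfl⟩
  have hM1 : 1 ≤ M := by rw [hMdef]; have : 0 < 1 / α := by positivity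
                         linarith
  have hM0 : 0 < M := by linarith
  rw [← hMdef] at hB
  obtain ⟨Q, hQ⟩ : ∃ Q, Q = min (1 / hinv (1 / τ)) (τ * h ε / ε) * Real.exp ε / τ ^ p := ⟨_, rfl⟩
  have h2 := L.hinvpos (1 / τ) (by positivity)
  have h3 := L.hpos hε
  have hQ0 : 0 < Q := by rw [hQ]; positivity
  have hA3 : 0 < A * M ^ 3 := by positivity
  have hCQ : 0 < C / Q := by positivity
  refine ⟨A * M ^ 3 + B + C / Q, by positivity, fun t ht htτ k hk x => ?_⟩
  have hA := hA t ht htτ k hk x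
  have hB := hB t ht htτ k hk x
  have hC := hC t ht htτ k hk x
  have hρ := L.hinvpos (1 / t) (by positivity)
  have hhρ := L.hinvr (1 / t) (by positivity)
  have htg := L.tg_nonneg (p := p) hτ hε ht x
  have fin : ∀ D E : ℝ, 0 < D → D ≤ A * M ^ 3 + B + C / Q → E ≤ tg h hinv τ ε p t x →
      ‖Fo (ph (cut μ 0 (2 * δ)) t k) x‖ ≤ D / hinv (1 / t) ^ k * E →
      ‖Fo (ph (cut μ 0 (2 * δ)) t k) x‖ ≤ (A * M ^ 3 + B + C / Q) / hinv (1 / t) ^ k * tg h hinv τ ε p t x := by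
    intro D E hD hD1 hE hF
    refine hF.trans ?_
    calc _ ≤ D / hinv (1 / t) ^ k * tg h hinv τ ε p t x := by gcongr
      _ ≤ _ := by gcongr
  by_cases hx : x = 0
  · refine fin A (1 / hinv (1 / t)) hA0 ?_ (by simp [tg, hx]) ?_
    · have : A ≤ A * M ^ 3 := le_mul_of_one_le_right hA0.le (one_le_pow₀ hM1)
      linarith
    · refine hA.trans (le_of_eq ?_)
      rw [div_mul_div_comm, mul_one, pow_succ]
  have hx0 := abs_pos.2 hx
  have hhx := L.hpos hx0
  by_cases hxe : |x| < ε
  · have etg : tg h hinv τ ε p t x = min (1 / hinv (1 / t)) (t * h |x| / |x|) := by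
      simp [tg, hx, hxe]
    set ρ := hinv (1 / t)
    rcases le_or_gt |x| (M * ρ) with hc | hc
    · refine fin (A * M ^ 3) (1 / (M ^ 3 * ρ)) hA3 (by linarith) ?_ ?_
      · rw [etg]
        refine le_min ?_ ?_
        · apply one_div_le_one_div_of_le hρ
          exact le_mul_of_one_le_left hρ.le (one_le_pow₀ hM1)
        · have q := L.quad hρ hM1
          rw [hhρ] at q
          have a1 := L.anti hx0 hc
          have hh := L.hpos (show 0 < M * ρ by positivity)
          calc 1 / (M ^ 3 * ρ) = t * (1 / t) / (M ^ 2 * (M * ρ)) := by field_simp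
            _ ≤ t * (M ^ 2 * h (M * ρ)) / (M ^ 2 * (M * ρ)) := by gcongr
            _ = t * h (M * ρ) / (M * ρ) := by field_simp
            _ ≤ _ := by gcongr
      · refine hA.trans (le_of_eq ?_)
        rw [div_mul_div_comm, pow_succ]
        field_simp
    · refine fin B (t * h |x| / |x|) hB0 (by linarith) ?_ (hB hc)
      rw [etg]
      refine le_min ?_ le_rfl
      have hρx : ρ ≤ |x| := (le_mul_of_one_le_left hρ.le hM1).trans hc.le
      have a1 := L.anti hρ hρx
      rw [hhρ] at a1
      calc _ ≤ t * (1 / t) / ρ := by gcongr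
        _ = 1 / ρ := by field_simp
  · refine fin (C / Q) (Q * (t ^ p * Real.exp (-|x|))) hCQ (by linarith) ?_ ?_
    · simp [tg, hx, hxe, hQ]
    · refine (hC (not_lt.1 hxe)).trans (le_of_eq ?_)
      field_simp
end Lev
end LV

namespace LV
open Complex Topology

lemma Fo_deriv {φ φ' : ℝ → ℂ} (hφ : Integrable φ) (hφ' : Integrable φ') (he : ∀ ξ : ℝ, φ' ξ = ξ * I * φ ξ) (x : ℝ) :
    HasDerivAt (Fo φ) (Fo φ' x) x := by
  have := hasDerivAt_integral_of_dominated_loc_of_deriv_le (μ := volume) (𝕜 := ℝ)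
    (F := fun (x ξ : ℝ) => cexp (x * ξ * I) * φ ξ) (F' := fun (x ξ : ℝ) => cexp (x * ξ * I) * φ' ξ)
    (x₀ := x) (s := Set.univ) (bound := fun ξ => ‖φ' ξ‖) Filter.univ_mem ?_ ?_ ?_ ?_ hφ'.norm ?_
  · exact this.2
  · exact Eventually.of_forall fun x => AEStronglyMeasurable.mul (by fun_prop) hφ.1
  · refine hφ.norm.mono' (AEStronglyMeasurable.mul (by fun_prop) hφ.1) (Eventually.of_forall fun ξ => ?_)
    rw [norm_mul, norm_e1, one_mul]
  · exact AEStronglyMeasurable.mul (by fun_prop) hφ'.1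
  · exact Eventually.of_forall fun ξ x _ => by rw [norm_mul, norm_e1, one_mul]
  · refine Eventually.of_forall fun ξ x _ => ?_
    have h1 : HasDerivAt (fun x : ℝ => (x : ℂ) * ξ * I) (ξ * I) x := by
      have := ((Complex.ofRealCLM.hasDerivAt (x := x)).mul_const (ξ : ℂ)).mul_const I
      simpa using this
    have h2 := h1.cexp.mul_const (φ ξ)
    refine h2.congr_deriv ?_
    rw [he]; ring

lemma diffs {F F1 F2 : ℝ → ℝ} (hF : ∀ v, HasDerivAt F (F1 v) v) (hF1 : ∀ v, HasDerivAt F1 (F2 v) v)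
    {W S0 S1 S2 : ℝ} (h0 : ∀ v, |v| ≤ W → |F v| ≤ S0) (h1 : ∀ v, |v| ≤ W → |F1 v| ≤ S1)
    (h2 : ∀ v, |v| ≤ W → |F2 v| ≤ S2) {w : ℝ} (hw : |w| ≤ W) :
    |F w - F 0| ≤ 2 * S0 ∧ |F w - F 0| ≤ S1 * |w| ∧ |F w + F (-w) - 2 * F 0| ≤ 4 * S0 ∧
    |F w + F (-w) - 2 * F 0| ≤ 2 * S2 * w ^ 2 := by
  have hz : |(0:ℝ)| ≤ W := by rw [abs_zero]; exact (abs_nonneg w).trans hw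
  have a1 := abs_le.1 (h0 w hw)
  have a2 := abs_le.1 (h0 (-w) (by rwa [abs_neg]))
  have a3 := abs_le.1 (h0 0 hz)
  have cvx : Convex ℝ (Set.Icc (-|w|) |w|) := convex_Icc _ _
  have mw : w ∈ Set.Icc (-|w|) |w| := ⟨neg_abs_le w, le_abs_self w⟩
  have m0 : (0:ℝ) ∈ Set.Icc (-|w|) |w| := ⟨by linarith [abs_nonneg w], abs_nonneg w⟩
  refine ⟨abs_le.2 ⟨by linarith, by linarith⟩, ?_, abs_le.2 ⟨by linarith, by linarith⟩, ?_⟩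
  · have := cvx.norm_image_sub_le_of_norm_hasDerivWithin_le (f := F) (f' := F1) (C := S1)
      (fun v _ => (hF v).hasDerivWithinAt) (fun v hv => h1 v ((abs_le.2 hv).trans hw)) m0 mw
    simpa using this
  · have hd : ∀ v, HasDerivAt (fun v => F v + F (-v)) (F1 v - F1 (-v)) v := by
      intro v
      have e := (hF v).add ((hF (-v)).comp v (hasDerivAt_neg v))
      refine e.congr_deriv ?_
      ring
    have bd : ∀ v ∈ Set.Icc (-|w|) |w|, ‖F1 v - F1 (-v)‖ ≤ 2 * S2 * |w| := by
      intro v hv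
      have hv' : -v ∈ Set.Icc (-|w|) |w| := ⟨by linarith [hv.2], by linarith [hv.1]⟩
      have := cvx.norm_image_sub_le_of_norm_hasDerivWithin_le (f := F1) (f' := F2) (C := S2)
        (fun v _ => (hF1 v).hasDerivWithinAt) (fun v hv => h2 v ((abs_le.2 hv).trans hw)) hv' hv
      refine this.trans ?_
      have hS : 0 ≤ S2 := (abs_nonneg _).trans (h2 0 hz)
      rw [sub_neg_eq_add, Real.norm_eq_abs]
      have : |v + v| ≤ 2 * |w| := by rw [← two_mul, abs_mul, abs_two]; linarith [abs_le.2 hv]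
      nlinarith
    have := cvx.norm_image_sub_le_of_norm_hasDerivWithin_le (f := fun v => F v + F (-v)) (C := 2 * S2 * |w|)
      (fun v _ => (hd v).hasDerivWithinAt) bd m0 mw
    rw [sub_zero, Real.norm_eq_abs, Real.norm_eq_abs, mul_assoc, abs_mul_abs_self] at this
    convert this using 2
    · simp; ring
    · ring

variable {ν μ h hinv : ℝ → ℝ} {α C₁ δ : ℝ}
namespace Lev

lemma dif (L : Lev ν μ h hinv α C₁ δ) {τ ε p : ℝ} (hτ : 0 < τ) (hε : 0 < ε) (hδ4 : 4 * δ ≤ 1)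
    (hp : 0 ≤ p) (hq : p + 1 / α + 2 ≤ ε / (4 * δ)) {ψ : ℝ → ℝ} {g : ℝ → ℝ → ℝ}
    (hψ : ∀ ξ : ℝ, ψ ξ = ∫ x : ℝ, (1 - Real.cos (ξ * x)) * μ x)
    (hg : ∀ t : ℝ, 0 < t → ∀ x : ℝ,
      g t x = (2 * Real.pi)⁻¹ * ∫ ξ : ℝ, Real.cos (x * ξ) * Real.exp (-t * ψ ξ)) : ∃ C : ℝ, 0 < C ∧
    ∀ t, 0 < t → t ≤ τ → ∀ a x S : ℝ,
      (∀ u ∈ Set.Icc (-(2 * δ)) (2 * δ), tg h hinv τ ε p t (x + a * u) ≤ S) → ∀ w, |w| ≤ 2 * δ →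
      |g t (x + a * w) - g t x| ≤ C * S * min 1 (|a * w| / hinv (1 / t)) ∧
      |g t (x + a * w) + g t (x - a * w) - 2 * g t x| ≤ C * S * min 1 ((a * w) ^ 2 / hinv (1 / t) ^ 2) := by
  obtain ⟨C, hC0, hC⟩ := L.main hτ hε hδ4 hp hq
  obtain ⟨c, B, hc, hD⟩ := L.decay hτ
  have hδ := L.δpos
  refine ⟨4 * C, by positivity, fun t ht htτ a x S hS w hw => ?_⟩
  have hC := hC t ht htτ
  have hρ := L.hinvpos (1 / t) (by positivity)
  have hint : ∀ k ≤ 2, Integrable (ph (cut μ 0 (2 * δ)) t k) := fun k hk =>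
    (L.good (by linarith)).ph_int hc L.αpos hρ
      (hD t ht htτ (2 * δ) ((min_le_right _ _).trans (by linarith))) hk
  set ρ := hinv (1 / t)
  have hS0 : 0 ≤ S := (L.tg_nonneg hτ hε ht _).trans (hS 0 ⟨by linarith, by linarith⟩)
  have hgG : ∀ x, g t x = (2 * Real.pi)⁻¹ * (Fo (ph (cut μ 0 (2 * δ)) t 0) x).re := by
    intro x
    rw [hg t ht]
    congr 1
    have hi : Integrable (fun ξ : ℝ => cexp (x * ξ * I) * ph (cut μ 0 (2 * δ)) t 0 ξ) := by
      refine (hint 0 (by norm_num)).norm.mono' (AEStronglyMeasurable.mul (by fun_prop) (hint 0 (by norm_num)).1)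
        (Eventually.of_forall fun ξ => ?_)
      rw [norm_mul, norm_e1, one_mul]
    have := Complex.reCLM.integral_comp_comm hi
    unfold Fo
    simp only [Complex.reCLM_apply] at this
    rw [← this]
    congr 1; ext ξ
    unfold ph
    rw [psiC_real, L.psi_eq le_rfl, ← hψ, pow_zero, one_mul, ← ofReal_neg, ← ofReal_mul, ← ofReal_mul, ← ofReal_exp,
      re_mul_ofReal, exp_ofReal_mul_I_re]
  have dFo : ∀ k ≤ 1, ∀ x, HasDerivAt (Fo (ph (cut μ 0 (2 * δ)) t k)) (Fo (ph (cut μ 0 (2 * δ)) t (k + 1)) x) x := by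
    intro k hk x
    refine Fo_deriv (hint k (by omega)) (hint (k + 1) (by omega)) (fun ξ => ?_) x
    unfold ph
    rw [pow_succ]; ring
  set F : ℕ → ℝ → ℝ := fun k v => a ^ k * ((2 * Real.pi)⁻¹ * (Fo (ph (cut μ 0 (2 * δ)) t k) (x + a * v)).re) with hF
  have dF : ∀ k ≤ 1, ∀ v, HasDerivAt (F k) (F (k + 1) v) v := by
    intro k hk v
    have h1 : HasDerivAt (fun v : ℝ => x + a * v) a v := by
      simpa using ((hasDerivAt_id v).const_mul a).const_add x
    have h2 := (dFo k hk (x + a * v)).scomp v h1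
    have h3 := ((Complex.reCLM.hasFDerivAt.comp_hasDerivAt v h2).const_mul ((2 * Real.pi)⁻¹)).const_mul (a ^ k)
    refine h3.congr_deriv ?_
    simp only [hF, Complex.reCLM_apply, Complex.real_smul, Complex.re_ofReal_mul]
    ring
  have bF : ∀ k ≤ 2, ∀ v, |v| ≤ 2 * δ → |F k v| ≤ C * S * (|a| / ρ) ^ k := by
    intro k hk v hv
    have h1 := hC k hk (x + a * v)
    have h2 := hS v (abs_le.1 hv)
    have h3 := Complex.abs_re_le_norm (Fo (ph (cut μ 0 (2 * δ)) t k) (x + a * v))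
    have hpi : |(2 * Real.pi)⁻¹| ≤ 1 := by
      rw [abs_of_pos (by positivity)]
      exact inv_le_one_of_one_le₀ (by linarith [Real.two_le_pi])
    simp only [hF]
    rw [abs_mul, abs_mul, abs_pow]
    calc _ ≤ |a| ^ k * (1 * (C / ρ ^ k * S)) := by
          gcongr
          exact h3.trans (h1.trans (by gcongr))
      _ = _ := by rw [div_pow]; ring
  obtain ⟨r1, r2, r3, r4⟩ := diffs (dF 0 (by norm_num)) (dF 1 le_rfl) (bF 0 (by norm_num)) (bF 1 (by norm_num))
    (bF 2 le_rfl) hw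
  have e : ∀ v, F 0 v = g t (x + a * v) := by
    intro v; rw [hgG]; simp [hF]
  rw [e, e] at r1 r2
  rw [e, e, e] at r3 r4
  rw [show x + a * 0 = x by ring] at r1 r2 r3 r4
  rw [show x + a * -w = x - a * w by ring] at r3 r4
  have hCS : 0 ≤ C * S := by positivity
  constructor
  · rw [mul_min_of_nonneg _ _ (by positivity)]
    refine le_min (r1.trans ?_) (r2.trans ?_)
    · rw [pow_zero]; linarith
    · have : 0 ≤ C * S * (|a| / ρ * |w|) := by positivity
      rw [abs_mul, pow_one]
      calc _ = C * S * (|a| / ρ * |w|) := by ring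
        _ ≤ 4 * (C * S * (|a| / ρ * |w|)) := by linarith
        _ = _ := by ring
  · rw [mul_min_of_nonneg _ _ (by positivity)]
    refine le_min (r3.trans ?_) (r4.trans ?_)
    · rw [pow_zero]; linarith
    · have : 0 ≤ C * S * (|a| ^ 2 / ρ ^ 2 * w ^ 2) := by positivity
      rw [div_pow, mul_pow]
      calc _ = 2 * (C * S * (|a| ^ 2 / ρ ^ 2 * w ^ 2)) := by ring
        _ ≤ 4 * (C * S * (|a| ^ 2 / ρ ^ 2 * w ^ 2)) := by linarith
        _ = _ := by rw [sq_abs]; ring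

lemma int_le (L : Lev ν μ h hinv α C₁ δ) {R K : ℝ} (hR : 0 < R) (hK : 0 ≤ K) {F : ℝ → ℝ} (hF : ∀ w, 0 ≤ F w)
    (hFb : ∀ w, |w| ≤ 2 * δ → F w ≤ K * min 1 (w ^ 2 / R ^ 2)) : ∫ w, F w * μ w ≤ K * h R := by
  rw [L.hdef R hR, ← integral_const_mul]
  have h0 : ∀ᵐ w : ℝ, w ≠ 0 := by
    rw [ae_iff]; simp
  refine integral_mono_of_nonneg ?_ ((L.hint hR).const_mul K) ?_
  · filter_upwards [h0] with w hw
    exact mul_nonneg (hF w) (L.μb w hw).1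
  · filter_upwards [h0] with w hw
    have hn := L.νnn w
    rcases le_total |w| (2 * δ) with hd | hd
    · rw [← mul_assoc]
      have := L.μb w hw
      have h1 := hFb w hd
      exact mul_le_mul h1 this.2 this.1 (by positivity)
    · rw [L.μzero w hd, mul_zero]
      positivity

lemma hscale (L : Lev ν μ h hinv α C₁ δ) {ρ s : ℝ} (hρ : 0 < ρ) (hs : 0 < s) :
    h (ρ / s) ≤ (1 + 1 / C₁) * (s ^ α + s ^ 2) * h ρ := by
  have hC := L.C₁pos
  have hh := L.hpos hρ
  have hsα : 0 < s ^ α := by positivity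
  have hC' : 0 < 1 / C₁ := by positivity
  rcases le_total 1 s with h1 | h1
  · have := L.quad (show 0 < ρ / s by positivity) h1
    rw [mul_div_cancel₀ _ hs.ne'] at this
    refine this.trans ?_
    gcongr
    nlinarith [sq_nonneg s, mul_pos hC' hsα, mul_nonneg hC'.le (sq_nonneg s)]
  · have := L.hlsc ρ hρ (1 / s) ((one_le_div hs).2 h1)
    rw [one_div_mul_eq_div, one_div, Real.inv_rpow hs.le] at this
    have h2 : h (ρ / s) ≤ (1 / C₁ * s ^ α) * h ρ := by
      calc h (ρ / s) = (1 / C₁ * s ^ α) * (C₁ * (s ^ α)⁻¹ * h (ρ / s)) := by field_simp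
        _ ≤ _ := by gcongr
    refine h2.trans (mul_le_mul_of_nonneg_right ?_ hh.le)
    nlinarith [sq_nonneg s, mul_pos hC' hsα, mul_nonneg hC'.le (sq_nonneg s)]

lemma I1 (L : Lev ν μ h hinv α C₁ δ) {ρ a K : ℝ} (hρ : 0 < ρ) (hK : 0 ≤ K) {F : ℝ → ℝ} (hF : ∀ w, 0 ≤ F w)
    (hFb : ∀ w, |w| ≤ 2 * δ → F w ≤ K * min 1 ((a * w) ^ 2 / ρ ^ 2)) :
    ∫ w, F w * μ w ≤ K * ((1 + 1 / C₁) * (|a| ^ α + |a| ^ 2) * h ρ) := by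
  have hC := L.C₁pos
  have hh := L.hpos hρ
  by_cases ha : a = 0
  · have h1 : ∫ w, F w * μ w ≤ 0 * h ρ := by
      refine L.int_le hρ le_rfl hF fun w hw => ?_
      have := hFb w hw
      simpa [ha] using this
    refine h1.trans ?_
    rw [zero_mul]
    positivity
  · have ha' := abs_pos.2 ha
    refine (L.int_le (R := ρ / |a|) (by positivity) hK hF fun w hw => ?_).trans
      (mul_le_mul_of_nonneg_left (L.hscale hρ ha') hK)
    refine (hFb w hw).trans (le_of_eq ?_)
    rw [div_pow, sq_abs, mul_pow]
    congr 2
    field_simp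

lemma I3 (L : Lev ν μ h hinv α C₁ δ) {ρ ρ' a b K : ℝ} (hρ : 0 < ρ) (hρ' : 0 < ρ') (hK : 0 ≤ K) {F : ℝ → ℝ}
    (hF : ∀ w, 0 ≤ F w)
    (hFb : ∀ w, |w| ≤ 2 * δ → F w ≤ K * (min 1 (|a * w| / ρ) * min 1 (|b * w| / ρ'))) :
    ∫ w, F w * μ w ≤ K * ((1 + 1 / C₁) * ((|a| * |b|) ^ (α / 2) + |a| * |b|) * h (√(ρ * ρ'))) := by
  have hab : 0 ≤ |a| * |b| := by positivity
  have := L.I1 (ρ := √(ρ * ρ')) (a := √(|a| * |b|)) (by positivity) hK hF fun w hw => ?_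
  · rw [abs_of_nonneg (Real.sqrt_nonneg _), Real.sq_sqrt hab, Real.sqrt_eq_rpow, ← Real.rpow_mul hab,
      one_div_mul_eq_div] at this
    exact this
  · refine (hFb w hw).trans ?_
    gcongr
    rw [mul_pow, Real.sq_sqrt hab, Real.sq_sqrt (by positivity)]
    refine le_min ?_ ?_
    · exact mul_le_one₀ (min_le_left _ _) (by positivity) (min_le_left _ _)
    · calc _ ≤ (|a * w| / ρ) * (|b * w| / ρ') := by
            gcongr
            · exact min_le_right _ _
            · exact min_le_right _ _
        _ = _ := by rw [abs_mul, abs_mul, ← sq_abs w]; field_simp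

lemma h_le (L : Lev ν μ h hinv α C₁ δ) {τ β C₂ c : ℝ} (hτ : 0 < τ) (hβ : 0 < β) (hC₂ : 0 < C₂) (hc : 0 < c)
    (husc : ∀ θ : ℝ, 0 < θ → θ ≤ 1 → ∀ l : ℝ, 0 < l → l ≤ 1 → h (l * θ) ≤ C₂ * l ^ (-β) * h θ) :
    ∃ C : ℝ, 0 < C ∧ ∀ t, 0 < t → t ≤ τ → ∀ ρ, c * t ^ (1 / α) ≤ ρ → h ρ ≤ C / t ^ (β / α) := by
  have h1 := L.hpos one_pos
  have hα := L.αpos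
  have k1 : 0 < C₂ * c ^ (-β) * h 1 := by positivity
  have k2 : 0 < h 1 * τ ^ (β / α) := by positivity
  refine ⟨C₂ * c ^ (-β) * h 1 + h 1 * τ ^ (β / α), by positivity, fun t ht htτ ρ hρ => ?_⟩
  have hp : 0 < c * t ^ (1 / α) := by positivity
  have hρ0 : 0 < ρ := by linarith
  have htb : 0 < t ^ (β / α) := by positivity
  rcases le_total ρ 1 with hr | hr
  · have := husc 1 one_pos le_rfl ρ hρ0 hr
    rw [mul_one] at this
    have h2 : ρ ^ (-β) ≤ c ^ (-β) / t ^ (β / α) := by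
      have := Real.rpow_le_rpow_of_nonpos hp hρ (show -β ≤ 0 by linarith)
      rw [Real.mul_rpow hc.le (by positivity), ← Real.rpow_mul ht.le] at this
      refine this.trans (le_of_eq ?_)
      rw [div_eq_mul_inv (c ^ (-β)), ← Real.rpow_neg ht.le]
      congr 2; ring
    calc h ρ ≤ C₂ * ρ ^ (-β) * h 1 := this
      _ ≤ C₂ * (c ^ (-β) / t ^ (β / α)) * h 1 := by gcongr
      _ = (C₂ * c ^ (-β) * h 1) / t ^ (β / α) := by ring
      _ ≤ _ := by gcongr; linarith
  · calc h ρ ≤ h 1 := L.anti one_pos hr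
      _ = h 1 * t ^ (β / α) / t ^ (β / α) := by field_simp
      _ ≤ h 1 * τ ^ (β / α) / t ^ (β / α) := by gcongr
      _ ≤ _ := by gcongr; linarith

lemma le_sup (L : Lev ν μ h hinv α C₁ δ) {τ ε p t : ℝ} (hτ : 0 < τ) (hε : 0 < ε) (ht : 0 < t) (x a : ℝ) :
    ∀ u ∈ Set.Icc (-(2 * δ)) (2 * δ), tg h hinv τ ε p t (x + a * u) ≤
      ⨆ u ∈ Set.Icc (-(2 * δ)) (2 * δ), tg h hinv τ ε p t (x + a * u) := by
  intro u hu
  obtain ⟨K, hK⟩ := L.tg_bdd (p := p) hτ hε ht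
  have hK0 : 0 ≤ K := (L.tg_nonneg hτ hε ht 0).trans (hK 0)
  refine le_ciSup_of_le ⟨K, ?_⟩ u ?_
  · rintro _ ⟨v, rfl⟩
    exact Real.iSup_le (fun _ => hK _) hK0
  · rw [ciSup_pos hu]

end Lev
end LV

/-- integral estimates for first and second differences of the
one-dimensional truncated heat kernels against the truncated Lévy densities,
with `δ = min{δ₀, εα/(8(d+β+2)), ε/(dη₁²)}`. -/
theorem stmt_12 (d : ℕ) (hd : 2 ≤ d)
    (ν ν' μ μ' h hinv ψδ : Fin d → ℝ → ℝ) (g : Fin d → ℝ → ℝ → ℝ)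
    (α β C₁ C₂ η₁ η₄ τ ε δ0 δ : ℝ)
    (hα : 0 < α) (hαβ : α ≤ β) (hβ : β < 2) (hC₁ : 0 < C₁) (hC₂ : 0 < C₂)
    (hη₁ : 1 ≤ η₁) (hη₄ : 0 < η₄) (hτ : 0 < τ) (hε0 : 0 < ε) (hε1 : ε ≤ 1)
    (hδ0 : 0 < δ0) (hδ0' : δ0 ≤ 1 / 24)
    (hδdef : δ = min δ0 (min (ε * α / (8 * (d + β + 2))) (ε / (d * η₁ ^ 2))))
    -- each ν i is the density of a symmetric infinite Lévy measure on ℝ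
    (hνmeas : ∀ i, Measurable (ν i))
    (hνnonneg : ∀ i, ∀ x : ℝ, 0 ≤ ν i x)
    (hνsymm : ∀ i, ∀ x : ℝ, ν i (-x) = ν i x)
    (hνint : ∀ i, Integrable (fun x : ℝ => min (x ^ 2) 1 * ν i x))
    (hνinf : ∀ i, ¬ Integrable (ν i))
    -- regularity of ν i near 0
    (hν'deriv : ∀ i, ∀ x ∈ Set.Ioo (0:ℝ) η₄, HasDerivAt (ν i) (ν' i x) x)
    (hν'neg : ∀ i, ∀ x ∈ Set.Ioo (0:ℝ) η₄, ν' i x < 0)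
    (hν'dec : ∀ i, ∀ x y : ℝ, 0 < x → x < y → y < η₄ → -ν' i y / y ≤ -ν' i x / x)
    -- h i and its inverse
    (hdef : ∀ i, ∀ r : ℝ, 0 < r → h i r = ∫ x : ℝ, min 1 (x ^ 2 / r ^ 2) * ν i x)
    (hcont : ∀ i, ContinuousOn (h i) (Set.Ioi 0))
    (hanti : ∀ i, StrictAntiOn (h i) (Set.Ioi 0))
    (hlim0 : ∀ i, Tendsto (h i) (nhdsWithin 0 (Set.Ioi 0)) atTop)
    (hlimtop : ∀ i, Tendsto (h i) atTop (nhds 0))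
    (hinvpos : ∀ i, ∀ s : ℝ, 0 < s → 0 < hinv i s)
    (hinvr : ∀ i, ∀ s : ℝ, 0 < s → h i (hinv i s) = s)
    (hinvl : ∀ i, ∀ r : ℝ, 0 < r → hinv i (h i r) = r)
    -- scaling conditions
    (hlsc : ∀ i, ∀ θ : ℝ, 0 < θ → ∀ l : ℝ, 1 ≤ l → C₁ * l ^ α * h i (l * θ) ≤ h i θ)
    (husc : ∀ i, ∀ θ : ℝ, 0 < θ → θ ≤ 1 → ∀ l : ℝ, 0 < l → l ≤ 1 →
      h i (l * θ) ≤ C₂ * l ^ (-β) * h i θ)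
    -- μ i = μ_i^{(δ)} is a symmetric truncation of ν i
    (hμmeas : ∀ i, Measurable (μ i))
    (hμeq : ∀ i, ∀ x : ℝ, 0 < x → x ≤ δ → μ i x = ν i x)
    (hμbound : ∀ i, ∀ x : ℝ, 0 < x → 0 ≤ μ i x ∧ μ i x ≤ ν i x)
    (hμzero : ∀ i, ∀ x : ℝ, 2 * δ ≤ x → μ i x = 0)
    (hμsymm : ∀ i, ∀ x : ℝ, μ i (-x) = μ i x)
    (hμ'deriv : ∀ i, ∀ x : ℝ, 0 < x → HasDerivAt (μ i) (μ' i x) x)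
    (hμ'nonpos : ∀ i, ∀ x : ℝ, 0 < x → μ' i x ≤ 0)
    (hμ'dec : ∀ i, ∀ x y : ℝ, 0 < x → x ≤ y → -μ' i y / y ≤ -μ' i x / x)
    -- ψδ i and the heat kernels g_{i,t}^{(δ)}
    (hψδdef : ∀ i, ∀ ξ : ℝ, ψδ i ξ = ∫ x : ℝ, (1 - Real.cos (ξ * x)) * μ i x)
    (hgdef : ∀ i, ∀ t : ℝ, 0 < t → ∀ x : ℝ,
      g i t x = (2 * Real.pi)⁻¹ * ∫ ξ : ℝ, Real.cos (x * ξ) * Real.exp (-t * ψδ i ξ)) :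
    ∃ c : ℝ, 0 < c ∧ ∀ a b : ℝ, ∀ t : ℝ, 0 < t → t ≤ τ → ∀ x y : ℝ, ∀ i j k : Fin d,
      (∫ w : ℝ, |g i t (x + a * w) + g i t (x - a * w) - 2 * g i t x| * μ j w) ≤
        c * (|a| ^ α + |a| ^ 2) / t ^ (β / α) *
          ⨆ u ∈ Set.Icc (-(2 * δ)) (2 * δ), tg (h i) (hinv i) τ ε ((d + β - 1) / α) t (x + a * u) ∧
      (∫ w : ℝ, |g i t (x + a * w) + g i t (x - a * w) - 2 * g i t x| * μ i w) ≤
        c * (|a| ^ α + |a| ^ 2) / t *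
          ⨆ u ∈ Set.Icc (-(2 * δ)) (2 * δ), tg (h i) (hinv i) τ ε ((d + β - 1) / α) t (x + a * u) ∧
      (∫ w : ℝ, |g i t (x + a * w) - g i t x| * |g k t (y + b * w) - g k t y| * μ j w) ≤
        c * ((|a| * |b|) ^ (α / 2) + |a| * |b|) / t ^ (β / α) *
          (⨆ u ∈ Set.Icc (-(2 * δ)) (2 * δ), tg (h i) (hinv i) τ ε ((d + β - 1) / α) t (x + a * u)) *
          (⨆ u ∈ Set.Icc (-(2 * δ)) (2 * δ), tg (h k) (hinv k) τ ε ((d + β - 1) / α) t (y + b * u)) ∧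
      (∫ w : ℝ, |g i t (x + a * w) - g i t x| * |g i t (y + b * w) - g i t y| * μ i w) ≤
        c * ((|a| * |b|) ^ (α / 2) + |a| * |b|) / t *
          (⨆ u ∈ Set.Icc (-(2 * δ)) (2 * δ), tg (h i) (hinv i) τ ε ((d + β - 1) / α) t (x + a * u)) *
          (⨆ u ∈ Set.Icc (-(2 * δ)) (2 * δ), tg (h i) (hinv i) τ ε ((d + β - 1) / α) t (y + b * u)) := by
  classical
  have hβ0 : 0 < β := by linarith
  have hd2 : (2:ℝ) ≤ d := by exact_mod_cast hd
  have hδpos : 0 < δ := by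
    rw [hδdef]
    refine lt_min hδ0 (lt_min (by positivity) ?_)
    have : (0:ℝ) < d := by linarith
    positivity
  have hδ1 : δ ≤ ε * α / (8 * (d + β + 2)) := by
    rw [hδdef]; exact (min_le_right _ _).trans (min_le_left _ _)
  have hδ4 : 4 * δ ≤ 1 := by
    have : δ ≤ δ0 := by rw [hδdef]; exact min_le_left _ _
    linarith
  have hp : (0:ℝ) ≤ (d + β - 1) / α := div_nonneg (by linarith) hα.le
  have hq : (d + β - 1) / α + 1 / α + 2 ≤ ε / (4 * δ) := by
    rw [le_div_iff₀ (by positivity)] at hδ1 ⊢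
    have e : (d + β - 1) / α + 1 / α + 2 = (d + β + 2 * α) / α := by field_simp; ring
    rw [e, div_mul_eq_mul_div, div_le_iff₀ hα]
    nlinarith
  have habs : ∀ (f : ℝ → ℝ), (∀ x, f (-x) = f x) → ∀ x, f |x| = f x := by
    intro f hf x
    rcases abs_choice x with h | h <;> rw [h]
    exact hf x
  have L : ∀ i, LV.Lev (ν i) (μ i) (h i) (hinv i) α C₁ δ := by
    intro i
    refine ⟨hνmeas i, hνnonneg i, hνint i, hdef i, hanti i, hinvpos i, hinvr i, hlsc i, hμmeas i,
      ?_, ?_, ?_, hμsymm i, ?_, hδpos, hα, hC₁⟩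
    · intro x hx hxd
      rw [← habs _ (hμsymm i), ← habs _ (hνsymm i)]
      exact hμeq i _ (abs_pos.2 hx) hxd
    · intro x hx
      rw [← habs _ (hμsymm i), ← habs _ (hνsymm i)]
      exact hμbound i _ (abs_pos.2 hx)
    · intro x hx
      rw [← habs _ (hμsymm i)]
      exact hμzero i _ hx
    · intro x y hx hxy
      have : AntitoneOn (μ i) (Set.Ioi 0) := by
        refine antitoneOn_of_deriv_nonpos (convex_Ioi 0) ?_ ?_ ?_
        · exact fun z hz => (hμ'deriv i z hz).continuousAt.continuousWithinAt
        · intro z hz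
          rw [interior_Ioi] at hz
          exact (hμ'deriv i z hz).differentiableAt.differentiableWithinAt
        · intro z hz
          rw [interior_Ioi] at hz
          rw [(hμ'deriv i z hz).deriv]
          exact hμ'nonpos i z hz
      exact this hx (show (0:ℝ) < y by linarith) hxy
  choose D hD0 hD using fun i => (L i).dif hτ hε0 hδ4 hp hq (hψδdef i) (hgdef i)
  choose r hr0 hr using fun i => (L i).rho_ge hτ
  choose H hH0 hH using fun (i j k : Fin d) => (L j).h_le (c := min (r i) (r k)) hτ hβ0 hC₂
    (lt_min (hr0 i) (hr0 k)) (husc j)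
  obtain ⟨E, hE⟩ : ∃ E : ℝ, E = 1 + 1 / C₁ := ⟨_, rfl⟩
  have hE0 : 0 < E := by rw [hE]; positivity
  set cc : Fin d → Fin d → Fin d → ℝ := fun i j k =>
    D i * E * H i j i + D i * E + D i * D k * E * H i j k + D i * D i * E with hcc
  have hcc0 : ∀ i j k, 0 ≤ cc i j k := by
    intro i j k
    have := hD0 i; have := hD0 k; have := hH0 i j i; have := hH0 i j k
    simp only [hcc]; positivity
  have hccle : ∀ i j k, cc i j k ≤ 1 + ∑ i, ∑ j, ∑ k, cc i j k := by
    intro i j k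
    have h1 := Finset.single_le_sum (f := fun k => cc i j k) (fun k _ => hcc0 i j k) (Finset.mem_univ k)
    have h2 := Finset.single_le_sum (f := fun j => ∑ k, cc i j k)
      (fun j _ => Finset.sum_nonneg fun k _ => hcc0 i j k) (Finset.mem_univ j)
    have h3 := Finset.single_le_sum (f := fun i => ∑ j, ∑ k, cc i j k)
      (fun i _ => Finset.sum_nonneg fun j _ => Finset.sum_nonneg fun k _ => hcc0 i j k) (Finset.mem_univ i)
    beta_reduce at h1 h2 h3
    linarith
  refine ⟨1 + ∑ i, ∑ j, ∑ k, cc i j k, ?_, ?_⟩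
  · have : 0 ≤ ∑ i, ∑ j, ∑ k, cc i j k :=
      Finset.sum_nonneg fun i _ => Finset.sum_nonneg fun j _ => Finset.sum_nonneg fun k _ => hcc0 i j k
    linarith
  intro a b t ht htτ x y i j k
  have hDi := hD0 i
  have hDk := hD0 k
  have hHi := hH0 i j i
  have hHk := hH0 i j k
  have hle := hccle i j k
  set cT := 1 + ∑ i, ∑ j, ∑ k, cc i j k
  have n1 : 0 < D i * E * H i j i := by positivity
  have n2 : 0 < D i * E := by positivity
  have n3 : 0 < D i * D k * E * H i j k := by positivity
  have n4 : 0 < D i * D i * E := by positivity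
  have c1 : D i * E * H i j i ≤ cT := by simp only [hcc] at hle; linarith
  have c2 : D i * E ≤ cT := by simp only [hcc] at hle; linarith
  have c3 : D i * D k * E * H i j k ≤ cT := by simp only [hcc] at hle; linarith
  have c4 : D i * D i * E ≤ cT := by simp only [hcc] at hle; linarith
  have hρi := hinvpos i (1 / t) (by positivity)
  have hρk := hinvpos k (1 / t) (by positivity)
  have hhi := hinvr i (1 / t) (by positivity)
  have sX : ∀ (i : Fin d) (x a : ℝ), ∀ u ∈ Set.Icc (-(2 * δ)) (2 * δ),
      tg (h i) (hinv i) τ ε ((d + β - 1) / α) t (x + a * u) ≤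
      ⨆ u ∈ Set.Icc (-(2 * δ)) (2 * δ), tg (h i) (hinv i) τ ε ((d + β - 1) / α) t (x + a * u) :=
    fun i x a => (L i).le_sup hτ hε0 ht x a
  have s0 : ∀ (i : Fin d) (x a : ℝ), 0 ≤
      ⨆ u ∈ Set.Icc (-(2 * δ)) (2 * δ), tg (h i) (hinv i) τ ε ((d + β - 1) / α) t (x + a * u) :=
    fun i x a => ((L i).tg_nonneg hτ hε0 ht _).trans (sX i x a 0 ⟨by linarith, by linarith⟩)
  have Hi : h j (hinv i (1 / t)) ≤ H i j i / t ^ (β / α) := by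
    apply hH i j i t ht htτ
    rw [min_self]; exact hr i t ht htτ
  have Hk : h j (√(hinv i (1 / t) * hinv k (1 / t))) ≤ H i j k / t ^ (β / α) := by
    apply hH i j k t ht htτ
    apply Real.le_sqrt_of_sq_le
    have tp : 0 < t ^ (1 / α) := by positivity
    have m0 : 0 < min (r i) (r k) := lt_min (hr0 i) (hr0 k)
    have a1 : min (r i) (r k) * t ^ (1 / α) ≤ hinv i (1 / t) :=
      (mul_le_mul_of_nonneg_right (min_le_left _ _) tp.le).trans (hr i t ht htτ)
    have a2 : min (r i) (r k) * t ^ (1 / α) ≤ hinv k (1 / t) :=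
      (mul_le_mul_of_nonneg_right (min_le_right _ _) tp.le).trans (hr k t ht htτ)
    rw [sq]
    exact mul_le_mul a1 a2 (by positivity) hρi.le
  have Sx := s0 i x a
  have Sy := s0 k y b
  have Sy' := s0 i y b
  have dx := fun w hw => hD i t ht htτ a x _ (sX i x a) w hw
  have dy := fun w hw => hD k t ht htτ b y _ (sX k y b) w hw
  have dy' := fun w hw => hD i t ht htτ b y _ (sX i y b) w hw
  set X := ⨆ u ∈ Set.Icc (-(2 * δ)) (2 * δ), tg (h i) (hinv i) τ ε ((d + β - 1) / α) t (x + a * u)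
  set Y := ⨆ u ∈ Set.Icc (-(2 * δ)) (2 * δ), tg (h k) (hinv k) τ ε ((d + β - 1) / α) t (y + b * u)
  set Y' := ⨆ u ∈ Set.Icc (-(2 * δ)) (2 * δ), tg (h i) (hinv i) τ ε ((d + β - 1) / α) t (y + b * u)
  have hA : 0 ≤ |a| ^ α + |a| ^ 2 := by positivity
  have hB : 0 ≤ (|a| * |b|) ^ (α / 2) + |a| * |b| := by positivity
  set A := |a| ^ α + |a| ^ 2
  set B := (|a| * |b|) ^ (α / 2) + |a| * |b|
  have htb : 0 < t ^ (β / α) := by positivity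
  refine ⟨?_, ?_, ?_, ?_⟩
  · refine ((L j).I1 hρi (K := D i * X) (a := a) (by positivity) (fun w => abs_nonneg _)
      (fun w hw => (dx w hw).2)).trans ?_
    rw [← hE]
    calc D i * X * (E * A * h j (hinv i (1 / t))) ≤ D i * X * (E * A * (H i j i / t ^ (β / α))) := by gcongr
      _ = (D i * E * H i j i) * A / t ^ (β / α) * X := by ring
      _ ≤ cT * A / t ^ (β / α) * X := by gcongr
  · refine ((L i).I1 hρi (K := D i * X) (a := a) (by positivity) (fun w => abs_nonneg _)
      (fun w hw => (dx w hw).2)).trans ?_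
    rw [← hE, hhi]
    calc D i * X * (E * A * (1 / t)) = (D i * E) * A / t * X := by ring
      _ ≤ cT * A / t * X := by gcongr
  · refine ((L j).I3 hρi hρk (K := D i * X * (D k * Y)) (a := a) (b := b) (by positivity)
      (fun w => by positivity) (fun w hw => ?_)).trans ?_
    · calc _ ≤ (D i * X * min 1 (|a * w| / hinv i (1 / t))) * (D k * Y * min 1 (|b * w| / hinv k (1 / t))) := by
            gcongr
            · exact (dx w hw).1
            · exact (dy w hw).1
        _ = _ := by ring
    · rw [← hE]
      calc D i * X * (D k * Y) * (E * B * h j (√(hinv i (1 / t) * hinv k (1 / t))))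
          ≤ D i * X * (D k * Y) * (E * B * (H i j k / t ^ (β / α))) := by gcongr
        _ = (D i * D k * E * H i j k) * B / t ^ (β / α) * X * Y := by ring
        _ ≤ cT * B / t ^ (β / α) * X * Y := by gcongr
  · refine ((L i).I3 hρi hρi (K := D i * X * (D i * Y')) (a := a) (b := b) (by positivity)
      (fun w => by positivity) (fun w hw => ?_)).trans ?_
    · calc _ ≤ (D i * X * min 1 (|a * w| / hinv i (1 / t))) * (D i * Y' * min 1 (|b * w| / hinv i (1 / t))) := by
            gcongr
            · exact (dx w hw).1
            · exact (dy' w hw).1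
        _ = _ := by ring
    · rw [← hE, Real.sqrt_mul_self hρi.le, hhi]
      calc D i * X * (D i * Y') * (E * B * (1 / t)) = (D i * D i * E) * B / t * X * Y' := by ring
        _ ≤ cT * B / t * X * Y' := by gcongr
end

section
/- There is a constant c such that for every a∈ℝ, every 0<t≤τ and all i,j,k∈{1,…,d}: (1) ∫_ℝ ((|a|+|w|)²|w|²/(h_i^{−1}(1/t))² ∧ 1) μ_i^{(δ)}(w)dw ≤ c·(t^{α/(2β)}+|a|^α+|a|²)/t; (2) ∫_ℝ ((|a|+|w|)|w|²/(h_i^{−1}(1/t))² ∧ 1) μ_i^{(δ)}(w)dw ≤ c·(t^{α/(3β)}+|a|^{α/2}+|a|)/t; (3) ∫_ℝ ((|a|+|w|)²|w|²/(h_i^{−1}(1/t)h_j^{−1}(1/t)) ∧ 1) μ_k^{(δ)}(w)dw ≤ c·(|a|^β t^{−β/α} + t^{−β/(2α)}); (4) ∫_ℝ ((|a|+|w|)|w|²/(h_i^{−1}(1/t))² ∧ 1) μ_k^{(δ)}(w)dw ≤ c·(|a|^{β/2} t^{−β/α} + t^{−2β/(3α)}). -/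
open Filter MeasureTheory

lemma aux_ptA (A w R : ℝ) (hA : 0 ≤ A) (hR : 0 < R) :
    min ((A + |w|) ^ 2 * w ^ 2 / R ^ 2) 1 ≤
      2 * min 1 (A ^ 2 / R ^ 2 * w ^ 2) + 2 * min 1 (R / R ^ 2 * w ^ 2) := by
  have h1 : (A + |w|) ^ 2 * w ^ 2 / R ^ 2 ≤
      2 * (A ^ 2 / R ^ 2 * w ^ 2) + 2 * (R / R ^ 2 * w ^ 2) ^ 2 := by
    have e : 2 * (A ^ 2 / R ^ 2 * w ^ 2) + 2 * (R / R ^ 2 * w ^ 2) ^ 2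
        = (2 * (A ^ 2 + |w| ^ 2)) * w ^ 2 / R ^ 2 := by
      rw [sq_abs]; field_simp
    rw [e]
    gcongr
    nlinarith [sq_nonneg (A - |w|)]
  have hx : 0 ≤ A ^ 2 / R ^ 2 * w ^ 2 := by positivity
  have hy : 0 ≤ R / R ^ 2 * w ^ 2 := by positivity
  generalize A ^ 2 / R ^ 2 * w ^ 2 = x at *
  generalize R / R ^ 2 * w ^ 2 = y at *
  generalize (A + |w|) ^ 2 * w ^ 2 / R ^ 2 = z at *
  rcases le_total 1 x with h | h
  · rw [min_eq_left h]
    have : 0 ≤ min 1 y := le_min zero_le_one hy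
    linarith [min_le_right z 1]
  rcases le_total 1 y with h' | h'
  · rw [min_eq_left h']
    have : 0 ≤ min 1 x := le_min zero_le_one hx
    linarith [min_le_right z 1]
  rw [min_eq_right h, min_eq_right h']
  have := min_le_left z 1
  nlinarith

lemma aux_ptB (A w R : ℝ) (hA : 0 ≤ A) (hR : 0 < R) :
    min ((A + |w|) * w ^ 2 / R ^ 2) 1 ≤
      min 1 (A / R ^ 2 * w ^ 2) + min 1 (R ^ (2 / 3 : ℝ) / R ^ 2 * w ^ 2) := by
  have hy0 : 0 < R ^ (2 / 3 : ℝ) := by positivity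
  have hy3 : R ^ 2 = (R ^ (2 / 3 : ℝ)) ^ 3 := by
    rw [← Real.rpow_natCast (R ^ (2 / 3 : ℝ)), ← Real.rpow_mul hR.le]; norm_num
  set y := R ^ (2 / 3 : ℝ) with hy
  rw [hy3]
  have hx : 0 ≤ A / y ^ 3 * w ^ 2 := by positivity
  have e : y / y ^ 3 * w ^ 2 = (|w| / y) ^ 2 := by
    rw [div_pow, sq_abs]; field_simp
  have e2 : (A + |w|) * w ^ 2 / y ^ 3 = A / y ^ 3 * w ^ 2 + (|w| / y) ^ 3 := by
    have : w ^ 2 = |w| ^ 2 := (sq_abs w).symm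
    rw [this]; field_simp
  rw [e, e2]
  have hz : 0 ≤ |w| / y := by positivity
  generalize A / y ^ 3 * w ^ 2 = x at *
  generalize |w| / y = z at *
  rcases le_total 1 x with h | h
  · rw [min_eq_left h]
    have : 0 ≤ min 1 (z ^ 2) := le_min zero_le_one (by positivity)
    linarith [min_le_right (x + z ^ 3) 1]
  rcases le_total 1 z with h' | h'
  · rw [min_eq_left (one_le_pow₀ h' : 1 ≤ z ^ 2)]
    have : 0 ≤ min 1 x := le_min zero_le_one hx
    linarith [min_le_right (x + z ^ 3) 1]
  rw [min_eq_right h, min_eq_right (pow_le_one₀ hz h')]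
  have := min_le_left (x + z ^ 3) 1
  have : z ^ 3 ≤ z ^ 2 := pow_le_pow_of_le_one hz h' (by norm_num)
  linarith

lemma aux_A (μ m : ℝ → ℝ) (A R : ℝ) (hA : 0 ≤ A) (hR : 0 < R)
    (h0 : ∀ᵐ w, 0 ≤ μ w) (h1 : ∀ᵐ w, μ w ≤ m w)
    (hi : ∀ s : ℝ, 0 ≤ s → Integrable (fun w : ℝ => min 1 (s * w ^ 2) * m w)) :
    (∫ w : ℝ, min ((A + |w|) ^ 2 * w ^ 2 / R ^ 2) 1 * μ w) ≤
      2 * (∫ w : ℝ, min 1 (A ^ 2 / R ^ 2 * w ^ 2) * m w) +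
      2 * (∫ w : ℝ, min 1 (R / R ^ 2 * w ^ 2) * m w) := by
  have i1 := (hi (A ^ 2 / R ^ 2) (by positivity)).const_mul 2
  have i2 := (hi (R / R ^ 2) (by positivity)).const_mul 2
  rw [← integral_const_mul, ← integral_const_mul, ← integral_add i1 i2]
  apply integral_mono_of_nonneg
  · filter_upwards [h0] with w hw
    have : 0 ≤ min ((A + |w|) ^ 2 * w ^ 2 / R ^ 2) 1 := le_min (by positivity) zero_le_one
    exact mul_nonneg this hw
  · exact i1.add i2
  · filter_upwards [h0, h1] with w hw hw1
    have := aux_ptA A w R hA hR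
    have hp : 0 ≤ min ((A + |w|) ^ 2 * w ^ 2 / R ^ 2) 1 := le_min (by positivity) zero_le_one
    calc _ ≤ min ((A + |w|) ^ 2 * w ^ 2 / R ^ 2) 1 * m w := mul_le_mul_of_nonneg_left hw1 hp
      _ ≤ (2 * min 1 (A ^ 2 / R ^ 2 * w ^ 2) + 2 * min 1 (R / R ^ 2 * w ^ 2)) * m w :=
        mul_le_mul_of_nonneg_right this (hw.trans hw1)
      _ = _ := by ring

lemma aux_B (μ m : ℝ → ℝ) (A R : ℝ) (hA : 0 ≤ A) (hR : 0 < R)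
    (h0 : ∀ᵐ w, 0 ≤ μ w) (h1 : ∀ᵐ w, μ w ≤ m w)
    (hi : ∀ s : ℝ, 0 ≤ s → Integrable (fun w : ℝ => min 1 (s * w ^ 2) * m w)) :
    (∫ w : ℝ, min ((A + |w|) * w ^ 2 / R ^ 2) 1 * μ w) ≤
      (∫ w : ℝ, min 1 (A / R ^ 2 * w ^ 2) * m w) +
      (∫ w : ℝ, min 1 (R ^ (2 / 3 : ℝ) / R ^ 2 * w ^ 2) * m w) := by
  have i1 := (hi (A / R ^ 2) (by positivity))
  have i2 := (hi (R ^ (2 / 3 : ℝ) / R ^ 2) (by positivity))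
  rw [← integral_add i1 i2]
  apply integral_mono_of_nonneg
  · filter_upwards [h0] with w hw
    have : 0 ≤ min ((A + |w|) * w ^ 2 / R ^ 2) 1 := le_min (by positivity) zero_le_one
    exact mul_nonneg this hw
  · exact i1.add i2
  · filter_upwards [h0, h1] with w hw hw1
    have := aux_ptB A w R hA hR
    have hp : 0 ≤ min ((A + |w|) * w ^ 2 / R ^ 2) 1 := le_min (by positivity) zero_le_one
    calc _ ≤ min ((A + |w|) * w ^ 2 / R ^ 2) 1 * m w := mul_le_mul_of_nonneg_left hw1 hp
      _ ≤ (min 1 (A / R ^ 2 * w ^ 2) + min 1 (R ^ (2 / 3 : ℝ) / R ^ 2 * w ^ 2)) * m w :=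
        mul_le_mul_of_nonneg_right this (hw.trans hw1)
      _ = _ := by ring

/-- integrability of the stable profile -/
lemma aux_stable_int (β : ℝ) (h0 : 0 < β) (h2 : β < 2) :
    Integrable (fun w : ℝ => min 1 (w ^ 2) * |w| ^ (-1 - β)) := by
  have hm : Measurable (fun w : ℝ => min 1 (w ^ 2) * w ^ (-1 - β)) := by fun_prop
  have hI : IntegrableOn (fun w : ℝ => min 1 (w ^ 2) * w ^ (-1 - β)) (Set.Ioi 0) := by
    rw [← Set.Ioc_union_Ioi_eq_Ioi (zero_le_one : (0:ℝ) ≤ 1)]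
    apply IntegrableOn.union
    · have := (intervalIntegral.intervalIntegrable_rpow' (a := 0) (b := 1) (r := 1 - β)
        (by linarith))
      rw [intervalIntegrable_iff_integrableOn_Ioc_of_le zero_le_one] at this
      refine this.mono' hm.aestronglyMeasurable ?_
      filter_upwards [ae_restrict_mem measurableSet_Ioc] with w hw
      have hw0 : 0 < w := hw.1
      rw [Real.norm_of_nonneg (by positivity)]
      calc _ ≤ w ^ 2 * w ^ (-1 - β) := by gcongr; exact min_le_right _ _
        _ = w ^ (1 - β) := by
          rw [← Real.rpow_natCast, ← Real.rpow_add hw0]; congr 1; push_cast; ring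
    · have := (integrableOn_Ioi_rpow_of_lt (a := -1 - β) (by linarith) (zero_lt_one : (0:ℝ) < 1))
      refine this.mono' hm.aestronglyMeasurable ?_
      filter_upwards [ae_restrict_mem measurableSet_Ioi] with w hw
      have hw0 : 0 < w := lt_trans zero_lt_one hw
      rw [Real.norm_of_nonneg (by positivity)]
      calc _ ≤ 1 * w ^ (-1 - β) := by gcongr; exact min_le_left _ _
        _ = _ := one_mul _
  have hP : IntegrableOn (fun w : ℝ => min 1 (w ^ 2) * |w| ^ (-1 - β)) (Set.Ioi 0) :=
    hI.congr_fun (fun w hw => by simp only [abs_of_pos (Set.mem_Ioi.1 hw)]) measurableSet_Ioi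
  have hN : IntegrableOn (fun w : ℝ => min 1 (w ^ 2) * |w| ^ (-1 - β)) (Set.Iic 0) := by
    rw [integrableOn_Iic_iff_integrableOn_Iio]
    have := hP.comp_neg
    simpa using this
  rw [← integrableOn_univ, ← Set.Iic_union_Ioi (a := (0:ℝ))]
  exact hN.union hP

lemma aux_stable (β : ℝ) (h0 : 0 < β) (h2 : β < 2) (s : ℝ) (hs : 0 ≤ s) :
    Integrable (fun w : ℝ => min 1 (s * w ^ 2) * |w| ^ (-1 - β)) ∧
    (∫ w : ℝ, min 1 (s * w ^ 2) * |w| ^ (-1 - β)) =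
      s ^ (β / 2) * ∫ w : ℝ, min 1 (w ^ 2) * |w| ^ (-1 - β) := by
  rcases hs.eq_or_lt with rfl | hs
  · simp [Real.zero_rpow (by positivity : β / 2 ≠ 0)]
  have hb : 0 < √s := Real.sqrt_pos.2 hs
  have hg := aux_stable_int β h0 h2
  have e : ∀ w : ℝ, min 1 (s * w ^ 2) * |w| ^ (-1 - β) =
      (√s) ^ (1 + β) * (min 1 ((√s * w) ^ 2) * |√s * w| ^ (-1 - β)) := by
    intro w
    rw [mul_pow, Real.sq_sqrt hs.le, abs_mul, abs_of_pos hb, Real.mul_rpow hb.le (abs_nonneg w)]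
    have : (√s) ^ (1 + β) * (√s) ^ (-1 - β) = 1 := by
      rw [← Real.rpow_add hb]; simp
    linear_combination (-(min 1 (s * w ^ 2) * |w| ^ (-1 - β))) * this
  simp_rw [e]
  constructor
  · exact (hg.comp_mul_left' hb.ne').const_mul _
  · rw [integral_const_mul, Measure.integral_comp_mul_left
      (fun w : ℝ => min 1 (w ^ 2) * |w| ^ (-1 - β)), abs_of_pos (by positivity), smul_eq_mul,
      ← mul_assoc]
    congr 1
    rw [Real.sqrt_eq_rpow, ← Real.rpow_neg_one, ← Real.rpow_mul hs.le, ← Real.rpow_mul hs.le,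
      ← Real.rpow_add hs]
    congr 1; ring

lemma aux_ae (P : ℝ → Prop) (hp : ∀ x, 0 < x → P x) (hn : ∀ x, 0 < x → P (-x)) :
    ∀ᵐ w : ℝ, P w := by
  have : ∀ᵐ w : ℝ, w ≠ 0 := by simp [ae_iff]
  filter_upwards [this] with w hw
  rcases lt_or_gt_of_ne hw with h | h
  · simpa using hn (-w) (by linarith)
  · exact hp w h

lemma aux_int (ν : ℝ → ℝ) (hm : Measurable ν) (h0 : ∀ x, 0 ≤ ν x)
    (hi : Integrable (fun x : ℝ => min (x ^ 2) 1 * ν x)) (s : ℝ) (hs : 0 ≤ s) :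
    Integrable (fun w : ℝ => min 1 (s * w ^ 2) * ν w) := by
  refine (hi.const_mul (max 1 s)).mono' (by fun_prop) ?_
  filter_upwards with w
  have := h0 w
  rw [Real.norm_of_nonneg (by positivity), ← mul_assoc]
  gcongr
  rcases le_total (w ^ 2) 1 with h | h
  · rw [min_eq_left h]
    exact (min_le_right _ _).trans (by gcongr; exact le_max_right _ _)
  · rw [min_eq_right h, mul_one]
    exact (min_le_left _ _).trans (le_max_left _ _)

/-- key bound on the scaled integral -/
lemma aux_K (ν h : ℝ → ℝ) (α C₁ R t u : ℝ) (hα : 0 < α) (hC₁ : 0 < C₁) (hR : 0 < R)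
    (ht : 0 < t) (hu : 0 ≤ u)
    (h0 : ∀ x, 0 ≤ ν x)
    (hi : ∀ s : ℝ, 0 ≤ s → Integrable (fun w : ℝ => min 1 (s * w ^ 2) * ν w))
    (hdef : ∀ r : ℝ, 0 < r → h r = ∫ x : ℝ, min 1 (x ^ 2 / r ^ 2) * ν x)
    (hlsc : ∀ θ : ℝ, 0 < θ → ∀ l : ℝ, 1 ≤ l → C₁ * l ^ α * h (l * θ) ≤ h θ)
    (hr : h R = 1 / t) :
    (∫ w : ℝ, min 1 (u / R ^ 2 * w ^ 2) * ν w) ≤ (1 + 1 / C₁) * ((u ^ (α / 2) + u) / t) := by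
  have hua : 0 ≤ u ^ (α / 2) := by positivity
  rcases hu.eq_or_lt with rfl | hu0
  · simp; positivity
  rcases le_total 1 u with h1 | h1
  · have e : (∫ w : ℝ, min 1 (u / R ^ 2 * w ^ 2) * ν w) ≤ u * (1 / t) := by
      rw [← hr, hdef R hR, ← integral_const_mul]
      apply integral_mono (hi _ (by positivity))
      · have := (hi (1 / R ^ 2) (by positivity)).const_mul u
        refine this.congr (ae_of_all _ fun w => ?_)
        simp only []
        congr 3; ring
      · intro w
        simp only []
        rw [← mul_assoc]
        apply mul_le_mul_of_nonneg_right _ (h0 w)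
        rw [mul_min_of_nonneg _ _ hu]
        apply min_le_min (by linarith)
        apply le_of_eq; ring
    refine e.trans ?_
    have : 0 ≤ 1 / C₁ * ((u ^ (α / 2) + u) / t) := by positivity
    have : 0 ≤ u ^ (α / 2) / t := by positivity
    have e3 : (u ^ (α / 2) + u) / t = u ^ (α / 2) / t + u * (1 / t) := by ring
    nlinarith
  · have hs : 0 < u ^ (-(1 / 2) : ℝ) := by positivity
    have hl : 1 ≤ u ^ (-(1 / 2) : ℝ) := Real.one_le_rpow_of_pos_of_le_one_of_nonpos hu0 h1 (by norm_num)
    have := hlsc R hR _ hl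
    have e : (∫ w : ℝ, min 1 (u / R ^ 2 * w ^ 2) * ν w) = h (u ^ (-(1 / 2) : ℝ) * R) := by
      rw [hdef _ (by positivity)]
      congr 1; ext w; congr 2
      rw [mul_pow, ← Real.rpow_natCast (u ^ (-(1 / 2) : ℝ)), ← Real.rpow_mul hu]
      norm_num
      rw [Real.rpow_neg_one]
      field_simp
    rw [e]
    have e2 : (u ^ (-(1 / 2) : ℝ)) ^ α = (u ^ (α / 2))⁻¹ := by
      rw [← Real.rpow_mul hu, ← Real.rpow_neg hu]; congr 1; ring
    rw [hr, e2] at this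
    have hp : 0 < u ^ (α / 2) := by positivity
    have e4 : h (u ^ (-(1 / 2) : ℝ) * R) ≤ 1 / C₁ * (u ^ (α / 2) / t) := by
      have e5 : h (u ^ (-(1 / 2) : ℝ) * R) = (1 / C₁ * u ^ (α / 2)) * (C₁ * (u ^ (α / 2))⁻¹ * h (u ^ (-(1 / 2) : ℝ) * R)) := by
        field_simp
      rw [e5]
      calc _ ≤ (1 / C₁ * u ^ (α / 2)) * (1 / t) := by gcongr
        _ = _ := by ring
    refine e4.trans ?_
    have : 0 ≤ 1 / C₁ * (u / t) := by positivity
    have : 0 ≤ (u ^ (α / 2) + u) / t := by positivity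
    have e3 : (1 + 1 / C₁) * ((u ^ (α / 2) + u) / t) = 1 / C₁ * (u ^ (α / 2) / t)
      + 1 / C₁ * (u / t) + (u ^ (α / 2) + u) / t := by ring
    linarith

/-- two-sided bounds on the inverse -/
lemma aux_R (h hinv : ℝ → ℝ) (α β C₁ C₂ τ : ℝ) (hα : 0 < α) (hβ : 0 < β)
    (hC₁ : 0 < C₁) (hC₂ : 0 < C₂) (hτ : 0 < τ)
    (hanti : StrictAntiOn h (Set.Ioi 0))
    (hinvpos : ∀ s : ℝ, 0 < s → 0 < hinv s)
    (hinvr : ∀ s : ℝ, 0 < s → h (hinv s) = s)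
    (hpos : 0 < h 1)
    (hlsc : ∀ θ : ℝ, 0 < θ → ∀ l : ℝ, 1 ≤ l → C₁ * l ^ α * h (l * θ) ≤ h θ)
    (husc : ∀ θ : ℝ, 0 < θ → θ ≤ 1 → ∀ l : ℝ, 0 < l → l ≤ 1 →
      h (l * θ) ≤ C₂ * l ^ (-β) * h θ) :
    ∃ m M B : ℝ, 0 < m ∧ 0 < M ∧ 0 < B ∧ ∀ t : ℝ, 0 < t → t ≤ τ →
      m * t ≤ hinv (1 / t) ^ α ∧ hinv (1 / t) ^ β ≤ M * t ∧ hinv (1 / t) ≤ B := by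
  have hB := hinvpos (1 / τ) (by positivity)
  refine ⟨min (C₁ * h 1) (1 / τ), max (C₂ * h 1) (hinv (1 / τ) ^ β * h 1), hinv (1 / τ),
    by positivity, by positivity, hB, fun t ht htτ => ?_⟩
  have hR := hinvpos (1 / t) (by positivity)
  have hr := hinvr (1 / t) (by positivity)
  have hrB := hinvr (1 / τ) (by positivity)
  set R := hinv (1 / t)
  set B := hinv (1 / τ)
  have hRB : R ≤ B := by
    by_contra! hc
    have := hanti hB hR hc
    rw [hr, hrB] at this
    have := one_div_le_one_div_of_le ht htτ
    linarith
  rcases le_total R 1 with h1 | h1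
  · refine ⟨?_, ?_, hRB⟩
    · have := hlsc R hR (1 / R) (by rw [le_div_iff₀ hR]; linarith)
      rw [one_div_mul_cancel hR.ne', hr, one_div, Real.inv_rpow hR.le] at this
      have hp : 0 < R ^ α := by positivity
      calc _ ≤ (C₁ * h 1) * t := by gcongr; exact min_le_left _ _
        _ = (C₁ * (R ^ α)⁻¹ * h 1) * (R ^ α * t) := by field_simp
        _ ≤ (1 / t) * (R ^ α * t) := by gcongr
        _ = _ := by field_simp
    · have := husc 1 one_pos le_rfl R hR h1
      rw [mul_one, hr, Real.rpow_neg hR.le] at this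
      have hp : 0 < R ^ β := by positivity
      calc R ^ β = (1 / t) * (R ^ β * t) := by field_simp
        _ ≤ (C₂ * (R ^ β)⁻¹ * h 1) * (R ^ β * t) := by gcongr
        _ = (C₂ * h 1) * t := by field_simp
        _ ≤ _ := by gcongr; exact le_max_left _ _
  · refine ⟨?_, ?_, hRB⟩
    · calc _ ≤ (1 / τ) * t := by gcongr; exact min_le_right _ _
        _ ≤ 1 := by rw [one_div_mul_eq_div]; exact (div_le_one hτ).2 htτ
        _ ≤ _ := Real.one_le_rpow h1 hα.le
    · have : 1 / t ≤ h 1 := by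
        rw [← hr]; exact hanti.antitoneOn (Set.mem_Ioi.2 one_pos) hR h1
      calc R ^ β ≤ B ^ β := by gcongr
        _ = B ^ β * (1 / t) * t := by field_simp
        _ ≤ B ^ β * h 1 * t := by gcongr
        _ ≤ _ := by gcongr; exact le_max_right _ _

lemma aux_up (α β M B R t e : ℝ) (hα : 0 < α) (hα2 : α < 2) (hβ : 0 < β) (hM : 0 < M)
    (hR : 0 < R) (ht : 0 < t) (he : 0 < e) (h1 : R ^ β ≤ M * t) (h2 : R ≤ B) :
    (R ^ e) ^ (α / 2) + R ^ e ≤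
      ((1 + B ^ (e * (1 - α / 2))) * M ^ (e * α / (2 * β))) * t ^ (e * α / (2 * β)) := by
  have hB : 0 < B := hR.trans_le h2
  have e1 : (R ^ e) ^ (α / 2) = (R ^ β) ^ (e * α / (2 * β)) := by
    rw [← Real.rpow_mul hR.le, ← Real.rpow_mul hR.le]; congr 1; field_simp
  have e2 : R ^ e = (R ^ e) ^ (α / 2) * R ^ (e * (1 - α / 2)) := by
    rw [← Real.rpow_mul hR.le, ← Real.rpow_add hR]; congr 1; ring
  have e3 : (R ^ β) ^ (e * α / (2 * β)) ≤ M ^ (e * α / (2 * β)) * t ^ (e * α / (2 * β)) := by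
    rw [← Real.mul_rpow hM.le ht.le]; gcongr
  have e4 : R ^ (e * (1 - α / 2)) ≤ B ^ (e * (1 - α / 2)) := by
    apply Real.rpow_le_rpow hR.le h2
    apply mul_nonneg he.le; linarith
  have e5 : (R ^ e) ^ (α / 2) ≤ M ^ (e * α / (2 * β)) * t ^ (e * α / (2 * β)) := e1 ▸ e3
  calc (R ^ e) ^ (α / 2) + R ^ e = (R ^ e) ^ (α / 2) * (1 + R ^ (e * (1 - α / 2))) := by
        linear_combination e2
    _ ≤ (M ^ (e * α / (2 * β)) * t ^ (e * α / (2 * β))) * (1 + B ^ (e * (1 - α / 2))) := by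
        gcongr
    _ = _ := by ring

lemma aux_low (α m R t γ : ℝ) (hα : 0 < α) (hm : 0 < m) (hR : 0 < R) (ht : 0 < t) (hγ : 0 < γ)
    (h1 : m * t ≤ R ^ α) : R ^ (-γ) ≤ m ^ (-(γ / α)) * t ^ (-(γ / α)) := by
  have e1 : R ^ (-γ) = (R ^ α) ^ (-(γ / α)) := by
    rw [← Real.rpow_mul hR.le]; congr 1; field_simp
  rw [e1, ← Real.mul_rpow hm.le ht.le]
  exact Real.rpow_le_rpow_of_nonpos (by positivity) h1 (by simp; positivity)

set_option maxHeartbeats 2000000 in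
/-- integral estimates for the truncated Lévy densities `μ_i^{(δ)}`
against the profiles `((|a|+|w|)^k |w|² / …) ∧ 1`. -/
theorem stmt_13 (d : ℕ) (hd : 1 ≤ d)
    (ν μ h hinv : Fin d → ℝ → ℝ)
    (α β C₀ C₁ C₂ τ δ0 δ : ℝ)
    (hα : 0 < α) (hαβ : α ≤ β) (hβ : β < 2)
    (hC₀ : 0 < C₀) (hC₁ : 0 < C₁) (hC₂ : 0 < C₂) (hτ : 0 < τ)
    (hδ0 : 0 < δ0) (hδ0' : δ0 ≤ 1 / 24) (hδpos : 0 < δ) (hδδ0 : δ ≤ δ0)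
    -- each ν i is the density of a symmetric infinite Lévy measure on ℝ
    (hνmeas : ∀ i, Measurable (ν i))
    (hνnonneg : ∀ i, ∀ x : ℝ, 0 ≤ ν i x)
    (hνsymm : ∀ i, ∀ x : ℝ, ν i (-x) = ν i x)
    (hνint : ∀ i, Integrable (fun x : ℝ => min (x ^ 2) 1 * ν i x))
    (hνinf : ∀ i, ¬ Integrable (ν i))
    -- pointwise bound on ν i (consequence of the scaling conditions)
    (hνbound : ∀ i, ∀ x : ℝ, 0 < x →
      ν i x ≤ C₀ * (x ^ (-1 - α) + x ^ (-1 - β)))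
    -- h i and its inverse
    (hdef : ∀ i, ∀ r : ℝ, 0 < r → h i r = ∫ x : ℝ, min 1 (x ^ 2 / r ^ 2) * ν i x)
    (hcont : ∀ i, ContinuousOn (h i) (Set.Ioi 0))
    (hanti : ∀ i, StrictAntiOn (h i) (Set.Ioi 0))
    (hlim0 : ∀ i, Tendsto (h i) (nhdsWithin 0 (Set.Ioi 0)) atTop)
    (hlimtop : ∀ i, Tendsto (h i) atTop (nhds 0))
    (hinvpos : ∀ i, ∀ s : ℝ, 0 < s → 0 < hinv i s)
    (hinvr : ∀ i, ∀ s : ℝ, 0 < s → h i (hinv i s) = s)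
    (hinvl : ∀ i, ∀ r : ℝ, 0 < r → hinv i (h i r) = r)
    -- scaling conditions
    (hlsc : ∀ i, ∀ θ : ℝ, 0 < θ → ∀ l : ℝ, 1 ≤ l → C₁ * l ^ α * h i (l * θ) ≤ h i θ)
    (husc : ∀ i, ∀ θ : ℝ, 0 < θ → θ ≤ 1 → ∀ l : ℝ, 0 < l → l ≤ 1 →
      h i (l * θ) ≤ C₂ * l ^ (-β) * h i θ)
    -- μ i = μ_i^{(δ)} is a symmetric truncation of ν i
    (hμmeas : ∀ i, Measurable (μ i))
    (hμeq : ∀ i, ∀ x : ℝ, 0 < x → x ≤ δ → μ i x = ν i x)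
    (hμbound : ∀ i, ∀ x : ℝ, 0 < x → 0 ≤ μ i x ∧ μ i x ≤ ν i x)
    (hμzero : ∀ i, ∀ x : ℝ, 2 * δ ≤ x → μ i x = 0)
    (hμsymm : ∀ i, ∀ x : ℝ, μ i (-x) = μ i x) :
    ∃ c : ℝ, 0 < c ∧ ∀ a : ℝ, ∀ t : ℝ, 0 < t → t ≤ τ → ∀ i j k : Fin d,
      (∫ w : ℝ, min ((|a| + |w|) ^ 2 * w ^ 2 / (hinv i (1 / t)) ^ 2) 1 * μ i w) ≤
        c * (t ^ (α / (2 * β)) + |a| ^ α + |a| ^ 2) / t ∧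
      (∫ w : ℝ, min ((|a| + |w|) * w ^ 2 / (hinv i (1 / t)) ^ 2) 1 * μ i w) ≤
        c * (t ^ (α / (3 * β)) + |a| ^ (α / 2) + |a|) / t ∧
      (∫ w : ℝ, min ((|a| + |w|) ^ 2 * w ^ 2 / (hinv i (1 / t) * hinv j (1 / t))) 1 * μ k w) ≤
        c * (|a| ^ β * t ^ (-(β / α)) + t ^ (-(β / (2 * α)))) ∧
      (∫ w : ℝ, min ((|a| + |w|) * w ^ 2 / (hinv i (1 / t)) ^ 2) 1 * μ k w) ≤
        c * (|a| ^ (β / 2) * t ^ (-(β / α)) + t ^ (-(2 * β / (3 * α)))) := by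
  have hβ0 : 0 < β := hα.trans_le hαβ
  have hα2 : α < 2 := hαβ.trans_lt hβ
  have hnon : Nonempty (Fin d) := ⟨⟨0, hd⟩⟩
  have hpos : ∀ i, 0 < h i 1 := by
    intro i
    have h1 : h i 2 < h i 1 :=
      hanti i (Set.mem_Ioi.2 one_pos) (Set.mem_Ioi.2 two_pos) one_lt_two
    have h2 : 0 ≤ h i 2 := by
      rw [hdef i 2 two_pos]
      exact integral_nonneg fun x => mul_nonneg (by positivity) (hνnonneg i x)
    linarith
  have hR := fun i => aux_R (h i) (hinv i) α β C₁ C₂ τ hα hβ0 hC₁ hC₂ hτ (hanti i) (hinvpos i)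
    (hinvr i) (hpos i) (hlsc i) (husc i)
  choose m' M' B' hm' hM' hB' hb using hR
  obtain ⟨m, hm, hmle⟩ : ∃ m : ℝ, 0 < m ∧ ∀ i, m ≤ m' i := by
    obtain ⟨i0, hi0⟩ := Finite.exists_min m'
    exact ⟨m' i0, hm' i0, hi0⟩
  obtain ⟨M, hM, hMle⟩ : ∃ M : ℝ, 0 < M ∧ ∀ i, M' i ≤ M := by
    obtain ⟨i0, hi0⟩ := Finite.exists_max M'
    exact ⟨M' i0, hM' i0, hi0⟩
  obtain ⟨B, hB, hBle⟩ : ∃ B : ℝ, 0 < B ∧ ∀ i, B' i ≤ B := by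
    obtain ⟨i0, hi0⟩ := Finite.exists_max B'
    exact ⟨B' i0, hB' i0, hi0⟩
  have hlow : ∀ i t, 0 < t → t ≤ τ → m * t ≤ hinv i (1 / t) ^ α := fun i t ht htτ =>
    (by gcongr; exact hmle i : m * t ≤ m' i * t).trans (hb i t ht htτ).1
  have hup : ∀ i t, 0 < t → t ≤ τ → hinv i (1 / t) ^ β ≤ M * t := fun i t ht htτ =>
    (hb i t ht htτ).2.1.trans (by gcongr; exact hMle i)
  have hupB : ∀ i t, 0 < t → t ≤ τ → hinv i (1 / t) ≤ B := fun i t ht htτ =>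
    (hb i t ht htτ).2.2.trans (hBle i)
  have hμ0 : ∀ i, ∀ᵐ w, 0 ≤ μ i w := fun i => aux_ae _ (fun x hx => (hμbound i x hx).1)
    (fun x hx => by rw [hμsymm]; exact (hμbound i x hx).1)
  have hμν : ∀ i, ∀ᵐ w, μ i w ≤ ν i w := fun i => aux_ae _ (fun x hx => (hμbound i x hx).2)
    (fun x hx => by rw [hμsymm, hνsymm]; exact (hμbound i x hx).2)
  have hst : ∀ i x, 0 < x → μ i x ≤ 2 * C₀ * |x| ^ (-1 - β) := by
    intro i x hx
    rw [abs_of_pos hx]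
    rcases le_or_gt (2 * δ) x with h2 | h2
    · rw [hμzero i x h2]; positivity
    · have hx1 : x ≤ 1 := by linarith
      have : x ^ (-1 - α) ≤ x ^ (-1 - β) :=
        Real.rpow_le_rpow_of_exponent_ge hx hx1 (by linarith)
      calc μ i x ≤ ν i x := (hμbound i x hx).2
        _ ≤ C₀ * (x ^ (-1 - α) + x ^ (-1 - β)) := hνbound i x hx
        _ ≤ C₀ * (x ^ (-1 - β) + x ^ (-1 - β)) := by gcongr
        _ = _ := by ring
  have hμst : ∀ i, ∀ᵐ w, μ i w ≤ 2 * C₀ * |w| ^ (-1 - β) := fun i => aux_ae _ (hst i)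
    (fun x hx => by rw [hμsymm, abs_neg]; exact hst i x hx)
  have hνi : ∀ i, ∀ s : ℝ, 0 ≤ s → Integrable (fun w : ℝ => min 1 (s * w ^ 2) * ν i w) :=
    fun i => aux_int (ν i) (hνmeas i) (hνnonneg i) (hνint i)
  have hsti : ∀ s : ℝ, 0 ≤ s →
      Integrable (fun w : ℝ => min 1 (s * w ^ 2) * (2 * C₀ * |w| ^ (-1 - β))) := by
    intro s hs
    refine ((aux_stable β hβ0 hβ s hs).1.const_mul (2 * C₀)).congr (ae_of_all _ fun w => ?_)
    simp only []
    ring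
  set I := ∫ w : ℝ, min 1 (w ^ 2) * |w| ^ (-1 - β) with hI
  have hI0 : 0 ≤ I := integral_nonneg fun w => by positivity
  set D := 2 * C₀ * I with hD
  have hD0 : 0 ≤ D := by positivity
  have hstK : ∀ s : ℝ, 0 ≤ s →
      (∫ w : ℝ, min 1 (s * w ^ 2) * (2 * C₀ * |w| ^ (-1 - β))) = D * s ^ (β / 2) := by
    intro s hs
    have e : ∀ w : ℝ, min 1 (s * w ^ 2) * (2 * C₀ * |w| ^ (-1 - β)) =
      2 * C₀ * (min 1 (s * w ^ 2) * |w| ^ (-1 - β)) := fun w => by ring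
    simp_rw [e]
    rw [integral_const_mul, (aux_stable β hβ0 hβ s hs).2]
    ring
  set Q := 1 + 1 / C₁ with hQ
  have hQ0 : 0 < Q := by positivity
  set P1 := (1 + B ^ ((1:ℝ) * (1 - α / 2))) * M ^ (1 * α / (2 * β)) with hP1
  set P2 := (1 + B ^ ((2 / 3 : ℝ) * (1 - α / 2))) * M ^ (2 / 3 * α / (2 * β)) with hP2
  have hP10 : 0 < P1 := by positivity
  have hP20 : 0 < P2 := by positivity
  set m1 := m ^ (-(β / α)) with hm1
  set m2 := m ^ (-(β / 2 / α)) with hm2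
  set m3 := m ^ (-(2 * β / 3 / α)) with hm3
  have hm10 : 0 < m1 := by positivity
  have hm20 : 0 < m2 := by positivity
  have hm30 : 0 < m3 := by positivity
  refine ⟨2 * Q * (1 + P1) + Q * (1 + P2) + 2 * D * (m1 + m2) + D * (m1 + m3), by positivity, ?_⟩
  intro a t ht htτ i j k
  have hRi := hinvpos i (1 / t) (by positivity)
  have hRj := hinvpos j (1 / t) (by positivity)
  have ha := abs_nonneg a
  have hsq : (|a| ^ 2) ^ (α / 2) = |a| ^ α := by
    rw [← Real.rpow_natCast, ← Real.rpow_mul ha]; congr 1; push_cast; ring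
  have hsqβ : (|a| ^ 2) ^ (β / 2) = |a| ^ β := by
    rw [← Real.rpow_natCast, ← Real.rpow_mul ha]; congr 1; push_cast; ring
  have hdiv : ∀ u R : ℝ, 0 ≤ u → 0 < R → (u / R ^ 2) ^ (β / 2) = u ^ (β / 2) * R ^ (-β) := by
    intro u R hu hR
    rw [Real.div_rpow hu (by positivity), ← Real.rpow_natCast, ← Real.rpow_mul hR.le,
      Real.rpow_neg hR.le, div_eq_mul_inv]
    congr 3; push_cast; ring
  have hK := fun u hu => aux_K (ν i) (h i) α C₁ (hinv i (1 / t)) t u hα hC₁ hRi ht hu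
    (hνnonneg i) (hνi i) (hdef i) (hlsc i) (hinvr i (1 / t) (by positivity))
  refine ⟨?_, ?_, ?_, ?_⟩
  · refine (aux_A (μ i) (ν i) |a| _ ha hRi (hμ0 i) (hμν i) (hνi i)).trans ?_
    have k1 := hK (|a| ^ 2) (by positivity)
    have k2 := hK (hinv i (1 / t)) hRi.le
    have k3 := aux_up α β M B (hinv i (1 / t)) t 1 hα hα2 hβ0 hM hRi ht one_pos
      (hup i t ht htτ) (hupB i t ht htτ)
    rw [Real.rpow_one, ← hP1, one_mul] at k3
    rw [hsq] at k1
    set T := t ^ (α / (2 * β))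
    have hT : 0 ≤ T := by positivity
    have hA : 0 ≤ |a| ^ α := by positivity
    calc _ ≤ 2 * (Q * ((|a| ^ α + |a| ^ 2) / t)) + 2 * (Q * (P1 * T / t)) := by
          have : Q * ((hinv i (1 / t) ^ (α / 2) + hinv i (1 / t)) / t) ≤ Q * (P1 * T / t) := by
            gcongr
          linarith
      _ = (2 * Q * (|a| ^ α + |a| ^ 2) + 2 * Q * P1 * T) / t := by ring
      _ ≤ (2 * Q * (1 + P1) * (T + |a| ^ α + |a| ^ 2)) / t := by
          gcongr
          have : 0 ≤ 2 * Q * T + 2 * Q * P1 * (|a| ^ α + |a| ^ 2) := by positivity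
          linarith
      _ ≤ _ := by
          gcongr
          have : 0 ≤ Q * (1 + P2) + 2 * D * (m1 + m2) + D * (m1 + m3) := by positivity
          linarith
  · refine (aux_B (μ i) (ν i) |a| _ ha hRi (hμ0 i) (hμν i) (hνi i)).trans ?_
    have k1 := hK |a| ha
    have k2 := hK (hinv i (1 / t) ^ (2 / 3 : ℝ)) (by positivity)
    have k3 := aux_up α β M B (hinv i (1 / t)) t (2 / 3) hα hα2 hβ0 hM hRi ht (by norm_num)
      (hup i t ht htτ) (hupB i t ht htτ)
    rw [← hP2, show 2 / 3 * α / (2 * β) = α / (3 * β) by field_simp] at k3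
    set T := t ^ (α / (3 * β))
    have hT : 0 ≤ T := by positivity
    have hA : 0 ≤ |a| ^ (α / 2) := by positivity
    calc _ ≤ (Q * ((|a| ^ (α / 2) + |a|) / t)) + (Q * (P2 * T / t)) := by
          have : Q * (((hinv i (1 / t) ^ (2 / 3 : ℝ)) ^ (α / 2) +
            hinv i (1 / t) ^ (2 / 3 : ℝ)) / t) ≤ Q * (P2 * T / t) := by
            gcongr
          linarith
      _ = (Q * (|a| ^ (α / 2) + |a|) + Q * P2 * T) / t := by ring
      _ ≤ (Q * (1 + P2) * (T + |a| ^ (α / 2) + |a|)) / t := by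
          gcongr
          have : 0 ≤ Q * T + Q * P2 * (|a| ^ (α / 2) + |a|) := by positivity
          linarith
      _ ≤ _ := by
          gcongr
          have : 0 ≤ 2 * Q * (1 + P1) + 2 * D * (m1 + m2) + D * (m1 + m3) := by positivity
          linarith
  · obtain ⟨R, hR, hRR, hRl⟩ : ∃ R : ℝ, 0 < R ∧ R ^ 2 = hinv i (1 / t) * hinv j (1 / t) ∧
        m * t ≤ R ^ α := by
      refine ⟨√(hinv i (1 / t) * hinv j (1 / t)), by positivity, Real.sq_sqrt (by positivity), ?_⟩
      have h1 : (√(hinv i (1 / t) * hinv j (1 / t))) ^ α =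
          √(hinv i (1 / t) ^ α * hinv j (1 / t) ^ α) := by
        rw [Real.sqrt_eq_rpow, Real.sqrt_eq_rpow, ← Real.mul_rpow hRi.le hRj.le,
          ← Real.rpow_mul (by positivity), ← Real.rpow_mul (by positivity), mul_comm α]
      rw [h1]
      apply Real.le_sqrt_of_sq_le
      rw [sq]
      exact mul_le_mul (hlow i t ht htτ) (hlow j t ht htτ) (by positivity) (by positivity)
    rw [← hRR]
    refine (aux_A (μ k) _ |a| R ha hR (hμ0 k) (hμst k) hsti).trans ?_
    rw [hstK _ (by positivity), hstK _ (by positivity), hdiv _ _ (by positivity) hR,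
      hdiv _ _ hR.le hR, hsqβ, ← Real.rpow_add hR]
    have l1 := aux_low α m R t β hα hm hR ht hβ0 hRl
    have l2 := aux_low α m R t (β / 2) hα hm hR ht (by positivity) hRl
    rw [show β / 2 + -β = -(β / 2) by ring]
    rw [← hm1] at l1
    rw [← hm2, show β / 2 / α = β / (2 * α) by field_simp] at l2
    set T1 := t ^ (-(β / α))
    set T2 := t ^ (-(β / (2 * α)))
    have hT1 : 0 ≤ T1 := by positivity
    have hT2 : 0 ≤ T2 := by positivity
    have hA : 0 ≤ |a| ^ β := by positivity
    calc _ ≤ 2 * (D * (|a| ^ β * (m1 * T1))) + 2 * (D * (m2 * T2)) := by gcongr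
      _ ≤ 2 * D * (m1 + m2) * (|a| ^ β * T1 + T2) := by
          have : 0 ≤ 2 * D * (m1 * T2 + m2 * (|a| ^ β * T1)) := by positivity
          linarith
      _ ≤ _ := by
          gcongr
          have : 0 ≤ 2 * Q * (1 + P1) + Q * (1 + P2) + D * (m1 + m3) := by positivity
          linarith
  · have hRl := hlow i t ht htτ
    set R := hinv i (1 / t)
    have hR : 0 < R := hRi
    refine (aux_B (μ k) _ |a| R ha hR (hμ0 k) (hμst k) hsti).trans ?_
    rw [hstK _ (by positivity), hstK _ (by positivity), hdiv _ _ (by positivity) hR,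
      hdiv _ _ (by positivity) hR, ← Real.rpow_mul hR.le, ← Real.rpow_add hR]
    have l1 := aux_low α m R t β hα hm hR ht hβ0 hRl
    have l2 := aux_low α m R t (2 * β / 3) hα hm hR ht (by positivity) hRl
    rw [show 2 / 3 * (β / 2) + -β = -(2 * β / 3) by ring]
    rw [← hm1] at l1
    rw [← hm3, show 2 * β / 3 / α = 2 * β / (3 * α) by field_simp] at l2
    set T1 := t ^ (-(β / α))
    set T2 := t ^ (-(2 * β / (3 * α)))
    have hT1 : 0 ≤ T1 := by positivity
    have hT2 : 0 ≤ T2 := by positivity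
    have hA : 0 ≤ |a| ^ (β / 2) := by positivity
    calc _ ≤ (D * (|a| ^ (β / 2) * (m1 * T1))) + (D * (m3 * T2)) := by gcongr
      _ ≤ D * (m1 + m3) * (|a| ^ (β / 2) * T1 + T2) := by
          have : 0 ≤ D * (m1 * T2 + m3 * (|a| ^ (β / 2) * T1)) := by positivity
          linarith
      _ ≤ _ := by
          gcongr
          have : 0 ≤ 2 * Q * (1 + P1) + Q * (1 + P2) + 2 * D * (m1 + m2) := by positivity
          linarith
end

section
/- For any d∈ℕ and real numbers 𝑎_i, 𝑏_i, 𝑐_i, 𝑑_i (i=1,…,d): ∏_{i=1}^d 𝑎_i + ∏_{i=1}^d 𝑏_i − ∏_{i=1}^d 𝑐_i − ∏_{i=1}^d 𝑑_i = Σ_{j=1}^d [ Σ_{k=1}^{j−1} (∏_{i=1}^{k−1} 𝑑_i)(𝑐_k−𝑑_k)(∏_{i=k+1}^{j−1} 𝑐_i)(𝑎_j−𝑐_j)(∏_{i=j+1}^d 𝑎_i) + (∏_{i=1}^{j−1} 𝑑_i)(𝑎_j−𝑐_j−(𝑑_j−𝑏_j))(∏_{i=j+1}^d 𝑎_i) +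 Σ_{k=j+1}^d (∏_{i=1}^{j−1} 𝑑_i)(𝑑_j−𝑏_j)(∏_{i=j+1}^{k−1} 𝑏_i)(𝑎_k−𝑏_k)(∏_{i=k+1}^d 𝑎_i) ], where empty products equal 1 and empty sums equal 0. -/
theorem tele_aux (X Y : ℕ → ℝ) (m : ℕ) (hm : 1 ≤ m) (n : ℕ) :
    ∑ k ∈ Finset.Icc m n, (∏ i ∈ Finset.Icc m (k - 1), Y i) * (X k - Y k) *
      (∏ i ∈ Finset.Icc (k + 1) n, X i)
    = (∏ i ∈ Finset.Icc m n, X i) - ∏ i ∈ Finset.Icc m n, Y i := by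
  induction n with
  | zero => rw [Finset.Icc_eq_empty (by omega)]; simp
  | succ n ih =>
    by_cases h : m ≤ n + 1
    · rw [Finset.sum_Icc_succ_top h, Finset.prod_Icc_succ_top h, Finset.prod_Icc_succ_top h]
      have e : ∑ k ∈ Finset.Icc m n, (∏ i ∈ Finset.Icc m (k - 1), Y i) * (X k - Y k) *
          (∏ i ∈ Finset.Icc (k + 1) (n + 1), X i)
          = (∑ k ∈ Finset.Icc m n, (∏ i ∈ Finset.Icc m (k - 1), Y i) * (X k - Y k) *
          (∏ i ∈ Finset.Icc (k + 1) n, X i)) * X (n + 1) := by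
        rw [Finset.sum_mul]
        refine Finset.sum_congr rfl fun k hk => ?_
        rw [Finset.mem_Icc] at hk
        rw [Finset.prod_Icc_succ_top (by omega)]
        ring
      rw [e, ih, Finset.Icc_eq_empty (a := n + 1 + 1) (by omega)]
      simp
      ring
    · rw [Finset.Icc_eq_empty h]; simp

/-- algebraic identity expressing
`∏a + ∏b − ∏c − ∏d` as a double sum of telescoping terms
(indices run over `{1, …, d}`; empty products are 1 and empty sums are 0). -/
theorem stmt_14 (d : ℕ) (A B C D : ℕ → ℝ) :
    (∏ i ∈ Finset.Icc 1 d, A i) + (∏ i ∈ Finset.Icc 1 d, B i)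
      - (∏ i ∈ Finset.Icc 1 d, C i) - (∏ i ∈ Finset.Icc 1 d, D i) =
    ∑ j ∈ Finset.Icc 1 d,
      ((∑ k ∈ Finset.Icc 1 (j - 1),
          (∏ i ∈ Finset.Icc 1 (k - 1), D i) * (C k - D k) *
          (∏ i ∈ Finset.Icc (k + 1) (j - 1), C i) * (A j - C j) *
          (∏ i ∈ Finset.Icc (j + 1) d, A i))
        + (∏ i ∈ Finset.Icc 1 (j - 1), D i) * (A j - C j - (D j - B j)) *
          (∏ i ∈ Finset.Icc (j + 1) d, A i)
        + ∑ k ∈ Finset.Icc (j + 1) d,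
            (∏ i ∈ Finset.Icc 1 (j - 1), D i) * (D j - B j) *
            (∏ i ∈ Finset.Icc (j + 1) (k - 1), B i) * (A k - B k) *
            (∏ i ∈ Finset.Icc (k + 1) d, A i)) := by
  rw [show ∀ a b c e : ℝ, a + b - c - e = (a - c) + (b - e) by intros; ring,
    ← tele_aux A C 1 le_rfl d, ← tele_aux B D 1 le_rfl d, ← Finset.sum_add_distrib]
  refine Finset.sum_congr rfl fun j _ => ?_
  have h1 := tele_aux C D 1 le_rfl (j - 1)
  have h2 := tele_aux A B (j + 1) (by omega) d
  have e1 : ∑ k ∈ Finset.Icc 1 (j - 1),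
          (∏ i ∈ Finset.Icc 1 (k - 1), D i) * (C k - D k) *
          (∏ i ∈ Finset.Icc (k + 1) (j - 1), C i) * (A j - C j) *
          (∏ i ∈ Finset.Icc (j + 1) d, A i) =
      ((∏ i ∈ Finset.Icc 1 (j - 1), C i) - ∏ i ∈ Finset.Icc 1 (j - 1), D i) * (A j - C j) *
          (∏ i ∈ Finset.Icc (j + 1) d, A i) := by
    rw [← h1, Finset.sum_mul, Finset.sum_mul]
  have e2 : ∑ k ∈ Finset.Icc (j + 1) d,
            (∏ i ∈ Finset.Icc 1 (j - 1), D i) * (D j - B j) *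
            (∏ i ∈ Finset.Icc (j + 1) (k - 1), B i) * (A k - B k) *
            (∏ i ∈ Finset.Icc (k + 1) d, A i) =
      (∏ i ∈ Finset.Icc 1 (j - 1), D i) * (D j - B j) *
        ((∏ i ∈ Finset.Icc (j + 1) d, A i) - ∏ i ∈ Finset.Icc (j + 1) d, B i) := by
    rw [← h2, Finset.mul_sum]
    refine Finset.sum_congr rfl fun k _ => ?_
    ring
  rw [e1, e2]
  ring
end

section
/- Assume ε ≤ 1/(η₁ d√d). For any t∈(0,τ+1] and x,y∈ℝ^d one has r_y(t,x−y) ≤ c₁·(∏_{i=1}^d 1/h_i^{−1}(1/t))·e^{−c|x−y|}; moreover for any t∈(0,τ+1] and x,y∈ℝ^d with |x−y| ≥ εη₁d^{3/2}, one has r_y(t,x−y) ≤ c₁·t·e^{−c|x−y|}, where c,c₁>0 are constants independent of t, x, y. -/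
open Filter MeasureTheory

theorem tg_aux (h hinv : ℝ → ℝ) (α C₁ τ ε p : ℝ) (hα : 0 < α) (hC₁ : 0 < C₁)
    (hτ : 0 < τ) (hε0 : 0 < ε) (hp : 0 < p)
    (hpos : ∀ r : ℝ, 0 < r → 0 ≤ h r)
    (hanti : StrictAntiOn h (Set.Ioi 0))
    (hinvpos : ∀ s : ℝ, 0 < s → 0 < hinv s)
    (hinvr : ∀ s : ℝ, 0 < s → h (hinv s) = s)
    (hlsc : ∀ θ : ℝ, 0 < θ → ∀ l : ℝ, 1 ≤ l → C₁ * l ^ α * h (l * θ) ≤ h θ) :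
    ∃ K : ℝ, 0 < K ∧ ∀ t : ℝ, 0 < t → t ≤ τ + 1 → ∀ w : ℝ,
      0 ≤ tg h hinv τ ε p t w ∧
      tg h hinv τ ε p t w ≤ K * (1 / hinv (1 / t)) * Real.exp (-|w|) ∧
      tg h hinv τ ε p t w ≤ K * t ^ (-(1 / α)) * Real.exp (-|w|) ∧
      (ε ≤ |w| → tg h hinv τ ε p t w ≤ K * t ^ p * Real.exp (-|w|)) := by
  have hT : 0 < τ + 1 := by linarith
  obtain ⟨T, hTdef⟩ : ∃ T, T = τ + 1 := ⟨_, rfl⟩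
  rw [← hTdef] at hT ⊢
  obtain ⟨R, hR⟩ : ∃ R, R = hinv (1 / T) := ⟨_, rfl⟩
  have hRpos : 0 < R := hR ▸ hinvpos _ (by positivity)
  have hhR : h R = 1 / T := by rw [hR]; exact hinvr _ (by positivity)
  obtain ⟨c, hc⟩ : ∃ c, c = min (1 / hinv (1 / τ)) (τ * h ε / ε) * Real.exp ε / τ ^ p := ⟨_, rfl⟩
  have hc0 : 0 ≤ c := by
    have h1 := hinvpos (1 / τ) (by positivity)
    have h2 := hpos ε hε0
    rw [hc]
    have : 0 ≤ min (1 / hinv (1 / τ)) (τ * h ε / ε) := le_min (by positivity) (by positivity)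
    positivity
  have hle : ∀ t, 0 < t → t ≤ T → hinv (1 / t) ≤ R := by
    intro t ht htT
    by_contra hcon
    push Not at hcon
    have h1 := hanti (Set.mem_Ioi.2 hRpos) (Set.mem_Ioi.2 (hRpos.trans hcon)) hcon
    rw [hhR, hinvr _ (by positivity)] at h1
    have := one_div_le_one_div_of_le ht htT
    linarith
  obtain ⟨κ, hκ⟩ : ∃ κ, κ = (C₁ * R ^ α / T) ^ (1 / α) := ⟨_, rfl⟩
  have hκ0 : 0 < κ := by rw [hκ]; positivity
  have hlow : ∀ t, 0 < t → t ≤ T → 1 / hinv (1 / t) ≤ κ⁻¹ * t ^ (-(1 / α)) := by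
    intro t ht htT
    have hθ := hinvpos (1 / t) (by positivity)
    have h0 := hle t ht htT
    have h2 := hinvr (1 / t) (by positivity)
    obtain ⟨θ, hθd⟩ : ∃ θ, θ = hinv (1 / t) := ⟨_, rfl⟩
    rw [← hθd] at hθ h0 h2 ⊢
    have h1 := hlsc θ hθ (R / θ) ((one_le_div hθ).2 h0)
    rw [div_mul_cancel₀ _ hθ.ne', hhR, h2, Real.div_rpow hRpos.le hθ.le] at h1
    have h3 : C₁ * R ^ α / T * t ≤ θ ^ α := by
      have : 0 < θ ^ α := by positivity
      have e : C₁ * (R ^ α / θ ^ α) * (1 / T) = (C₁ * R ^ α / T) / θ ^ α := by ring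
      rw [e, div_le_div_iff₀ this ht] at h1
      linarith
    have h4 : κ * t ^ (1 / α) ≤ θ := by
      have := Real.rpow_le_rpow (by positivity) h3 (show 0 ≤ 1 / α by positivity)
      rw [Real.mul_rpow (by positivity) ht.le, ← Real.rpow_mul hθ.le,
        mul_one_div_cancel hα.ne', Real.rpow_one, ← hκ] at this
      exact this
    rw [Real.rpow_neg ht.le, ← mul_inv, ← one_div]
    exact one_div_le_one_div_of_le (by positivity) h4
  obtain ⟨K₀, hK₀⟩ : ∃ K₀, K₀ = Real.exp ε + c * T ^ p * R := ⟨_, rfl⟩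
  have hK₀0 : 0 < K₀ := by rw [hK₀]; positivity
  have hfar : ∀ t w, ε ≤ |w| → tg h hinv τ ε p t w = c * (t ^ p * Real.exp (-|w|)) := by
    intro t w hw
    have : w ≠ 0 := by
      rintro rfl
      simp at hw; linarith
    rw [tg, if_neg this, if_neg (not_lt.2 hw), hc]
  have hnear : ∀ t w, 0 < t → |w| < ε → 0 ≤ tg h hinv τ ε p t w ∧
      tg h hinv τ ε p t w ≤ 1 / hinv (1 / t) := by
    intro t w ht hw
    have h1 := hinvpos (1 / t) (by positivity)
    rw [tg]
    split_ifs with h0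
    · exact ⟨by positivity, le_rfl⟩
    · have h3 : 0 < |w| := abs_pos.2 h0
      have h2 := hpos |w| h3
      exact ⟨le_min (by positivity) (by positivity), min_le_left _ _⟩
  have hmain : ∀ t, 0 < t → t ≤ T → ∀ w, 
      tg h hinv τ ε p t w ≤ K₀ * (1 / hinv (1 / t)) * Real.exp (-|w|) := by
    intro t ht htT w
    have hθ := hinvpos (1 / t) (by positivity)
    have h0 := hle t ht htT
    obtain ⟨H, hH⟩ : ∃ H, H = 1 / hinv (1 / t) := ⟨_, rfl⟩
    have hH0 : 0 < H := by rw [hH]; positivity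
    have hRH : 1 ≤ R * H := by
      rw [hH, mul_one_div]; exact (one_le_div hθ).2 h0
    rw [← hH]
    rcases lt_or_ge |w| ε with hw | hw
    · have h1 := (hnear t w ht hw).2
      rw [← hH] at h1
      have h2 : 1 ≤ Real.exp ε * Real.exp (-|w|) := by
        rw [← Real.exp_add]; exact Real.one_le_exp (by linarith)
      have h3 : 0 ≤ c * T ^ p * R * H * Real.exp (-|w|) := by positivity
      have h4 := mul_le_mul_of_nonneg_left h2 hH0.le
      rw [hK₀]
      nlinarith
    · rw [hfar t w hw]
      have h1 : t ^ p ≤ T ^ p := Real.rpow_le_rpow ht.le htT hp.le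
      have h2 : t ^ p ≤ T ^ p * (R * H) :=
        h1.trans (le_mul_of_one_le_right (by positivity) hRH)
      calc c * (t ^ p * Real.exp (-|w|)) ≤ c * (T ^ p * (R * H) * Real.exp (-|w|)) := by gcongr
        _ = (c * T ^ p * R) * H * Real.exp (-|w|) := by ring
        _ ≤ K₀ * H * Real.exp (-|w|) := by
          have : c * T ^ p * R ≤ K₀ := by rw [hK₀]; linarith [Real.exp_pos ε]
          gcongr
  refine ⟨K₀ + K₀ * κ⁻¹ + c, by positivity, ?_⟩
  intro t ht htT w
  have hθ := hinvpos (1 / t) (by positivity)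
  have hm := hmain t ht htT w
  have hk : 0 < κ⁻¹ := by positivity
  refine ⟨?_, ?_, ?_, ?_⟩
  · rcases lt_or_ge |w| ε with hw | hw
    · exact (hnear t w ht hw).1
    · rw [hfar t w hw]; positivity
  · refine hm.trans ?_
    have : K₀ ≤ K₀ + K₀ * κ⁻¹ + c := by nlinarith
    gcongr
  · refine hm.trans ?_
    calc _ ≤ K₀ * (κ⁻¹ * t ^ (-(1 / α))) * Real.exp (-|w|) := by
            gcongr; exact hlow t ht htT
      _ = (K₀ * κ⁻¹) * t ^ (-(1 / α)) * Real.exp (-|w|) := by ring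
      _ ≤ _ := by
        have : K₀ * κ⁻¹ ≤ K₀ + K₀ * κ⁻¹ + c := by linarith
        gcongr
  · intro hw
    rw [hfar t w hw, ← mul_assoc]
    have : c ≤ K₀ + K₀ * κ⁻¹ + c := by nlinarith
    gcongr

/-- exponential off-diagonal bounds for
`r_y(t,x) = ∏ᵢ tilde-g_{i,t}^{(ε)}(bᵢ(y)·x)`, assuming `ε ≤ 1/(η₁ d √d)`. -/
theorem stmt_15 (d : ℕ) (hd : 2 ≤ d)
    (ν h hinv : Fin d → ℝ → ℝ)
    (α β C₁ C₂ η₁ η₂ η₃ τ ε : ℝ)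
    (hα : 0 < α) (hαβ : α ≤ β) (hβ : β < 2) (hC₁ : 0 < C₁) (hC₂ : 0 < C₂)
    (hη₁ : 1 ≤ η₁) (hη₂ : 0 < η₂) (hη₃ : 1 ≤ η₃) (hτ : 0 < τ)
    (hε0 : 0 < ε) (hε1 : ε ≤ 1)
    (hεd : ε ≤ 1 / (η₁ * d * Real.sqrt d))
    -- each ν i is the density of a symmetric infinite Lévy measure on ℝ
    (hνmeas : ∀ i, Measurable (ν i))
    (hνnonneg : ∀ i, ∀ x : ℝ, 0 ≤ ν i x)
    (hνsymm : ∀ i, ∀ x : ℝ, ν i (-x) = ν i x)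
    (hνint : ∀ i, Integrable (fun x : ℝ => min (x ^ 2) 1 * ν i x))
    (hνinf : ∀ i, ¬ Integrable (ν i))
    -- h i and its inverse
    (hdef : ∀ i, ∀ r : ℝ, 0 < r → h i r = ∫ x : ℝ, min 1 (x ^ 2 / r ^ 2) * ν i x)
    (hcont : ∀ i, ContinuousOn (h i) (Set.Ioi 0))
    (hanti : ∀ i, StrictAntiOn (h i) (Set.Ioi 0))
    (hlim0 : ∀ i, Tendsto (h i) (nhdsWithin 0 (Set.Ioi 0)) atTop)
    (hlimtop : ∀ i, Tendsto (h i) atTop (nhds 0))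
    (hinvpos : ∀ i, ∀ s : ℝ, 0 < s → 0 < hinv i s)
    (hinvr : ∀ i, ∀ s : ℝ, 0 < s → h i (hinv i s) = s)
    (hinvl : ∀ i, ∀ r : ℝ, 0 < r → hinv i (h i r) = r)
    -- scaling conditions
    (hlsc : ∀ i, ∀ θ : ℝ, 0 < θ → ∀ l : ℝ, 1 ≤ l → C₁ * l ^ α * h i (l * θ) ≤ h i θ)
    (husc : ∀ i, ∀ θ : ℝ, 0 < θ → θ ≤ 1 → ∀ l : ℝ, 0 < l → l ≤ 1 →
      h i (l * θ) ≤ C₂ * l ^ (-β) * h i θ)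
    -- the matrix A and its inverse B = A⁻¹
    (A : EuclideanSpace ℝ (Fin d) → Matrix (Fin d) (Fin d) ℝ)
    (hAbd : ∀ x i j, |A x i j| ≤ η₁)
    (hAdet : ∀ x, η₂ ≤ (A x).det)
    (hALip : ∀ x y i j, |A x i j - A y i j| ≤ η₃ * ‖x - y‖)
    (hBbd : ∀ x i j, |(A x)⁻¹ i j| ≤ η₁)
    (hBLip : ∀ x y i j, |(A x)⁻¹ i j - (A y)⁻¹ i j| ≤ η₃ * ‖x - y‖) :
    ∃ c c₁ : ℝ, 0 < c ∧ 0 < c₁ ∧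
      ∀ t : ℝ, 0 < t → t ≤ τ + 1 → ∀ x y : EuclideanSpace ℝ (Fin d),
        (∏ i, tg (h i) (hinv i) τ ε ((d + β - 1) / α) t
            (∑ j, (A y)⁻¹ i j * (x - y) j)) ≤
          c₁ * (∏ i, 1 / hinv i (1 / t)) * Real.exp (-c * ‖x - y‖) ∧
        (ε * η₁ * (d : ℝ) ^ ((3 : ℝ) / 2) ≤ ‖x - y‖ →
          (∏ i, tg (h i) (hinv i) τ ε ((d + β - 1) / α) t
              (∑ j, (A y)⁻¹ i j * (x - y) j)) ≤
            c₁ * t * Real.exp (-c * ‖x - y‖)) := by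
  have hd0 : (2 : ℝ) ≤ d := by exact_mod_cast hd
  have hp : 0 < ((d : ℝ) + β - 1) / α := div_pos (by linarith) hα
  have hpos : ∀ i, ∀ r : ℝ, 0 < r → 0 ≤ h i r := by
    intro i r hr
    rw [hdef i r hr]
    exact integral_nonneg fun x => mul_nonneg (le_min zero_le_one (by positivity)) (hνnonneg i x)
  have key := fun i => tg_aux (h i) (hinv i) α C₁ τ ε (((d : ℝ) + β - 1) / α) hα hC₁ hτ hε0 hp
    (hpos i) (hanti i) (hinvpos i) (hinvr i) (hlsc i)
  choose K hK0 hK using key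
  have hPK : 0 < ∏ i, K i := Finset.prod_pos fun i _ => hK0 i
  have hT : 0 < τ + 1 := by linarith
  have hTp : 0 < (τ + 1) ^ (β / α - 1) := by positivity
  refine ⟨1 / (d * η₁), (∏ i, K i) * (1 + (τ + 1) ^ (β / α - 1)), by positivity, by positivity, ?_⟩
  intro t ht htT x y
  obtain ⟨z, hz⟩ : ∃ z, z = x - y := ⟨_, rfl⟩
  rw [← hz]
  obtain ⟨w, hw⟩ : ∃ w : Fin d → ℝ, w = fun i => ∑ j, (A y)⁻¹ i j * z j := ⟨_, rfl⟩
  have hw' : ∀ i, ∑ j, (A y)⁻¹ i j * z j = w i := fun i => by rw [hw]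
  simp only [hw']
  have hzw : ∀ i, z i = ∑ j, A y i j * w j := by
    have h1 : w = (A y)⁻¹.mulVec z.ofLp := by rw [hw]; rfl
    have h2 : (A y).mulVec w = z.ofLp := by
      have hu : IsUnit (A y).det := isUnit_iff_ne_zero.2 (by linarith [hAdet y])
      rw [h1, Matrix.mulVec_mulVec, Matrix.mul_nonsing_inv _ hu, Matrix.one_mulVec]
    intro i
    rw [← congrFun h2 i]; rfl
  have hzi : ∀ i, |z i| ≤ η₁ * ∑ j, |w j| := by
    intro i
    rw [hzw i, Finset.mul_sum]
    refine (Finset.abs_sum_le_sum_abs _ _).trans (Finset.sum_le_sum fun j _ => ?_)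
    rw [abs_mul]
    exact mul_le_mul_of_nonneg_right (hAbd y i j) (abs_nonneg _)
  have hnorm : ∀ S : ℝ, 0 ≤ S → (∀ i, |z i| ≤ S) → ‖z‖ ≤ Real.sqrt d * S := by
    intro S hS hi
    rw [EuclideanSpace.norm_eq]
    refine Real.sqrt_le_iff.2 ⟨by positivity, ?_⟩
    rw [mul_pow, Real.sq_sqrt (by positivity)]
    calc ∑ i, ‖z i‖ ^ 2 ≤ ∑ i : Fin d, S ^ 2 := by
          refine Finset.sum_le_sum fun i _ => ?_
          rw [Real.norm_eq_abs]
          exact pow_le_pow_left₀ (abs_nonneg _) (hi i) 2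
      _ = d * S ^ 2 := by simp
  have hsum0 : 0 ≤ ∑ j, |w j| := Finset.sum_nonneg fun _ _ => abs_nonneg _
  have hexp : ∏ i, Real.exp (-|w i|) ≤ Real.exp (-(1 / (d * η₁)) * ‖z‖) := by
    rw [← Real.exp_sum, Real.exp_le_exp, Finset.sum_neg_distrib, neg_mul, neg_le_neg_iff]
    have h1 := hnorm _ (by positivity) hzi
    have h2 : Real.sqrt d ≤ d := by
      rw [Real.sqrt_le_left (by positivity)]; nlinarith
    have h3 : ‖z‖ ≤ d * (η₁ * ∑ j, |w j|) := h1.trans (by gcongr)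
    rw [one_div_mul_eq_div, div_le_iff₀ (by positivity)]
    linarith
  constructor
  · have h1 : (∏ i, tg (h i) (hinv i) τ ε (((d : ℝ) + β - 1) / α) t (w i)) ≤
        ∏ i, (K i * (1 / hinv i (1 / t)) * Real.exp (-|w i|)) :=
      Finset.prod_le_prod (fun i _ => (hK i t ht htT (w i)).1)
        (fun i _ => (hK i t ht htT (w i)).2.1)
    rw [Finset.prod_mul_distrib, Finset.prod_mul_distrib] at h1
    have hH : 0 < ∏ i, 1 / hinv i (1 / t) :=
      Finset.prod_pos fun i _ => by
        have := hinvpos i (1 / t) (by positivity)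
        positivity
    refine h1.trans ?_
    have : (∏ i, K i) ≤ (∏ i, K i) * (1 + (τ + 1) ^ (β / α - 1)) := by nlinarith
    gcongr
  · intro hzl
    have hex : ∃ i, ε ≤ |w i| := by
      by_contra hcon
      push Not at hcon
      have hne : (Finset.univ : Finset (Fin d)).Nonempty := ⟨⟨0, by omega⟩, Finset.mem_univ _⟩
      have hlt : ∑ j, |w j| < d * ε := by
        calc ∑ j, |w j| < ∑ j : Fin d, ε := Finset.sum_lt_sum_of_nonempty hne fun i _ => hcon i
          _ = d * ε := by simp
      have h1 := hnorm _ (by positivity) hzi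
      have hs : 0 < Real.sqrt d := Real.sqrt_pos.2 (by linarith)
      have e : (d : ℝ) ^ ((3 : ℝ) / 2) = d * Real.sqrt d := by
        rw [Real.sqrt_eq_rpow, show (3 : ℝ) / 2 = 1 + 1 / 2 by norm_num,
          Real.rpow_add (by linarith), Real.rpow_one]
      rw [e] at hzl
      have h2 : Real.sqrt d * (η₁ * ∑ j, |w j|) < Real.sqrt d * (η₁ * (d * ε)) := by gcongr
      linarith
    obtain ⟨i₀, hi₀⟩ := hex
    have h1 : (∏ i, tg (h i) (hinv i) τ ε (((d : ℝ) + β - 1) / α) t (w i)) ≤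
        ∏ i, (K i * t ^ (if i = i₀ then ((d : ℝ) + β - 1) / α else -(1 / α)) *
          Real.exp (-|w i|)) := by
      refine Finset.prod_le_prod (fun i _ => (hK i t ht htT (w i)).1) (fun i _ => ?_)
      split_ifs with hi
      · exact (hK i t ht htT (w i)).2.2.2 (hi ▸ hi₀)
      · exact (hK i t ht htT (w i)).2.2.1
    rw [Finset.prod_mul_distrib, Finset.prod_mul_distrib,
      ← Real.rpow_sum_of_pos ht] at h1
    have hs : ∑ i : Fin d, (if i = i₀ then ((d : ℝ) + β - 1) / α else -(1 / α)) = β / α := by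
      have : ∀ i : Fin d, (if i = i₀ then ((d : ℝ) + β - 1) / α else -(1 / α)) =
          -(1 / α) + if i = i₀ then ((d : ℝ) + β - 1) / α + 1 / α else 0 := by
        intro i; split_ifs <;> ring
      rw [Finset.sum_congr rfl fun i _ => this i, Finset.sum_add_distrib]
      simp
      field_simp
      ring
    rw [hs] at h1
    have h2 : t ^ (β / α) ≤ (1 + (τ + 1) ^ (β / α - 1)) * t := by
      have : t ^ (β / α) = t ^ (β / α - 1) * t := by
        rw [Real.rpow_sub_one ht.ne', div_mul_cancel₀ _ ht.ne']
      rw [this]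
      have h3 : t ^ (β / α - 1) ≤ (τ + 1) ^ (β / α - 1) :=
        Real.rpow_le_rpow ht.le htT (by rw [sub_nonneg, one_le_div hα]; exact hαβ)
      gcongr
      linarith
    refine h1.trans ?_
    rw [mul_assoc (∏ i, K i) _ t]
    gcongr
end
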